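/- Suppose (a_n) is a sequence of positive integers with a_n ≤ p^n for all n, and suppose the set of limit points of the sequence (1/n)·log a_n is infinite. Then the power series ζ(z) = exp(∑_{n≥1} a_n z^n / n) is not a rational function of z. -/

import Mathlib

open Filter

namespace Sub
open MvPolynomial

/-- sum of the norms of the coefficients -/
noncomputable def L1 {σ R : Type*} [NormedCommRing R] (f : MvPolynomial σ R) : ℝ :=
  ∑ m ∈ f.support, ‖f.coeff m‖

section L1
variable {σ R : Type*} [NormedCommRing R]

lemma L1_eq_of_subset (f : MvPolynomial σ R) {s : Finset (σ →₀ ℕ)} (h : f.support ⊆ s) :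
    L1 f = ∑ m ∈ s, ‖f.coeff m‖ := by
  refine Finset.sum_subset h ?_
  intro m _ hm
  simp [notMem_support_iff.mp hm]

lemma L1_nonneg (f : MvPolynomial σ R) : 0 ≤ L1 f :=
  Finset.sum_nonneg fun _ _ => norm_nonneg _

@[simp] lemma L1_zero : L1 (0 : MvPolynomial σ R) = 0 := by simp [L1]

lemma L1_add_le (f g : MvPolynomial σ R) : L1 (f + g) ≤ L1 f + L1 g := by
  classical
  have h1 : f.support ⊆ f.support ∪ g.support := Finset.subset_union_left
  have h2 : g.support ⊆ f.support ∪ g.support := Finset.subset_union_right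
  rw [L1_eq_of_subset f h1, L1_eq_of_subset g h2, L1_eq_of_subset (f + g) support_add,
    ← Finset.sum_add_distrib]
  exact Finset.sum_le_sum fun m _ => by rw [coeff_add]; exact norm_add_le _ _

lemma L1_sum_le {α : Type*} (s : Finset α) (f : α → MvPolynomial σ R) :
    L1 (∑ i ∈ s, f i) ≤ ∑ i ∈ s, L1 (f i) := by
  classical
  induction s using Finset.induction_on with
  | empty => simp
  | insert a s ha ih =>
    rw [Finset.sum_insert ha, Finset.sum_insert ha]
    exact (L1_add_le _ _).trans (by linarith)

lemma L1_monomial (m : σ →₀ ℕ) (a : R) : L1 (monomial m a) = ‖a‖ := by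
  classical
  rw [L1_eq_of_subset _ support_monomial_subset]
  simp

lemma L1_neg (f : MvPolynomial σ R) : L1 (-f) = L1 f := by
  simp [L1]

lemma coeff_le_L1 (f : MvPolynomial σ R) (m : σ →₀ ℕ) : ‖f.coeff m‖ ≤ L1 f := by
  by_cases h : m ∈ f.support
  · exact Finset.single_le_sum (f := fun m => ‖f.coeff m‖) (fun _ _ => norm_nonneg _) h
  · rw [notMem_support_iff.mp h]; simpa using L1_nonneg f

lemma L1_mul_le (f g : MvPolynomial σ R) : L1 (f * g) ≤ L1 f * L1 g := by
  have : f * g = ∑ m ∈ f.support, ∑ n ∈ g.support, monomial (m + n) (f.coeff m * g.coeff n) := by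
    conv_lhs => rw [f.as_sum, g.as_sum, Finset.sum_mul_sum]
    simp [monomial_mul]
  rw [this]
  have e : L1 f * L1 g = ∑ m ∈ f.support, ∑ n ∈ g.support, ‖f.coeff m‖ * ‖g.coeff n‖ :=
    Finset.sum_mul_sum _ _ _ _
  rw [e]
  refine (L1_sum_le _ _).trans (Finset.sum_le_sum fun m _ => ?_)
  refine (L1_sum_le _ _).trans (Finset.sum_le_sum fun n _ => ?_)
  rw [L1_monomial]; exact norm_mul_le _ _

lemma L1_C (a : R) : L1 (C a : MvPolynomial σ R) = ‖a‖ := L1_monomial 0 a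

lemma L1_X [NormOneClass R] (i : σ) : L1 (X i : MvPolynomial σ R) = 1 := by
  rw [X, L1_monomial]; simp

lemma L1_one [NormOneClass R] : L1 (1 : MvPolynomial σ R) = 1 := by
  rw [← C_1, L1_C]; simp

lemma L1_prod_le [NormOneClass R] {α : Type*} (s : Finset α) (f : α → MvPolynomial σ R) :
    L1 (∏ i ∈ s, f i) ≤ ∏ i ∈ s, L1 (f i) := by
  classical
  induction s using Finset.induction_on with
  | empty => simp [L1_one]
  | insert a s ha ih =>
    rw [Finset.prod_insert ha, Finset.prod_insert ha]
    exact (L1_mul_le _ _).trans (mul_le_mul_of_nonneg_left ih (L1_nonneg _))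

lemma L1_pow_le [NormOneClass R] (f : MvPolynomial σ R) (n : ℕ) : L1 (f ^ n) ≤ L1 f ^ n := by
  have := L1_prod_le (Finset.range n) (fun _ => f)
  simpa using this

lemma one_le_L1_int {σ : Type*} (f : MvPolynomial σ ℤ) (hf : f ≠ 0) : 1 ≤ L1 f := by
  obtain ⟨m, hm⟩ := ne_zero_iff.mp hf
  refine le_trans ?_ (coeff_le_L1 f m)
  rw [Int.norm_eq_abs]
  exact_mod_cast Int.one_le_abs hm

/-- evaluation in a polynomial ring -/
lemma L1_eval₂_le {τ S : Type*} [NormedCommRing S] [NormOneClass S] (φ : R →+* MvPolynomial τ S)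
    (v : σ → MvPolynomial τ S) (f : MvPolynomial σ R) :
    L1 (eval₂ φ v f) ≤ ∑ m ∈ f.support, L1 (φ (f.coeff m)) * m.prod fun i e => L1 (v i) ^ e := by
  rw [eval₂_eq]
  refine (L1_sum_le _ _).trans (Finset.sum_le_sum fun m _ => ?_)
  refine (L1_mul_le _ _).trans (mul_le_mul_of_nonneg_left ?_ (L1_nonneg _))
  refine (L1_prod_le _ _).trans ?_
  exact Finset.prod_le_prod (fun _ _ => L1_nonneg _) fun i _ => L1_pow_le _ _

end L1

section hd
variable {σ R : Type*} [CommRing R]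

/-- the shift `f(X+Y)` -/
noncomputable def sh : MvPolynomial σ R →+* MvPolynomial σ (MvPolynomial σ R) :=
  eval₂Hom (C.comp C) (fun i => C (X i) + X i)

/-- Hasse derivative -/
noncomputable def hd (μ : σ →₀ ℕ) (f : MvPolynomial σ R) : MvPolynomial σ R := coeff μ (sh f)

@[simp] lemma sh_X (i : σ) : sh (X i : MvPolynomial σ R) = C (X i) + X i := by simp [sh]
@[simp] lemma sh_C (a : R) : sh (C a : MvPolynomial σ R) = C (C a) := by simp [sh]

end hd

section hdf
variable {σ R : Type*} [CommRing R] [Fintype σ]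

lemma coeff_hd (μ m : σ →₀ ℕ) (f : MvPolynomial σ R) :
    coeff m (hd μ f) = (∏ i, ((m i + μ i).choose (μ i) : R)) * coeff (m + μ) f := by
  classical
  unfold hd
  induction f using MvPolynomial.induction_on generalizing μ m with
  | C a =>
    simp only [sh_C, coeff_C]
    by_cases hμ : μ = 0
    · subst hμ
      simp [coeff_C]
    · have : ¬ (0 = m + μ) := by
        intro h
        apply hμ
        ext i
        have := DFunLike.congr_fun h i
        simp at this; simp; omega
      simp [Ne.symm hμ, this]
  | add p q hp hq => simp only [map_add, coeff_add, hp, hq]; ring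
  | mul_X p j hp =>
    rw [map_mul, sh_X, mul_add, coeff_add, coeff_mul_X', coeff_add, mul_comm (sh p) (C _),
      coeff_C_mul, mul_comm (X j), coeff_mul_X', coeff_mul_X']
    have split : ∀ g : σ → R, ∏ i, g i = g j * ∏ i ∈ Finset.univ.erase j, g i := fun g =>
      (Finset.mul_prod_erase _ _ (Finset.mem_univ j)).symm
    have hm : ∀ a : σ →₀ ℕ, j ∈ a.support ↔ 1 ≤ a j := fun a => by
      rw [Finsupp.mem_support_iff]; omega
    simp only [hm, Finsupp.add_apply]
    have e1 : ∀ a : σ →₀ ℕ, ∀ i ∈ Finset.univ.erase j, (a - Finsupp.single j 1 : σ →₀ ℕ) i = a i := by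
      intro a i hi
      have : j ≠ i := (Finset.ne_of_mem_erase hi).symm
      simp [Finsupp.single_eq_of_ne' this]
    have e2 : ∀ a : σ →₀ ℕ, (a - Finsupp.single j 1 : σ →₀ ℕ) j = a j - 1 := fun a => by simp
    have sub1 : 1 ≤ m j → m + μ - Finsupp.single j 1 = (m - Finsupp.single j 1) + μ := by
      intro h; ext i
      by_cases hij : i = j
      · subst hij; simp; omega
      · simp [Finsupp.single_eq_of_ne hij]
    have sub2 : 1 ≤ μ j → m + μ - Finsupp.single j 1 = m + (μ - Finsupp.single j 1) := by
      intro h; ext i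
      by_cases hij : i = j
      · subst hij; simp; omega
      · simp [Finsupp.single_eq_of_ne hij]
    have P1 : ∏ i ∈ Finset.univ.erase j, ((((m - Finsupp.single j 1 : σ →₀ ℕ) i + μ i).choose (μ i) : ℕ) : R)
        = ∏ i ∈ Finset.univ.erase j, (((m i + μ i).choose (μ i) : ℕ) : R) :=
      Finset.prod_congr rfl fun i hi => by rw [e1 m i hi]
    have P2 : ∏ i ∈ Finset.univ.erase j, (((m i + (μ - Finsupp.single j 1 : σ →₀ ℕ) i).choose
          ((μ - Finsupp.single j 1 : σ →₀ ℕ) i) : ℕ) : R)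
        = ∏ i ∈ Finset.univ.erase j, (((m i + μ i).choose (μ i) : ℕ) : R) :=
      Finset.prod_congr rfl fun i hi => by rw [e1 μ i hi]
    have A1 : (if 1 ≤ m j then coeff (m - Finsupp.single j 1) (coeff μ (sh p)) else 0)
        = if 1 ≤ m j then ((m j - 1 + μ j).choose (μ j) : R) *
          (∏ i ∈ Finset.univ.erase j, (((m i + μ i).choose (μ i) : ℕ) : R)) *
            coeff (m + μ - Finsupp.single j 1) p else 0 := by
      split_ifs with h
      · rw [hp, split, P1, e2, sub1 h]
      · rfl
    have A2 : coeff m (if 1 ≤ μ j then coeff (μ - Finsupp.single j 1) (sh p) else 0)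
        = if 1 ≤ μ j then ((m j + (μ j - 1)).choose (μ j - 1) : R) *
          (∏ i ∈ Finset.univ.erase j, (((m i + μ i).choose (μ i) : ℕ) : R)) *
            coeff (m + μ - Finsupp.single j 1) p else 0 := by
      split_ifs with h
      · rw [hp, split, P2, e2, sub2 h]
      · simp
    rw [A1, A2, split]
    rcases Nat.eq_zero_or_pos (m j) with h1 | h1 <;> rcases Nat.eq_zero_or_pos (μ j) with h2 | h2
    · simp [h1, h2]
    · have : 1 ≤ μ j := h2
      simp [h1, this]
    · have : 1 ≤ m j := h1
      simp [h2, this]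
    · obtain ⟨a, ha⟩ : ∃ a, m j = a + 1 := ⟨m j - 1, by omega⟩
      obtain ⟨b, hb⟩ : ∃ b, μ j = b + 1 := ⟨μ j - 1, by omega⟩
      have hc : (a + 1 + (b + 1)).choose (b + 1) = (a + (b + 1)).choose (b + 1) +
          (a + 1 + b).choose b := by
        have := Nat.choose_succ_succ (a + b + 1) b
        rw [show a + 1 + (b + 1) = a + b + 1 + 1 by ring, this,
          show a + (b + 1) = a + b + 1 by ring, show a + 1 + b = a + b + 1 by ring]
        simp only [Nat.succ_eq_add_one]; ring
      simp only [ha, hb]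
      rw [if_pos (by omega), if_pos (by omega), if_pos (by omega)]
      rw [hc]
      simp only [Nat.add_sub_cancel]
      push_cast
      ring

end hdf

/-- translation -/
noncomputable def tr {σ R : Type*} [CommRing R] (ξ : σ → R) : MvPolynomial σ R →ₐ[R] MvPolynomial σ R :=
  aeval fun i => X i + C (ξ i)

lemma hd_tr {σ R : Type*} [CommRing R] (ξ : σ → R) (μ : σ →₀ ℕ) (f : MvPolynomial σ R) :
    hd μ (tr ξ f) = tr ξ (hd μ f) := by
  have : (sh : MvPolynomial σ R →+* _).comp (tr ξ).toRingHom =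
      (MvPolynomial.map (tr ξ).toRingHom).comp sh := by
    apply MvPolynomial.ringHom_ext
    · intro r; simp [tr]
    · intro i; simp [tr]; ring
  have h := congrArg (fun g => coeff μ (g f)) this
  simpa [hd, coeff_map] using h

lemma hd_map {σ R S : Type*} [CommRing R] [CommRing S] (φ : R →+* S) (μ : σ →₀ ℕ) (f : MvPolynomial σ R) :
    hd μ (MvPolynomial.map φ f) = MvPolynomial.map φ (hd μ f) := by
  have : (sh : MvPolynomial σ S →+* _).comp (MvPolynomial.map φ) =
      (MvPolynomial.map (MvPolynomial.map φ)).comp sh := by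
    apply MvPolynomial.ringHom_ext
    · intro r; simp
    · intro i; simp
  have h := congrArg (fun g => coeff μ (g f)) this
  simpa [hd, coeff_map] using h

end Sub

namespace Sub
open MvPolynomial
open scoped MonomialOrder

section GW
variable {σ : Type*} [Fintype σ]

lemma exists_reduced (mo : MonomialOrder σ) : ∀ (r : ℕ) (f : Fin r → MvPolynomial σ ℚ),
    LinearIndependent ℚ f → ∃ g : Fin r → MvPolynomial σ ℚ,
      (∀ j, g j ∈ Submodule.span ℚ (Set.range f)) ∧ (∀ j, g j ≠ 0) ∧
      Function.Injective fun j => mo.degree (g j) := by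
  intro r
  induction r with
  | zero => exact fun f _ => ⟨f, fun j => j.elim0, fun j => j.elim0, fun j => j.elim0⟩
  | succ r ih =>
    intro f hf
    rw [linearIndependent_finSucc] at hf
    obtain ⟨hf1, hf2⟩ := hf
    obtain ⟨g, hg1, hg2, hg3⟩ := ih (Fin.tail f) hf1
    let S : Set mo.syn := {d | ∃ h, h - f 0 ∈ Submodule.span ℚ (Set.range (Fin.tail f)) ∧
      mo.toSyn (mo.degree h) = d}
    have hS : S.Nonempty := ⟨_, f 0, by simp, rfl⟩
    have wf : WellFounded (fun a b : mo.syn => a < b) := wellFounded_lt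
    obtain ⟨h, hh, hd⟩ := wf.min_mem S hS
    have hne : ∀ h, h - f 0 ∈ Submodule.span ℚ (Set.range (Fin.tail f)) → h ≠ 0 := by
      rintro h hh rfl
      apply hf2
      simpa using (Submodule.neg_mem _ hh)
    have key : ∀ j, mo.degree (g j) ≠ mo.degree h := by
      intro j hj
      set c := mo.leadingCoeff h / mo.leadingCoeff (g j) with hc
      have h1 : (h - c • g j) - f 0 ∈ Submodule.span ℚ (Set.range (Fin.tail f)) := by
        have := Submodule.sub_mem _ hh (Submodule.smul_mem _ c (hg1 j))
        convert this using 1; ring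
      have h2 : ¬ mo.toSyn (mo.degree (h - c • g j)) < wf.min S hS := wf.not_lt_min S ⟨_, h1, rfl⟩
      rw [← hd] at h2
      have h3 : (h - c • g j).coeff (mo.degree h) = 0 := by
        rw [coeff_sub, coeff_smul, hc, ← hj]
        have : mo.leadingCoeff (g j) ≠ 0 := mo.leadingCoeff_ne_zero_iff.mpr (hg2 j)
        simp only [MonomialOrder.leadingCoeff] at this ⊢
        rw [hj] at this ⊢
        simp only [smul_eq_mul]; field_simp; ring
      have h4 : mo.degree (h - c • g j) ≼[mo] mo.degree h := by
        refine (mo.degree_sub_le).trans (sup_le le_rfl ?_)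
        rw [← hj]; exact mo.degree_smul_le
      have h5 : mo.degree (h - c • g j) = mo.degree h :=
        mo.toSyn.injective (le_antisymm h4 (not_lt.mp h2))
      have h6 := mo.leadingCoeff_ne_zero_iff.mpr (hne _ h1)
      rw [MonomialOrder.leadingCoeff, h5] at h6
      exact h6 h3
    have htail : Submodule.span ℚ (Set.range (Fin.tail f)) ≤ Submodule.span ℚ (Set.range f) :=
      Submodule.span_mono (by rintro _ ⟨i, rfl⟩; exact ⟨i.succ, rfl⟩)
    refine ⟨Fin.cons h g, ?_, ?_, ?_⟩
    · intro j
      refine Fin.cases ?_ (fun j => ?_) j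
      · have := Submodule.add_mem _ (htail hh) (Submodule.subset_span (Set.mem_range_self (0 : Fin (r+1))))
        simpa using this
      · simpa using htail (hg1 j)
    · intro j
      refine Fin.cases ?_ (fun j => ?_) j
      · simpa using hne h hh
      · simpa using hg2 j
    · intro i j
      refine Fin.cases ?_ (fun i => ?_) i <;> refine Fin.cases ?_ (fun j => ?_) j
      · simp
      · intro e; exact absurd e.symm (by simpa using key j)
      · intro e; exact absurd e (by simpa using key i)
      · intro e; simp only [Fin.cons_succ] at e
        rw [hg3 e]

/-- multi binomial -/
def mb (μ e : σ →₀ ℕ) : ℚ := ∏ i, ((e i).choose (μ i) : ℚ)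

lemma coeff_mon_hd (μ e : σ →₀ ℕ) (f : MvPolynomial σ ℚ) :
    coeff e (monomial μ 1 * hd μ f) = mb μ e * coeff e f := by
  classical
  rw [coeff_monomial_mul']
  split_ifs with h
  · rw [coeff_hd, one_mul, tsub_add_cancel_of_le h, mb]
    congr 1
    refine Finset.prod_congr rfl fun i _ => ?_
    have := h i
    rw [Finsupp.tsub_apply, Nat.sub_add_cancel this]
  · have : ∃ i, e i < μ i := by
      by_contra hh; push Not at hh; exact h hh
    obtain ⟨i, hi⟩ := this
    rw [mb, Finset.prod_eq_zero (Finset.mem_univ i) (by simp [Nat.choose_eq_zero_of_lt hi]), zero_mul]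

lemma mul_mem_span_mb (i : σ) (μ : σ →₀ ℕ) :
    ∀ e : σ →₀ ℕ, (e i : ℚ) * mb μ e = (μ i + 1) * mb (μ + Finsupp.single i 1) e + μ i * mb μ e := by
  classical
  intro e
  have split : ∀ μ, mb μ e = (e i).choose (μ i) * ∏ j ∈ Finset.univ.erase i, ((e j).choose (μ j) : ℚ) :=
    fun μ => (Finset.mul_prod_erase _ _ (Finset.mem_univ i)).symm
  rw [split, split]
  have : ∏ j ∈ Finset.univ.erase i, ((e j).choose ((μ + Finsupp.single i 1 : σ →₀ ℕ) j) : ℚ) =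
      ∏ j ∈ Finset.univ.erase i, ((e j).choose (μ j) : ℚ) := by
    refine Finset.prod_congr rfl fun j hj => ?_
    have := Finset.ne_of_mem_erase hj
    simp [Finsupp.single_eq_of_ne this]
  rw [this]
  have h1 : (e i : ℚ) * (e i).choose (μ i) = (μ i + 1) * (e i).choose (μ i + 1) + μ i * (e i).choose (μ i) := by
    have := Nat.choose_succ_right_eq (e i) (μ i)
    rcases le_or_gt (μ i) (e i) with h | h
    · have h2 : ((e i).choose (μ i + 1) * (μ i + 1) : ℚ) = (e i).choose (μ i) * ((e i : ℚ) - μ i) := by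
        rw [← Nat.cast_sub h]; exact_mod_cast this
      linarith
    · simp [Nat.choose_eq_zero_of_lt h, Nat.choose_eq_zero_of_lt (h.trans (Nat.lt_succ_self _))]
  simp only [Finsupp.add_apply, Finsupp.single_eq_same]
  calc _ = ((e i : ℚ) * (e i).choose (μ i)) * ∏ j ∈ Finset.univ.erase i, ((e j).choose (μ j) : ℚ) := by ring
    _ = _ := by rw [h1]; ring

lemma exists_mb (r : ℕ) (e : Fin r → σ →₀ ℕ) (he : Function.Injective e) :
    ∃ μ : Fin r → σ →₀ ℕ, (∀ i, (μ i).degree ≤ r - 1) ∧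
      (Matrix.of fun i j => mb (μ i) (e j)).det ≠ 0 := by
  classical
  let P : ℕ → Submodule ℚ (Fin r → ℚ) := fun d =>
    Submodule.span ℚ ((fun μ : σ →₀ ℕ => fun j => mb μ (e j)) '' {μ | μ.degree ≤ d})
  have mulP : ∀ d i (v : Fin r → ℚ) (c : ℚ), v ∈ P d → (fun j => ((e j i : ℚ) - c) * v j) ∈ P (d+1) := by
    intro d i v c hv
    have mono : P d ≤ P (d+1) := Submodule.span_mono (Set.image_mono fun μ hμ => by
      simp only [Set.mem_ofPred_eq] at hμ ⊢; omega)
    let M : (Fin r → ℚ) →ₗ[ℚ] (Fin r → ℚ) := LinearMap.pi fun j => ((e j i : ℚ) - c) • LinearMap.proj j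
    have : P d ≤ (P (d+1)).comap M := by
      refine Submodule.span_le.mpr ?_
      rintro _ ⟨μ, hμ, rfl⟩
      simp only [Submodule.comap_coe, Set.mem_preimage, SetLike.mem_coe]
      have e1 : M (fun j => mb μ (e j)) = (μ i + 1 : ℚ) • (fun j => mb (μ + Finsupp.single i 1) (e j))
          + (μ i - c : ℚ) • (fun j => mb μ (e j)) := by
        funext j
        have := mul_mem_span_mb i μ (e j)
        simp only [M, LinearMap.pi_apply, LinearMap.smul_apply, LinearMap.proj_apply, smul_eq_mul,
          Pi.add_apply, Pi.smul_apply]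
        linarith
      rw [e1]
      refine Submodule.add_mem _ (Submodule.smul_mem _ _ (Submodule.subset_span ⟨_, ?_, rfl⟩))
        (Submodule.smul_mem _ _ (mono (Submodule.subset_span ⟨_, hμ, rfl⟩)))
      simp only [Set.mem_ofPred_eq] at hμ ⊢
      simp only [map_add, Finsupp.degree_single]; omega
    exact this hv
  have prodP : ∀ (j0 : Fin r) (s : Finset (Fin r)), j0 ∉ s → ∃ v ∈ P s.card, v j0 ≠ 0 ∧ ∀ j ∈ s, v j = 0 := by
    intro j0 s
    induction s using Finset.induction_on with
    | empty =>
      intro _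
      refine ⟨fun j => mb 0 (e j), Submodule.subset_span ⟨0, by simp, rfl⟩, by simp [mb], by simp⟩
    | insert a s ha ih =>
      intro hj
      obtain ⟨v, hv, hv1, hv2⟩ := ih (fun h => hj (Finset.mem_insert_of_mem h))
      have hne : e j0 ≠ e a := fun h => hj (by rw [he h]; exact Finset.mem_insert_self _ _)
      obtain ⟨i, hi⟩ : ∃ i, e j0 i ≠ e a i := by
        by_contra hh; push Not at hh; exact hne (Finsupp.ext hh)
      refine ⟨fun j => ((e j i : ℚ) - e a i) * v j, ?_, ?_, ?_⟩
      · rw [Finset.card_insert_of_notMem ha]; exact mulP _ _ _ _ hv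
      · refine mul_ne_zero (sub_ne_zero.mpr ?_) hv1
        exact_mod_cast hi
      · intro j hj
        rcases Finset.mem_insert.mp hj with rfl | hj
        · simp
        · simp [hv2 j hj]
  have top : P (r-1) = ⊤ := by
    rw [eq_top_iff, ← (Pi.basisFun ℚ (Fin r)).span_eq]
    refine Submodule.span_le.mpr ?_
    rintro _ ⟨j0, rfl⟩
    obtain ⟨v, hv, hv1, hv2⟩ := prodP j0 (Finset.univ.erase j0) (by simp)
    rw [Finset.card_erase_of_mem (Finset.mem_univ _), Finset.card_univ, Fintype.card_fin] at hv
    have : (Pi.basisFun ℚ (Fin r)) j0 = (v j0)⁻¹ • v := by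
      funext j
      by_cases h : j = j0
      · subst h; simp [hv1]
      · simp [hv2 j (by simp [h]), h]
    rw [this]; exact Submodule.smul_mem _ _ hv
  obtain ⟨w, hw1, hw2, hw3⟩ := Submodule.exists_fun_fin_finrank_span_eq ℚ
    ((fun μ : σ →₀ ℕ => fun j => mb μ (e j)) '' {μ | μ.degree ≤ r - 1})
  have hr : Module.finrank ℚ (Submodule.span ℚ
    ((fun μ : σ →₀ ℕ => fun j => mb μ (e j)) '' {μ | μ.degree ≤ r - 1})) = r := by
    change Module.finrank ℚ (P (r-1)) = r
    rw [top]; simp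
  choose μ hμ1 hμ2 using hw1
  refine ⟨fun i => μ (Fin.cast hr.symm i), fun i => hμ1 _, ?_⟩
  have hli : LinearIndependent ℚ (fun i : Fin r => w (Fin.cast hr.symm i)) :=
    hw3.comp _ (Fin.cast_injective _)
  have : (Matrix.of fun i j => mb (μ (Fin.cast hr.symm i)) (e j)).row = fun i : Fin r => w (Fin.cast hr.symm i) := by
    funext i j; rw [← hμ2]; rfl
  rw [← this, Matrix.linearIndependent_rows_iff_isUnit, Matrix.isUnit_iff_isUnit_det] at hli
  exact hli.ne_zero

lemma coeff_prod_le (mo : MonomialOrder σ) {ι : Type*} (s : Finset ι) (e : ι → σ →₀ ℕ)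
    (p : ι → MvPolynomial σ ℚ) (h : ∀ i ∈ s, mo.degree (p i) ≼[mo] e i) :
    coeff (∑ i ∈ s, e i) (∏ i ∈ s, p i) = ∏ i ∈ s, coeff (e i) (p i) ∧
      mo.degree (∏ i ∈ s, p i) ≼[mo] ∑ i ∈ s, e i := by
  classical
  induction s using Finset.induction_on with
  | empty => simp
  | insert a s ha ih =>
    obtain ⟨h1, h2⟩ := ih fun i hi => h i (Finset.mem_insert_of_mem hi)
    have h3 := h a (Finset.mem_insert_self _ _)
    rw [Finset.sum_insert ha, Finset.prod_insert ha, Finset.prod_insert ha,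
      mo.coeff_mul_of_add_of_degree_le h3 h2, h1]
    refine ⟨rfl, (mo.degree_mul_le).trans ?_⟩
    simp only [map_add]
    exact add_le_add h3 h2

/-- generalized Wronskian -/
lemma gen_wronskian (mo : MonomialOrder σ) (r : ℕ) (f : Fin r → MvPolynomial σ ℚ)
    (hf : LinearIndependent ℚ f) : ∃ μ : Fin r → σ →₀ ℕ, (∀ i, (μ i).degree ≤ r - 1) ∧
      (Matrix.of fun i j => hd (μ i) (f j)).det ≠ 0 := by
  classical
  obtain ⟨g, hg1, hg2, hg3⟩ := exists_reduced mo r f hf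
  obtain ⟨μ, hμ, hdet⟩ := exists_mb r (fun j => mo.degree (g j)) hg3
  refine ⟨μ, hμ, fun h0 => ?_⟩
  have : ∀ j, ∃ c : Fin r → ℚ, ∑ i, c i • f i = g j := fun j =>
    (Submodule.mem_span_range_iff_exists_fun ℚ).mp (hg1 j)
  choose c hc using this
  have hdl : ∀ μ : σ →₀ ℕ, ∀ j, hd μ (g j) = ∑ i, hd μ (f i) * C (c j i) := by
    intro μ j
    rw [← hc, hd, map_sum, coeff_sum]
    refine Finset.sum_congr rfl fun i _ => ?_
    rw [smul_eq_C_mul, map_mul, sh_C, coeff_C_mul, mul_comm]; rfl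
  have h1 : (Matrix.of fun i j => hd (μ i) (g j)).det = 0 := by
    have : (Matrix.of fun i j => hd (μ i) (g j)) = (Matrix.of fun i j => hd (μ i) (f j)) *
        (Matrix.of fun i j => (C (c j i) : MvPolynomial σ ℚ)) := by
      ext1 i j
      rw [Matrix.mul_apply]; exact hdl _ _
    rw [this, Matrix.det_mul, h0, zero_mul]
  have h2 : (Matrix.of fun i j => monomial (μ i) (1 : ℚ) * hd (μ i) (g j)).det = 0 := by
    have := Matrix.det_mul_column (fun i => monomial (μ i) (1 : ℚ)) (Matrix.of fun i j => hd (μ i) (g j))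
    rw [h1, mul_zero] at this
    exact this
  apply hdet
  have h3 := congrArg (coeff (∑ j, mo.degree (g j))) h2
  rw [Matrix.det_apply, coeff_sum, coeff_zero] at h3
  have hle : ∀ i j, mo.degree (monomial (μ i) (1 : ℚ) * hd (μ i) (g j)) ≼[mo] mo.degree (g j) := by
    intro i j
    rw [mo.degree_le_iff]
    intro e he
    rw [mem_support_iff, coeff_mon_hd] at he
    exact mo.le_degree (mem_support_iff.mpr (right_ne_zero_of_mul he))
  have h4 : ∀ τ : Equiv.Perm (Fin r), coeff (∑ j, mo.degree (g j)) (Equiv.Perm.sign τ •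
      ∏ i, (Matrix.of fun i j => monomial (μ i) (1 : ℚ) * hd (μ i) (g j)) (τ i) i) =
      (Equiv.Perm.sign τ • ∏ i, mb (μ (τ i)) (mo.degree (g i))) * ∏ i, mo.leadingCoeff (g i) := by
    intro τ
    have := (coeff_prod_le mo Finset.univ (fun j => mo.degree (g j))
      (fun i => monomial (μ (τ i)) (1 : ℚ) * hd (μ (τ i)) (g i)) (fun i _ => hle _ _)).1
    simp only [coeff_mon_hd, Finset.prod_mul_distrib] at this
    simp only [Units.smul_def, Matrix.of_apply, zsmul_eq_mul]
    rw [show ((Equiv.Perm.sign τ : ℤ) : MvPolynomial σ ℚ) = C ((Equiv.Perm.sign τ : ℤ) : ℚ) by simp,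
      coeff_C_mul, Finset.prod_mul_distrib, this, mul_assoc]
    rfl
  rw [Finset.sum_congr rfl fun τ _ => h4 τ, ← Finset.sum_mul] at h3
  have h5 := (mul_eq_zero.mp h3).resolve_right
    (Finset.prod_ne_zero_iff.mpr fun i _ => mo.leadingCoeff_ne_zero_iff.mpr (hg2 i))
  rw [Matrix.det_apply]; exact h5

end GW
end Sub

namespace Sub
open MvPolynomial

section tp
variable {k : ℕ} {R : Type*} [CommRing R]

noncomputable def i0 (k : ℕ) (R : Type*) [CommRing R] : MvPolynomial (Fin 1) R →ₐ[R] MvPolynomial (Fin (k+1)) R :=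
  rename fun _ => 0
noncomputable def i1 (k : ℕ) (R : Type*) [CommRing R] : MvPolynomial (Fin k) R →ₐ[R] MvPolynomial (Fin (k+1)) R :=
  rename Fin.succ

lemma coeff_tp (g : MvPolynomial (Fin 1) R) (f : MvPolynomial (Fin k) R) (m : Fin (k+1) →₀ ℕ) :
    coeff m (i0 k R g * i1 k R f) = coeff (Finsupp.single 0 (m 0)) g * coeff (Finsupp.tail m) f := by
  classical
  induction g using MvPolynomial.induction_on' with
  | add p q hp hq => simp only [map_add, add_mul, coeff_add, hp, hq]
  | monomial u a =>
    induction f using MvPolynomial.induction_on' with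
    | add p q hp hq => simp only [map_add, mul_add, coeff_add, hp, hq]
    | monomial v b =>
      simp only [i0, i1, rename_monomial, monomial_mul, coeff_monomial]
      have h0 : ∀ y, (Finsupp.mapDomain Fin.succ v) y = Fin.cases 0 (fun i => v i) y := by
        intro y
        refine Fin.cases ?_ (fun i => ?_) y
        · refine Finsupp.mapDomain_notin_range _ _ ?_ |>.trans rfl
          rintro ⟨i, hi⟩; exact Fin.succ_ne_zero i hi
        · exact Finsupp.mapDomain_apply (Fin.succ_injective _) _ _
      have h1 : ∀ y : Fin (k+1), (Finsupp.mapDomain (fun _ : Fin 1 => (0 : Fin (k+1))) u) y =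
          Fin.cases (u 0) (fun i => 0) y := by
        intro y
        refine Fin.cases ?_ (fun i => ?_) y
        · exact Finsupp.mapDomain_apply (f := fun _ : Fin 1 => (0 : Fin (k+1)))
            (Function.injective_of_subsingleton _) u 0
        · refine Finsupp.mapDomain_notin_range _ _ ?_ |>.trans rfl
          rintro ⟨_, hi⟩; exact Fin.succ_ne_zero i hi.symm
      have e1 : (Finsupp.mapDomain (fun _ : Fin 1 => (0 : Fin (k+1))) u + Finsupp.mapDomain Fin.succ v = m) ↔
          (u = Finsupp.single 0 (m 0) ∧ v = Finsupp.tail m) := by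
        constructor
        · rintro rfl
          constructor
          · ext; simp [h0, h1]
          · ext i; simp [h0, h1, Finsupp.tail_apply]
        · rintro ⟨hu, hv⟩
          ext y
          rw [Finsupp.add_apply, h0, h1]
          refine Fin.cases ?_ (fun i => ?_) y
          · simp [hu]
          · simp [hv, Finsupp.tail_apply]
      simp only [e1]
      by_cases hu : u = Finsupp.single 0 (m 0) <;> by_cases hv : v = Finsupp.tail m <;> simp [hu, hv]

lemma hd_tp (g : MvPolynomial (Fin 1) R) (f : MvPolynomial (Fin k) R) (ν : Fin 1 →₀ ℕ) (μ : Fin k →₀ ℕ) :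
    hd (Finsupp.cons (ν 0) μ) (i0 k R g * i1 k R f) = i0 k R (hd ν g) * i1 k R (hd μ f) := by
  ext m
  rw [coeff_hd, coeff_tp, coeff_tp, coeff_hd, coeff_hd, Fin.prod_univ_succ]
  simp only [Finsupp.add_apply, Finsupp.cons_zero, Finsupp.cons_succ, Finsupp.tail_apply,
    Finset.univ_unique, Fin.default_eq_zero, Finset.prod_singleton, Finsupp.single_eq_same]
  have e1 : Finsupp.single (0 : Fin 1) (m 0 + ν 0) = Finsupp.single 0 (m 0) + ν := by
    ext; simp
  have e2 : Finsupp.tail (m + Finsupp.cons (ν 0) μ) = Finsupp.tail m + μ := by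
    ext i; simp [Finsupp.tail_apply]
  rw [e1, e2]; ring

lemma tr_tp (ξ : Fin (k+1) → R) (g : MvPolynomial (Fin 1) R) (f : MvPolynomial (Fin k) R) :
    tr ξ (i0 k R g * i1 k R f) = i0 k R (tr (fun _ => ξ 0) g) * i1 k R (tr (Fin.tail ξ) f) := by
  rw [map_mul]
  congr 1
  · have : (tr ξ).comp (i0 k R) = (i0 k R).comp (tr fun _ => ξ 0) := by
      apply algHom_ext; intro i; simp [tr, i0]
    exact congrArg (fun φ : _ →ₐ[R] _ => φ g) this
  · have : (tr ξ).comp (i1 k R) = (i1 k R).comp (tr (Fin.tail ξ)) := by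
      apply algHom_ext; intro i; simp [tr, i1, Fin.tail]
    exact congrArg (fun φ : _ →ₐ[R] _ => φ f) this

end tp

lemma R1poly (s t : ℤ) (hst : IsCoprime s t) (ht : t ≠ 0) (p : Polynomial ℤ) (hp : p ≠ 0) (L : ℤ)
    (hL : ∀ i, |p.coeff i| ≤ L) :
    (max |s| |t|) ^ ((p.map (Int.castRingHom ℚ)).rootMultiplicity ((s : ℚ) / t)) ≤ L := by
  set P := p.map (Int.castRingHom ℚ) with hP
  set e := P.rootMultiplicity ((s : ℚ) / t)
  let l : Polynomial ℤ := Polynomial.C t * Polynomial.X - Polynomial.C s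
  have htq : (t : ℚ) ≠ 0 := by exact_mod_cast ht
  have hl : l.map (Int.castRingHom ℚ) = Polynomial.C (t : ℚ) * (Polynomial.X - Polynomial.C ((s : ℚ) / t)) := by
    simp only [l, Polynomial.map_sub, Polynomial.map_mul, Polynomial.map_C, Polynomial.map_X, mul_sub,
      ← Polynomial.C_mul]
    rw [mul_div_cancel₀ _ htq]; simp
  have c1 : l.coeff 1 = t := by simp [l, Polynomial.coeff_C, -eq_intCast]
  have c0 : l.coeff 0 = -s := by simp [l]
  have hprim : l.IsPrimitive := by
    intro r hr
    have h1 := (Polynomial.C_dvd_iff_dvd_coeff r l).mp hr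
    have h2 : r ∣ t := by simpa [c1] using h1 1
    have h3 : r ∣ s := by simpa [c0] using h1 0
    exact hst.isUnit_of_dvd' h3 h2
  have hprime : ∀ n, (l ^ n).IsPrimitive := by
    intro n
    induction n with
    | zero => simp
    | succ n ih => rw [pow_succ]; exact ih.mul hprim
  have hdvd : l ^ e ∣ p := by
    rw [Polynomial.IsPrimitive.Int.dvd_iff_map_cast_dvd_map_cast _ _ (hprime e), Polynomial.map_pow, hl, mul_pow]
    have h1 := Polynomial.pow_rootMultiplicity_dvd P ((s : ℚ) / t)
    have hu : IsUnit (Polynomial.C (t : ℚ) ^ e) := (Polynomial.isUnit_C.mpr (isUnit_iff_ne_zero.mpr htq)).pow e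
    exact (IsUnit.mul_left_dvd hu).mpr h1
  obtain ⟨q, hq⟩ := hdvd
  have hq0 : q ≠ 0 := by rintro rfl; simp at hq; exact hp hq
  have hldeg : l.natDegree = 1 := by
    simp only [l]; compute_degree!
  have hlead : l.leadingCoeff = t := by rw [Polynomial.leadingCoeff, hldeg, c1]
  have habs : ∀ a b : ℤ, b ≠ 0 → |a ^ e * b| ≤ L → |a| ^ e ≤ L := by
    intro a b hb h
    rw [abs_mul, abs_pow] at h
    have : 1 ≤ |b| := Int.one_le_abs hb
    nlinarith [pow_nonneg (abs_nonneg a) e]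
  have ht' : |t| ^ e ≤ L := by
    refine habs t q.leadingCoeff (by simpa using hq0) ?_
    have := hL p.natDegree
    rw [← Polynomial.leadingCoeff, hq, Polynomial.leadingCoeff_mul, Polynomial.leadingCoeff_pow, hlead] at this
    exact this
  have hs' : |s| ^ e ≤ L := by
    by_cases hs : s = 0
    · subst hs
      refine le_trans ?_ ht'
      exact pow_le_pow_left₀ (abs_nonneg _) (by simp) _
    · have htr : l.trailingCoeff = -s := by
        have : l.natTrailingDegree = 0 := by
          rw [Polynomial.natTrailingDegree_eq_zero]; right; rw [c0]; simpa using hs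
        rw [Polynomial.trailingCoeff, this, c0]
      have htrp : ∀ n, (l ^ n).trailingCoeff = (-s) ^ n := by
        intro n
        induction n with
        | zero => simp [Polynomial.trailingCoeff]
        | succ n ih => rw [pow_succ, Polynomial.trailingCoeff_mul, ih, htr, pow_succ]
      have := habs (-s) q.trailingCoeff (by simpa using hq0) (by
        have := hL p.natTrailingDegree
        rw [← Polynomial.trailingCoeff, hq, Polynomial.trailingCoeff_mul, htrp] at this
        exact this)
      simpa using this
  rcases max_choice |s| |t| with h | h <;> rw [h] <;> assumption

lemma R1 (s t : ℤ) (hst : IsCoprime s t) (ht : t ≠ 0) (f : MvPolynomial (Fin 1) ℤ) (hf : f ≠ 0) :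
    ∃ m ∈ (tr (fun _ => (s : ℚ) / t) (map (Int.castRingHom ℚ) f)).support,
      ((max |s| |t| : ℤ) : ℝ) ^ (m 0) ≤ L1 f := by
  let φ := uniqueAlgEquiv ℤ (Fin 1)
  let ψ := uniqueAlgEquiv ℚ (Fin 1)
  have hp : φ f ≠ 0 := by simpa using hf
  have hmap : ψ (map (Int.castRingHom ℚ) f) = (φ f).map (Int.castRingHom ℚ) := by
    ext i; rw [Polynomial.coeff_map, coeff_uniqueAlgEquiv, coeff_uniqueAlgEquiv, coeff_map]
  have hcomp : ∀ g : MvPolynomial (Fin 1) ℚ, ψ (tr (fun _ => (s : ℚ) / t) g) =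
      (ψ g).comp (Polynomial.X + Polynomial.C ((s : ℚ) / t)) := by
    intro g
    have : (ψ.toAlgHom).comp (tr (fun _ => (s : ℚ) / t)) =
        (Polynomial.aeval (R := ℚ) (Polynomial.X + Polynomial.C ((s : ℚ) / t))).comp ψ.toAlgHom := by
      apply algHom_ext; intro i; simp [tr, ψ, uniqueAlgEquiv]
    have := congrArg (fun φ : _ →ₐ[ℚ] _ => φ g) this
    rw [Polynomial.comp, ← Polynomial.algebraMap_eq, ← Polynomial.aeval_def]
    exact this
  set g := tr (fun _ => (s : ℚ) / t) (map (Int.castRingHom ℚ) f) with hg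
  have hg0 : ψ g ≠ 0 := by
    rw [hg, hcomp, hmap]
    intro h
    rw [Polynomial.comp_eq_zero_iff] at h
    rcases h with h | ⟨_, h⟩
    · rw [Polynomial.map_eq_zero_iff (RingHom.injective_int _)] at h; exact hp h
    · have := congrArg (fun p => Polynomial.coeff p 1) h
      simp at this
  refine ⟨Finsupp.single 0 (ψ g).natTrailingDegree, ?_, ?_⟩
  · rw [mem_support_iff]
    have := Polynomial.trailingCoeff_nonzero_iff_nonzero.mpr hg0
    rw [Polynomial.trailingCoeff, coeff_uniqueAlgEquiv] at this
    exact this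
  · rw [Finsupp.single_eq_same, hg, hcomp, hmap, ← Polynomial.rootMultiplicity_eq_natTrailingDegree]
    have := R1poly s t hst ht (φ f) hp ⌊L1 f⌋ (fun i => by
      rw [Int.le_floor, coeff_uniqueAlgEquiv]
      have := coeff_le_L1 f (Finsupp.single default i)
      rwa [Int.norm_eq_abs, ← Int.cast_abs] at this)
    have := Int.le_floor.mp this
    push_cast at this ⊢; exact this

end Sub

namespace Sub
open MvPolynomial

lemma L1_le_of_inj {σ τ R S : Type*} [NormedCommRing R] [NormedCommRing S] (f : MvPolynomial σ R)
    (g : MvPolynomial τ S) (φ : (σ →₀ ℕ) → (τ →₀ ℕ)) (hφ : Function.Injective φ) (c : ℝ)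
    (h : ∀ m, coeff m f ≠ 0 → ‖coeff m f‖ ≤ c * ‖coeff (φ m) g‖) (hc : 0 ≤ c) : L1 f ≤ c * L1 g := by
  classical
  calc L1 f ≤ ∑ m ∈ f.support, c * ‖coeff (φ m) g‖ :=
        Finset.sum_le_sum fun m hm => h m (mem_support_iff.mp hm)
    _ = c * ∑ m ∈ f.support.image φ, ‖coeff m g‖ := by
        rw [Finset.sum_image hφ.injOn, Finset.mul_sum]
    _ ≤ c * L1 g := by
        refine mul_le_mul_of_nonneg_left ?_ hc
        rw [L1_eq_of_subset g (Finset.subset_union_right (s₁ := f.support.image φ))]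
        exact Finset.sum_le_sum_of_subset_of_nonneg Finset.subset_union_left fun _ _ _ => norm_nonneg _

/-- the index is at least `θ` -/
def Ix {k : ℕ} {S : Type*} [CommSemiring S] (D : Fin k → ℕ) (θ : ℝ) (f : MvPolynomial (Fin k) S) : Prop :=
  ∀ m, coeff m f ≠ 0 → θ ≤ ∑ h, (m h : ℝ) / D h

section Ix
variable {k : ℕ} {S : Type*} [CommRing S] {D : Fin k → ℕ}

lemma Ix.mono {θ θ' : ℝ} {f : MvPolynomial (Fin k) S} (h : Ix D θ f) (hle : θ' ≤ θ) : Ix D θ' f :=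
  fun m hm => hle.trans (h m hm)

lemma Ix_nonpos {θ : ℝ} (f : MvPolynomial (Fin k) S) (h : θ ≤ 0) : Ix D θ f :=
  fun _ _ => h.trans (Finset.sum_nonneg fun _ _ => by positivity)

lemma Ix_sum {ι : Type*} {θ : ℝ} (s : Finset ι) (f : ι → MvPolynomial (Fin k) S)
    (h : ∀ i ∈ s, Ix D θ (f i)) : Ix D θ (∑ i ∈ s, f i) := by
  intro m hm
  rw [coeff_sum] at hm
  obtain ⟨i, hi, hne⟩ := Finset.exists_ne_zero_of_sum_ne_zero hm
  exact h i hi m hne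

lemma Ix.mul {θ₁ θ₂ : ℝ} {f g : MvPolynomial (Fin k) S} (hf : Ix D θ₁ f) (hg : Ix D θ₂ g) :
    Ix D (θ₁ + θ₂) (f * g) := by
  classical
  intro m hm
  rw [coeff_mul] at hm
  obtain ⟨⟨a, b⟩, hab, hne⟩ := Finset.exists_ne_zero_of_sum_ne_zero hm
  have h1 := hf a (left_ne_zero_of_mul hne)
  have h2 := hg b (right_ne_zero_of_mul hne)
  replace hab : a + b = m := by simpa using hab
  rw [← hab]
  have : ∑ h, (((a + b) h : ℕ) : ℝ) / D h = ∑ h, (a h : ℝ) / D h + ∑ h, (b h : ℝ) / D h := by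
    rw [← Finset.sum_add_distrib]
    refine Finset.sum_congr rfl fun h _ => ?_
    rw [Finsupp.add_apply, Nat.cast_add, add_div]
  rw [this]; linarith

lemma Ix_prod {ι : Type*} (s : Finset ι) (θ : ι → ℝ) (f : ι → MvPolynomial (Fin k) S)
    (h : ∀ i ∈ s, Ix D (θ i) (f i)) : Ix D (∑ i ∈ s, θ i) (∏ i ∈ s, f i) := by
  classical
  induction s using Finset.induction_on with
  | empty => exact Ix_nonpos _ (by simp)
  | insert a s ha ih =>
    rw [Finset.sum_insert ha, Finset.prod_insert ha]
    exact (h a (Finset.mem_insert_self _ _)).mul (ih fun i hi => h i (Finset.mem_insert_of_mem hi))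

lemma Ix.hd {θ : ℝ} {f : MvPolynomial (Fin k) S} (hf : Ix D θ f) (μ : Fin k →₀ ℕ) :
    Ix D (θ - ∑ h, (μ h : ℝ) / D h) (hd μ f) := by
  intro m hm
  rw [coeff_hd] at hm
  have h1 := hf _ (right_ne_zero_of_mul hm)
  have : ∑ h, (((m + μ) h : ℕ) : ℝ) / D h = ∑ h, (m h : ℝ) / D h + ∑ h, (μ h : ℝ) / D h := by
    rw [← Finset.sum_add_distrib]
    refine Finset.sum_congr rfl fun h _ => ?_
    rw [Finsupp.add_apply, Nat.cast_add, add_div]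
  linarith

lemma Ix_det {r : ℕ} (θ : Fin r → ℝ) (M : Matrix (Fin r) (Fin r) (MvPolynomial (Fin k) S))
    (h : ∀ i l, Ix D (θ l) (M i l)) : Ix D (∑ l, θ l) M.det := by
  rw [Matrix.det_apply]
  refine Ix_sum _ _ fun τ _ => ?_
  intro m hm
  refine Ix_prod Finset.univ θ (fun i => M (τ i) i) (fun i _ => h _ _) m ?_
  intro h0; apply hm
  rw [Units.smul_def, zsmul_eq_mul, show (((Equiv.Perm.sign τ : ℤ)) : MvPolynomial (Fin k) S) =
    C ((Equiv.Perm.sign τ : ℤ) : S) by simp, coeff_C_mul, h0, mul_zero]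

end Ix

section deg
variable {σ : Type*} [Fintype σ]

lemma degreeOf_hd_le (i : σ) (μ : σ →₀ ℕ) (f : MvPolynomial σ ℤ) : degreeOf i (hd μ f) ≤ degreeOf i f := by
  rw [degreeOf_le_iff]
  intro m hm
  rw [mem_support_iff, coeff_hd] at hm
  have := monomial_le_degreeOf i (mem_support_iff.mpr (right_ne_zero_of_mul hm))
  rw [Finsupp.add_apply] at this; omega

lemma L1_hd_le (D : σ → ℕ) (μ : σ →₀ ℕ) (f : MvPolynomial σ ℤ) (hD : ∀ i, degreeOf i f ≤ D i) :
    L1 (hd μ f) ≤ 2 ^ (∑ i, D i) * L1 f := by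
  refine L1_le_of_inj _ _ (fun m => m + μ) (add_left_injective μ) _ ?_ (by positivity)
  intro m hm
  rw [coeff_hd] at hm ⊢
  refine (norm_mul_le _ _).trans (mul_le_mul_of_nonneg_right ?_ (norm_nonneg _))
  rw [← Finset.prod_pow_eq_pow_sum, Int.norm_eq_abs]
  have : ∏ i, ((m i + μ i).choose (μ i)) ≤ ∏ i, 2 ^ D i := by
    refine Finset.prod_le_prod' fun i _ => ?_
    refine (Nat.choose_le_two_pow _ _).trans (Nat.pow_le_pow_right (by norm_num) ?_)
    have := monomial_le_degreeOf i (mem_support_iff.mpr (right_ne_zero_of_mul hm))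
    rw [Finsupp.add_apply] at this
    exact this.trans (hD i)
  have h2 : ((∏ i, ((m i + μ i).choose (μ i) : ℤ) : ℤ) : ℝ) = ((∏ i, ((m i + μ i).choose (μ i)) : ℕ) : ℝ) := by
    push_cast; rfl
  rw [h2, Nat.abs_cast]
  calc _ ≤ ((∏ i, 2 ^ D i : ℕ) : ℝ) := by exact_mod_cast this
    _ = _ := by push_cast; rfl

lemma degreeOf_det_le {r : ℕ} (i : σ) (d : ℕ) (M : Matrix (Fin r) (Fin r) (MvPolynomial σ ℤ))
    (h : ∀ a b, degreeOf i (M a b) ≤ d) : degreeOf i M.det ≤ r * d := by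
  rw [Matrix.det_apply]
  refine (degreeOf_sum_le _ _ _).trans (Finset.sup_le fun τ _ => ?_)
  rw [Units.smul_def, zsmul_eq_mul, show (((Equiv.Perm.sign τ : ℤ)) : MvPolynomial σ ℤ) =
    C ((Equiv.Perm.sign τ : ℤ)) by simp]
  refine (degreeOf_C_mul_le _ _ _).trans ((degreeOf_prod_le _ _ _).trans ?_)
  refine (Finset.sum_le_sum fun a _ => h _ _).trans ?_
  simp

lemma L1_det_le {r : ℕ} (B : ℝ) (M : Matrix (Fin r) (Fin r) (MvPolynomial σ ℤ))
    (h : ∀ a b, L1 (M a b) ≤ B) : L1 M.det ≤ r.factorial * B ^ r := by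
  rw [Matrix.det_apply]
  refine (L1_sum_le _ _).trans ?_
  refine (Finset.sum_le_card_nsmul _ _ (B ^ r) fun τ _ => ?_).trans ?_
  · have : L1 (∏ i, M (τ i) i) ≤ B ^ r := by
      refine (L1_prod_le _ _).trans ?_
      refine (Finset.prod_le_prod (fun _ _ => L1_nonneg _) fun a _ => h _ _).trans ?_
      simp
    rcases Int.units_eq_one_or (Equiv.Perm.sign τ) with h | h <;> rw [h]
    · simpa using this
    · simpa [L1_neg] using this
  · simp [Fintype.card_perm]

end deg

lemma decomp {k : ℕ} (F : MvPolynomial (Fin (k+1)) ℚ) (hF : F ≠ 0) (d : ℕ) (hd : degreeOf 0 F ≤ d) :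
    ∃ r, 0 < r ∧ r ≤ d + 1 ∧ ∃ (I : Fin r → ℕ) (g : Fin r → MvPolynomial (Fin 1) ℚ),
      LinearIndependent ℚ g ∧ LinearIndependent ℚ (fun j => Polynomial.coeff (finSuccEquiv ℚ k F) (I j)) ∧
      F = ∑ j, i0 k ℚ (g j) * i1 k ℚ (Polynomial.coeff (finSuccEquiv ℚ k F) (I j)) := by
  classical
  set c : ℕ → MvPolynomial (Fin k) ℚ := Polynomial.coeff (finSuccEquiv ℚ k F) with hc
  have hc0 : ∀ i, d < i → c i = 0 := fun i hi => by
    apply Polynomial.coeff_eq_zero_of_natDegree_lt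
    rw [natDegree_finSuccEquiv]; omega
  have hcm : ∀ m, coeff m F = coeff (Finsupp.tail m) (c (m 0)) := fun m => by
    rw [hc, finSuccEquiv_coeff_coeff, Finsupp.cons_tail]
  set s : Finset (MvPolynomial (Fin k) ℚ) := (Finset.range (d+1)).image c with hs
  obtain ⟨r, hr, b, hb1, hb2, hb3⟩ : ∃ r, r = Module.finrank ℚ (Submodule.span ℚ (s : Set (MvPolynomial (Fin k) ℚ))) ∧
      ∃ b : Fin r → MvPolynomial (Fin k) ℚ, (∀ i, b i ∈ (s : Set (MvPolynomial (Fin k) ℚ))) ∧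
      Submodule.span ℚ (Set.range b) = Submodule.span ℚ (s : Set (MvPolynomial (Fin k) ℚ)) ∧ LinearIndependent ℚ b :=
    ⟨_, rfl, Submodule.exists_fun_fin_finrank_span_eq ℚ (s : Set (MvPolynomial (Fin k) ℚ))⟩
  have hI : ∀ j, ∃ i, c i = b j := fun j => by
    have := hb1 j
    rw [hs, Finset.coe_image] at this
    obtain ⟨i, _, hi⟩ := this
    exact ⟨i, hi⟩
  choose I hI using hI
  have hmem : ∀ i, c i ∈ Submodule.span ℚ (Set.range b) := by
    intro i
    rw [hb2]
    by_cases hi : d < i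
    · rw [hc0 i hi]; exact Submodule.zero_mem _
    · exact Submodule.subset_span (by rw [hs, Finset.coe_image]; exact ⟨i, by simp; omega, rfl⟩)
  have := fun i => (Submodule.mem_span_range_iff_exists_fun ℚ).mp (hmem i)
  choose a ha using this
  have ha0 : ∀ i, d < i → a i = 0 := by
    intro i hi
    have h1 := ha i
    rw [hc0 i hi] at h1
    exact _root_.funext (Fintype.linearIndependent_iff.mp hb3 _ h1)
  let g : Fin r → MvPolynomial (Fin 1) ℚ := fun j => ∑ i ∈ Finset.range (d+1), monomial (Finsupp.single 0 i) (a i j)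
  have hg : ∀ j e, coeff (Finsupp.single 0 e) (g j) = a e j := by
    intro j e
    simp only [g, coeff_sum, coeff_monomial]
    have : ∀ i, (Finsupp.single (0 : Fin 1) i = Finsupp.single 0 e) ↔ i = e := fun i =>
      (Finsupp.single_injective 0).eq_iff
    simp only [this, Finset.sum_ite_eq', Finset.mem_range]
    split_ifs with h
    · rfl
    · rw [ha0 e (by omega)]; rfl
  have hbI : (fun j => c (I j)) = b := _root_.funext hI
  refine ⟨r, ?_, ?_, I, g, ?_, ?_, ?_⟩
  · rcases Nat.eq_zero_or_pos r with h | h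
    · exfalso
      apply hF
      ext m
      rw [hcm, ← ha]
      have : IsEmpty (Fin r) := by rw [h]; infer_instance
      simp
    · exact h
  · refine hr.le.trans <| (finrank_span_finset_le_card s).trans (Finset.card_image_le.trans (by simp))
  · rw [Fintype.linearIndependent_iff]
    intro l hl
    have key : ∀ i, ∑ j, a i j * l j = 0 := by
      intro i
      have := congrArg (coeff (Finsupp.single 0 i)) hl
      simp only [coeff_sum, coeff_smul, hg, coeff_zero, smul_eq_mul] at this
      rw [← this]; exact Finset.sum_congr rfl fun j _ => mul_comm _ _
    intro j
    have h1 := ha (I j)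
    rw [hI] at h1
    have h2 : ∑ j', (a (I j) j' - if j' = j then 1 else 0) • b j' = 0 := by
      simp only [sub_smul, Finset.sum_sub_distrib, h1]; simp
    have h3 := Fintype.linearIndependent_iff.mp hb3 _ h2
    have h4 := key (I j)
    have h5 : ∀ j', a (I j) j' = if j' = j then 1 else 0 := fun j' => by linarith [h3 j']
    simpa [h5] using h4
  · rw [hbI]; exact hb3
  · ext m
    rw [coeff_sum, hcm, ← ha (m 0), coeff_sum]
    refine Finset.sum_congr rfl fun j _ => ?_
    rw [coeff_tp, hg, coeff_smul, hI, smul_eq_mul]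

lemma slice {k : ℕ} (W : MvPolynomial (Fin (k+1)) ℤ) (m0 : Fin k →₀ ℕ) : ∃ V : MvPolynomial (Fin 1) ℤ,
    (∀ e, coeff e V = coeff (Finsupp.cons (e 0) m0) W) ∧ L1 V ≤ L1 W := by
  classical
  obtain ⟨V, hV⟩ : ∃ V : MvPolynomial (Fin 1) ℤ, ∀ e, coeff e V = coeff (Finsupp.cons (e 0) m0) W := by
    refine ⟨∑ i ∈ Finset.range (degreeOf 0 W + 1), monomial (Finsupp.single 0 i) (coeff (Finsupp.cons i m0) W), ?_⟩
    intro e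
    simp only [coeff_sum, coeff_monomial]
    have : ∀ i, (Finsupp.single (0 : Fin 1) i = e) ↔ i = e 0 := fun i =>
      ⟨fun h => by rw [← h]; simp, fun h => by ext; simp [h]⟩
    simp only [this, Finset.sum_ite_eq', Finset.mem_range]
    split_ifs with h
    · rfl
    · by_contra hne
      have := monomial_le_degreeOf 0 (mem_support_iff.mpr (Ne.symm hne))
      rw [Finsupp.cons_zero] at this; omega
  refine ⟨V, hV, ?_⟩
  have := L1_le_of_inj V W (fun e => Finsupp.cons (e 0) m0) ?_ 1 ?_ zero_le_one
  · simpa using this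
  · intro a b h
    have := DFunLike.congr_fun h 0
    simp only [Finsupp.cons_zero] at this
    ext; simpa using this
  · intro m _; rw [hV, one_mul]

end Sub

namespace Sub
open MvPolynomial

lemma tri_sum (r d : ℕ) (θ : ℝ) (h0 : 0 < θ) (h1 : θ ≤ 1) (hd : 0 < d) (hr : r ≤ d + 1) :
    θ ^ 2 * r / 8 ≤ ∑ l ∈ Finset.range r, max 0 (θ - l / d) := by
  have hd' : (0 : ℝ) < d := by exact_mod_cast hd
  have hr' : (r : ℝ) ≤ 2 * d := by
    have : r ≤ 2 * d := by omega
    exact_mod_cast this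
  set q := min r ⌈θ * d / 2⌉₊ with hq
  have hqr : θ * r / 4 ≤ q := by
    rw [hq, Nat.cast_min]
    refine le_min ?_ (le_trans ?_ (Nat.le_ceil _))
    · nlinarith [(Nat.cast_nonneg r : (0 : ℝ) ≤ r)]
    · nlinarith
  calc θ ^ 2 * r / 8 ≤ q * (θ / 2) := by nlinarith
    _ = ∑ l ∈ Finset.range q, θ / 2 := by simp
    _ ≤ ∑ l ∈ Finset.range q, max 0 (θ - l / d) := by
        refine Finset.sum_le_sum fun l hl => le_max_of_le_right ?_
        have : l < ⌈θ * d / 2⌉₊ := (Finset.mem_range.mp hl).trans_le (min_le_right _ _)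
        have h2 : (l : ℝ) / d ≤ θ / 2 := by
          rw [div_le_iff₀ hd']; linarith [Nat.lt_ceil.mp this]
        linarith
    _ ≤ _ := Finset.sum_le_sum_of_subset_of_nonneg
        (Finset.range_mono (min_le_left _ _)) fun _ _ _ => le_max_left _ _

lemma perm_sum {r : ℕ} (v : Fin r → ℕ) (hv : Function.Injective v) (hr : ∀ i, v i < r) (φ : ℕ → ℝ) :
    ∑ i, φ (v i) = ∑ l ∈ Finset.range r, φ l := by
  have : Finset.univ.image v = Finset.range r := by
    refine Finset.eq_of_subset_of_card_le (fun x hx => ?_) ?_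
    · obtain ⟨i, _, rfl⟩ := Finset.mem_image.mp hx
      exact Finset.mem_range.mpr (hr i)
    · rw [Finset.card_image_of_injective _ hv]; simp
  rw [← this, Finset.sum_image hv.injOn]

lemma hd_sum {σ R ι : Type*} [CommRing R] (s : Finset ι) (μ : σ →₀ ℕ) (f : ι → MvPolynomial σ R) :
    hd μ (∑ i ∈ s, f i) = ∑ i ∈ s, hd μ (f i) := by
  simp [hd, map_sum, coeff_sum]

theorem roth : ∀ (k : ℕ) (σ : ℝ), 0 < σ → ∃ ω > 0, ∀ (D : Fin k → ℕ) (s t : Fin k → ℤ) (Λ : ℝ)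
    (f : MvPolynomial (Fin k) ℤ), (∀ h, 0 < D h) → (∀ h, IsCoprime (s h) (t h)) → (∀ h, t h ≠ 0) → 0 < Λ →
    (∀ h, Λ ≤ D h * Real.log ((max |s h| |t h| : ℤ) : ℝ)) → (∀ i j, i < j → (D i : ℝ) ≤ ω * D j) →
    Real.log (L1 f) ≤ ω * Λ → (∑ h, D h : ℕ) ≤ ω * Λ → f ≠ 0 → (∀ h, degreeOf h f ≤ D h) →
    ¬ Ix D σ (tr (fun h => (s h : ℚ) / t h) (map (Int.castRingHom ℚ) f)) := by
  intro k
  induction k with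
  | zero =>
    intro σ hσ
    refine ⟨1, one_pos, ?_⟩
    intro D s t Λ f _ _ _ _ _ _ _ _ hf _ hI
    have hf0 : map (Int.castRingHom ℚ) f ≠ 0 :=
      (map_ne_zero_iff _ (map_injective _ (Int.cast_injective))).mpr hf
    have := hI 0 ?_
    · simp at this; linarith
    · rw [eq_C_of_isEmpty (map (Int.castRingHom ℚ) f)]
      intro h0
      apply hf0
      rw [eq_C_of_isEmpty (map (Int.castRingHom ℚ) f)]
      rw [tr, aeval_C] at h0
      simp only [algebraMap_eq, coeff_C, if_true] at h0
      simp [h0]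
  | succ k ih =>
    intro σ hσ
    set θ := min σ 1 with hθ
    have hθ0 : 0 < θ := lt_min hσ one_pos
    have hθ1 : θ ≤ 1 := min_le_right _ _
    obtain ⟨ω', hω', IH⟩ := ih (θ ^ 2 / 100) (by positivity)
    refine ⟨min (ω' / 3) (θ ^ 2 / 1000), by positivity, ?_⟩
    intro D s t Λ f hD hst ht hΛ hH hrapid hL1 hDs hf hdeg hI
    set ω := min (ω' / 3) (θ ^ 2 / 1000) with hω
    have hω0 : 0 < ω := by positivity
    have hω1 : 3 * ω ≤ ω' := by have := min_le_left (ω' / 3) (θ ^ 2 / 1000); linarith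
    have hω2 : ω ≤ θ ^ 2 / 1000 := min_le_right _ _
    have hinj := map_injective (σ := Fin (k+1)) (Int.castRingHom ℚ) Int.cast_injective
    have hinj' := map_injective (σ := Fin k) (Int.castRingHom ℚ) Int.cast_injective
    set F := map (Int.castRingHom ℚ) f with hF
    have hF0 : F ≠ 0 := (map_ne_zero_iff _ hinj).mpr hf
    obtain ⟨r, hr0, hrD, I, g, hg, hb, hdec⟩ := decomp F hF0 (D 0)
      ((degreeOf_le_iff.mpr fun m hm => (degreeOf_le_iff.mp (hdeg 0)) m (support_map_subset _ _ hm)))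
    set b := fun j => Polynomial.coeff (finSuccEquiv ℚ k F) (I j) with hbdef
    let bZ := fun j => Polynomial.coeff (finSuccEquiv ℤ k f) (I j)
    have hbZ : ∀ j, map (Int.castRingHom ℚ) (bZ j) = b j := by
      intro j; ext m
      simp only [bZ, b, coeff_map, finSuccEquiv_coeff_coeff, hF]
    have hbL : ∀ j, L1 (bZ j) ≤ L1 f := by
      intro j
      have := L1_le_of_inj (bZ j) f (fun m => Finsupp.cons (I j) m) (Finsupp.cons_right_injective _) 1
        (fun m _ => by simp only [bZ, finSuccEquiv_coeff_coeff, one_mul]; rfl) zero_le_one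
      simpa using this
    have hbdeg : ∀ j h, degreeOf h (bZ j) ≤ D h.succ := by
      intro j h
      rw [degreeOf_le_iff]
      intro m hm
      rw [mem_support_iff, finSuccEquiv_coeff_coeff] at hm
      have := (degreeOf_le_iff.mp (hdeg h.succ)) _ (mem_support_iff.mpr hm)
      simpa using this
    obtain ⟨μ, hμ, hU⟩ := gen_wronskian (MonomialOrder.lex) r b hb
    obtain ⟨ν, hν, hV⟩ := gen_wronskian (MonomialOrder.lex) r g hg
    set U := (Matrix.of fun i j => hd (μ i) (b j)).det with hUdef
    set V := (Matrix.of fun i j => hd (ν i) (g j)).det with hVdef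
    set UZ := (Matrix.of fun i j => hd (μ i) (bZ j)).det with hUZ
    set WM := (Matrix.of fun i l => hd (Finsupp.cons (ν l 0) (μ i)) f) with hWM
    have hUmap : map (Int.castRingHom ℚ) UZ = U := by
      rw [hUZ, RingHom.map_det]
      congr 1; ext1 i j
      simp only [RingHom.mapMatrix_apply, Matrix.map_apply, Matrix.of_apply, ← hd_map, hbZ]
    have hW : map (Int.castRingHom ℚ) WM.det = i0 k ℚ V * i1 k ℚ U := by
      rw [RingHom.map_det, hUdef, hVdef, AlgHom.map_det, AlgHom.map_det, mul_comm,
        ← Matrix.det_transpose ((i0 k ℚ).mapMatrix _), ← Matrix.det_mul]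
      congr 1; ext1 i l
      simp only [RingHom.mapMatrix_apply, AlgHom.mapMatrix_apply, Matrix.map_apply, Matrix.of_apply, ← hd_map,
        Matrix.mul_apply, Matrix.transpose_apply, hWM]
      rw [← hF]
      conv_lhs => rw [hdec]
      rw [hd_sum]
      exact Finset.sum_congr rfl fun j _ => by rw [hd_tp, mul_comm]
    have hr0' : (0 : ℝ) < r := by exact_mod_cast hr0
    have hD0 : (0 : ℝ) < D 0 := by exact_mod_cast hD 0
    have hf1 := one_le_L1_int f hf
    have hrD' : (r : ℝ) ≤ D 0 + 1 := by exact_mod_cast hrD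
    have hlogr : Real.log r ≤ ω * Λ := by
      refine (Real.log_le_sub_one_of_pos hr0').trans (le_trans ?_ hDs)
      have : D 0 ≤ ∑ h, D h := Finset.single_le_sum (f := D) (fun _ _ => Nat.zero_le _) (Finset.mem_univ 0)
      have : (D 0 : ℝ) ≤ (∑ h, D h : ℕ) := by exact_mod_cast this
      linarith
    have hbound : ∀ X : ℝ, 0 < X → X ≤ r.factorial * (2 ^ (∑ h, D h) * L1 f) ^ r → Real.log X ≤ r * (3 * ω * Λ) := by
      intro X hX hXle
      have h1 : (r.factorial : ℝ) ≤ (r : ℝ) ^ r := by exact_mod_cast Nat.factorial_le_pow r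
      have h2 : X ≤ ((r : ℝ) * (2 ^ (∑ h, D h) * L1 f)) ^ r := by
        rw [mul_pow]; exact hXle.trans (mul_le_mul_of_nonneg_right h1 (by positivity))
      refine (Real.log_le_log hX h2).trans ?_
      rw [Real.log_pow, Real.log_mul (by positivity) (by positivity), Real.log_mul (by positivity) (by positivity),
        Real.log_pow]
      refine mul_le_mul_of_nonneg_left ?_ hr0'.le
      have : ((∑ h, D h : ℕ) : ℝ) * Real.log 2 ≤ (∑ h, D h : ℕ) :=
        mul_le_of_le_one_right (Nat.cast_nonneg _) (by linarith [Real.log_two_lt_d9])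
      linarith
    have hUZ0 : UZ ≠ 0 := by
      rintro h; apply hU; rw [← hUmap, h, map_zero]
    have hUL : L1 UZ ≤ r.factorial * (2 ^ (∑ h, D h) * L1 f) ^ r := by
      refine L1_det_le _ _ fun i j => ?_
      refine (L1_hd_le (fun h => D h.succ) _ _ (hbdeg j)).trans ?_
      refine mul_le_mul (pow_le_pow_right₀ one_le_two ?_) (hbL j) (L1_nonneg _) (by positivity)
      rw [Fin.sum_univ_succ]; omega
    have hWL : L1 WM.det ≤ r.factorial * (2 ^ (∑ h, D h) * L1 f) ^ r :=
      L1_det_le _ _ fun i j => L1_hd_le D _ _ hdeg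
    obtain ⟨m0, hm0⟩ := ne_zero_iff.mp hU
    obtain ⟨V', hV', hV'L⟩ := slice WM.det m0
    have hVV : map (Int.castRingHom ℚ) V' = C (coeff m0 U) * V := by
      ext e
      rw [coeff_map, hV', ← coeff_map, hW, coeff_tp, coeff_C_mul, Finsupp.cons_zero, Finsupp.tail_cons, mul_comm]
      congr 2; ext; simp
    have hV'0 : V' ≠ 0 := by
      rintro rfl
      rw [map_zero] at hVV
      exact mul_ne_zero (by simpa using hm0) hV hVV.symm
    obtain ⟨e, he, heL⟩ := R1 (s 0) (t 0) (hst 0) (ht 0) V' hV'0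
    rw [hVV, map_mul, tr, aeval_C, algebraMap_eq, mem_support_iff, coeff_C_mul] at he
    replace he := right_ne_zero_of_mul he
    have he' : (e 0 : ℝ) ≤ 3 * r * ω * D 0 := by
      have h1 := one_le_L1_int V' hV'0
      have hH1 : (0 : ℝ) < ((max |s 0| |t 0| : ℤ) : ℝ) := by
        have : 0 < max |s 0| |t 0| := lt_max_of_lt_right (abs_pos.mpr (ht 0))
        exact_mod_cast this
      have h2 := Real.log_le_log (by positivity) heL
      rw [Real.log_pow] at h2
      have h3 := hbound _ (by linarith) (hV'L.trans hWL)
      have h4 := hH 0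
      have h5 : (e 0 : ℝ) * Λ ≤ (3 * r * ω * D 0) * Λ := by
        calc (e 0 : ℝ) * Λ ≤ e 0 * (D 0 * Real.log ((max |s 0| |t 0| : ℤ) : ℝ)) :=
              mul_le_mul_of_nonneg_left h4 (Nat.cast_nonneg _)
          _ = D 0 * (e 0 * Real.log ((max |s 0| |t 0| : ℤ) : ℝ)) := by ring
          _ ≤ D 0 * (r * (3 * ω * Λ)) := mul_le_mul_of_nonneg_left (h2.trans h3) hD0.le
          _ = _ := by ring
      exact le_of_mul_le_mul_right h5 hΛ
    have hIH := IH (fun h => r * D h.succ) (fun h => s h.succ) (fun h => t h.succ) (r * Λ) UZ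
      (fun h => Nat.mul_pos hr0 (hD _)) (fun h => hst _) (fun h => ht _) (by positivity)
      (fun h => by
        have := mul_le_mul_of_nonneg_left (hH h.succ) hr0'.le
        push_cast at this ⊢; linarith)
      (fun i j hij => by
        have := hrapid i.succ j.succ (Fin.succ_lt_succ_iff.mpr hij)
        have h2 : ω * D j.succ ≤ ω' * D j.succ := mul_le_mul_of_nonneg_right (by linarith) (Nat.cast_nonneg _)
        have := mul_le_mul_of_nonneg_left (this.trans h2) hr0'.le
        push_cast; linarith)
      (by
        refine (hbound _ (by linarith [one_le_L1_int _ hUZ0]) hUL).trans ?_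
        have := mul_le_mul_of_nonneg_right hω1 (mul_pos hr0' hΛ).le
        linarith)
      (by
        rw [Fin.sum_univ_succ] at hDs
        rw [← Finset.mul_sum]
        push_cast at hDs ⊢
        have h1 : ∑ h : Fin k, (D h.succ : ℝ) ≤ ω' * Λ := by nlinarith
        have := mul_le_mul_of_nonneg_left h1 hr0'.le
        linarith) hUZ0
      (fun h => degreeOf_det_le _ _ _ fun i j => (degreeOf_hd_le _ _ _).trans (hbdeg j h))
    rw [hUmap] at hIH
    simp only [Ix, not_forall, not_le] at hIH
    obtain ⟨m1, hm1, hm1lt⟩ := hIH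
    set ξ : Fin (k+1) → ℚ := fun h => (s h : ℚ) / t h with hξ
    set φ : ℕ → ℝ := fun l => max 0 ((θ - ω) - l / D 0) with hφ
    have hIW : Ix D (∑ l, φ (ν l 0)) (tr ξ (map (Int.castRingHom ℚ) WM.det)) := by
      rw [RingHom.map_det, AlgHom.map_det]
      refine Ix_det (fun l => φ (ν l 0)) _ fun i l => ?_
      simp only [RingHom.mapMatrix_apply, AlgHom.mapMatrix_apply, Matrix.map_apply, hWM, Matrix.of_apply, ← hd_map]
      rw [← hd_tr, ← hF]
      rcases le_total ((θ - ω) - (ν l 0 : ℝ) / D 0) 0 with h | h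
      · exact Ix_nonpos _ (by simp only [hφ, max_eq_left h]; exact le_rfl)
      · refine (hI.hd (Finsupp.cons (ν l 0) (μ i))).mono ?_
        simp only [hφ, max_eq_right h]
        rw [Fin.sum_univ_succ]
        simp only [Finsupp.cons_zero, Finsupp.cons_succ]
        have h1 : ∑ h : Fin k, (μ i h : ℝ) / D h.succ ≤ ω := by
          calc ∑ h : Fin k, (μ i h : ℝ) / D h.succ ≤ ∑ h : Fin k, (μ i h : ℝ) * (ω / D 0) := by
                refine Finset.sum_le_sum fun h _ => ?_
                rw [div_eq_mul_inv]
                refine mul_le_mul_of_nonneg_left ?_ (Nat.cast_nonneg _)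
                have hpos : (0 : ℝ) < D h.succ := by exact_mod_cast hD _
                rw [inv_le_iff_one_le_mul₀ hpos, div_mul_eq_mul_div, le_div_iff₀ hD0, one_mul]
                exact hrapid 0 h.succ (Fin.succ_pos h)
            _ = ((μ i).degree : ℝ) * (ω / D 0) := by
                rw [← Finset.sum_mul, Finsupp.degree_eq_sum]; push_cast; rfl
            _ ≤ D 0 * (ω / D 0) := by
                refine mul_le_mul_of_nonneg_right ?_ (by positivity)
                have : (μ i).degree ≤ D 0 := (hμ i).trans (by omega)
                exact_mod_cast this
            _ = ω := by field_simp
        have : θ ≤ σ := min_le_left _ _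
        linarith
    have hνinj : Function.Injective fun l => ν l 0 := by
      intro l l' h
      by_contra hne
      apply hV
      refine Matrix.det_zero_of_row_eq hne ?_
      have : ν l = ν l' := by ext; simpa using h
      ext j; simp [this]
    have hνlt : ∀ l, ν l 0 < r := fun l => by
      have := hν l
      rw [Finsupp.degree_eq_sum] at this
      simp at this; omega
    rw [perm_sum _ hνinj hνlt φ] at hIW
    have hωθ : ω ≤ θ / 2 := by nlinarith
    have htri := tri_sum r (D 0) (θ - ω) (by linarith) (by linarith) (hD 0) hrD
    have hfin := hIW (Finsupp.cons (e 0) m1) (by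
      rw [hW, tr_tp, coeff_tp, Finsupp.cons_zero, Finsupp.tail_cons]
      refine mul_ne_zero ?_ hm1
      have : Finsupp.single 0 (e 0) = e := by ext; simp
      rw [this]; exact he)
    rw [Fin.sum_univ_succ] at hfin
    simp only [Finsupp.cons_zero, Finsupp.cons_succ] at hfin
    have h1 : (e 0 : ℝ) / D 0 ≤ 3 * r * ω := by rw [div_le_iff₀ hD0]; exact he'
    have h2 : ∑ h : Fin k, (m1 h : ℝ) / D h.succ < r * (θ ^ 2 / 100) := by
      have := mul_lt_mul_of_pos_left hm1lt hr0'
      rw [Finset.mul_sum] at this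
      refine lt_of_eq_of_lt (Finset.sum_congr rfl fun h _ => ?_) this
      push_cast; field_simp
    have h3 : (θ / 2) ^ 2 * r / 8 ≤ (θ - ω) ^ 2 * r / 8 := by
      have : (θ / 2) ^ 2 ≤ (θ - ω) ^ 2 := pow_le_pow_left₀ (by positivity) (by linarith) 2
      gcongr
    have h4 : θ ^ 2 / 32 * r < (3 * ω + θ ^ 2 / 100) * r := by
      linarith [h1, h2, h3, htri, hfin]
    have h5 := lt_of_mul_lt_mul_right h4 hr0'.le
    linarith [pow_pos hθ0 2]

end Sub

namespace Sub

/-- multidegree exponents -/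
def VV {k : ℕ} (ι : Type*) [Fintype ι] [DecidableEq ι] (D : Fin k → ℕ) : Finset (Fin k → ι → ℕ) :=
  Fintype.piFinset fun h => Finset.piAntidiag Finset.univ (D h)

section count
variable {ι : Type*} [Fintype ι] [DecidableEq ι]

lemma mem_VV {k : ℕ} {D : Fin k → ℕ} {v : Fin k → ι → ℕ} : v ∈ VV ι D ↔ ∀ h, ∑ i, v h i = D h := by
  simp [VV, Fintype.mem_piFinset, Finset.mem_piAntidiag]

lemma mean_zero [Nonempty ι] (d : ℕ) (hd : 0 < d) (i : ι) :
    ∑ u ∈ Finset.piAntidiag (Finset.univ : Finset ι) d, ((u i : ℝ) / d - 1 / Fintype.card ι) = 0 := by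
  set s := Finset.piAntidiag (Finset.univ : Finset ι) d
  have hsym : ∀ j, ∑ u ∈ s, (u j : ℝ) = ∑ u ∈ s, (u i : ℝ) := by
    intro j
    refine Finset.sum_bij' (fun u _ => u ∘ Equiv.swap i j) (fun u _ => u ∘ Equiv.swap i j) ?_ ?_ ?_ ?_ ?_
    · intro u hu
      simp only [s, Finset.mem_piAntidiag, Finset.mem_univ, implies_true, and_true, Function.comp] at hu ⊢
      rw [← hu]; exact Equiv.sum_comp (Equiv.swap i j) u
    · intro u hu
      simp only [s, Finset.mem_piAntidiag, Finset.mem_univ, implies_true, and_true, Function.comp] at hu ⊢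
      rw [← hu]; exact Equiv.sum_comp (Equiv.swap i j) u
    · intro u _; ext; simp
    · intro u _; ext; simp
    · intro u _; simp
  have htot : ∑ j, ∑ u ∈ s, (u j : ℝ) = d * s.card := by
    rw [Finset.sum_comm]
    rw [Finset.sum_congr rfl (g := fun _ => (d : ℝ))]
    · simp [mul_comm]
    · intro u hu
      have := (Finset.mem_piAntidiag.mp hu).1
      exact_mod_cast this
  rw [Finset.sum_congr rfl fun j _ => hsym j] at htot
  simp only [Finset.sum_const, Finset.card_univ, nsmul_eq_mul] at htot
  have hN : (Fintype.card ι : ℝ) ≠ 0 := by exact_mod_cast Fintype.card_ne_zero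
  have hd' : (d : ℝ) ≠ 0 := by exact_mod_cast hd.ne'
  rw [Finset.sum_sub_distrib, ← Finset.sum_div]
  simp only [Finset.sum_const, nsmul_eq_mul]
  field_simp
  linarith

lemma chernoff [Nonempty ι] {k : ℕ} (D : Fin k → ℕ) (hD : ∀ h, 0 < D h) (i : ι) (ε : ℝ) (h0 : 0 < ε) (h1 : ε ≤ 1)
    (τ : ℝ) (hτ : |τ| = 1) :
    (((VV ι D).filter fun v => ε * k < τ * ∑ h, ((v h i : ℝ) / D h - 1 / Fintype.card ι)).card : ℝ)
      ≤ Real.exp (-(ε ^ 2 * k / 4)) * (VV ι D).card := by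
  set X : Fin k → (ι → ℕ) → ℝ := fun h u => (u i : ℝ) / D h - 1 / Fintype.card ι
  set lam : ℝ := ε / 2
  have hcard1 : (1 : ℝ) / Fintype.card ι ≤ 1 := by
    have : (1 : ℝ) ≤ Fintype.card ι := by exact_mod_cast Fintype.card_pos
    exact div_le_one_of_le₀ this (by linarith)
  have hX : ∀ h, ∀ u ∈ Finset.piAntidiag (Finset.univ : Finset ι) (D h), |X h u| ≤ 1 := by
    intro h u hu
    have hu1 : u i ≤ D h := by
      rw [← (Finset.mem_piAntidiag.mp hu).1]
      exact Finset.single_le_sum (fun _ _ => Nat.zero_le _) (Finset.mem_univ i)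
    have h2 : (u i : ℝ) / D h ≤ 1 := div_le_one_of_le₀ (by exact_mod_cast hu1) (by positivity)
    have h3 : (0 : ℝ) ≤ (u i : ℝ) / D h := by positivity
    have h4 : (0 : ℝ) ≤ 1 / Fintype.card ι := by positivity
    rw [abs_le]; constructor <;> simp only [X] <;> linarith
  have hblock : ∀ h, ∑ u ∈ Finset.piAntidiag (Finset.univ : Finset ι) (D h), Real.exp (lam * (τ * X h u))
      ≤ Real.exp (lam ^ 2) * (Finset.piAntidiag (Finset.univ : Finset ι) (D h)).card := by
    intro h
    have hpt : ∀ u ∈ Finset.piAntidiag (Finset.univ : Finset ι) (D h),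
        Real.exp (lam * (τ * X h u)) ≤ lam * τ * X h u + (1 + lam ^ 2) := by
      intro u hu
      have hxx : |lam * (τ * X h u)| ≤ lam := by
        rw [abs_mul, abs_mul, hτ, abs_of_nonneg (by positivity : (0 : ℝ) ≤ lam), one_mul]
        exact mul_le_of_le_one_right (by positivity) (hX h u hu)
      have := Real.abs_exp_sub_one_sub_id_le (hxx.trans (by simp only [lam]; linarith))
      have h5 : (lam * (τ * X h u)) ^ 2 ≤ lam ^ 2 := sq_le_sq' (by linarith [abs_le.mp hxx]) (abs_le.mp hxx).2
      linarith [(abs_le.mp this).2]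
    refine (Finset.sum_le_sum hpt).trans ?_
    rw [Finset.sum_add_distrib, ← Finset.mul_sum, mean_zero _ (hD h)]
    simp only [mul_zero, zero_add, Finset.sum_const, nsmul_eq_mul]
    rw [mul_comm]
    exact mul_le_mul_of_nonneg_right (by linarith [Real.add_one_le_exp (lam ^ 2)]) (by positivity)
  have htot : ∑ v ∈ VV ι D, Real.exp (lam * (τ * ∑ h, X h (v h))) ≤ Real.exp (lam ^ 2) ^ k * (VV ι D).card := by
    calc _ = ∑ v ∈ VV ι D, ∏ h, Real.exp (lam * (τ * X h (v h))) := by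
          refine Finset.sum_congr rfl fun v _ => ?_
          rw [← Real.exp_sum, Finset.mul_sum, Finset.mul_sum]
      _ = ∏ h, ∑ u ∈ Finset.piAntidiag (Finset.univ : Finset ι) (D h), Real.exp (lam * (τ * X h u)) :=
          (Finset.prod_univ_sum _ (fun h u => Real.exp (lam * (τ * X h u)))).symm
      _ ≤ ∏ h, (Real.exp (lam ^ 2) * (Finset.piAntidiag (Finset.univ : Finset ι) (D h)).card) :=
          Finset.prod_le_prod (fun h _ => Finset.sum_nonneg fun _ _ => (Real.exp_pos _).le) fun h _ => hblock h
      _ = _ := by rw [Finset.prod_mul_distrib, VV, Fintype.card_piFinset]; simp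
  set B := (VV ι D).filter fun v => ε * k < τ * ∑ h, X h (v h)
  have hB : (B.card : ℝ) * Real.exp (lam * (ε * k)) ≤ Real.exp (lam ^ 2) ^ k * (VV ι D).card := by
    refine le_trans ?_ htot
    rw [← nsmul_eq_mul]
    refine (Finset.card_nsmul_le_sum B (fun v => Real.exp (lam * (τ * ∑ h, X h (v h)))) _ ?_).trans ?_
    · intro v hv
      exact Real.exp_le_exp.mpr (mul_le_mul_of_nonneg_left (Finset.mem_filter.mp hv).2.le (by positivity))
    · exact Finset.sum_le_sum_of_subset_of_nonneg (Finset.filter_subset _ _) fun _ _ _ => (Real.exp_pos _).le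
  rw [← le_div_iff₀ (Real.exp_pos _)] at hB
  refine hB.trans (le_of_eq ?_)
  rw [← Real.exp_nat_mul, mul_comm _ ((VV ι D).card : ℝ), mul_div_assoc, ← Real.exp_sub, mul_comm]
  congr 2
  simp only [lam]; ring

/-- unbalanced exponents -/
def Unb {k : ℕ} (ε : ℝ) (D : Fin k → ℕ) (v : Fin k → ι → ℕ) : Prop :=
  ∃ i, ε * k < |∑ h, ((v h i : ℝ) / D h - 1 / Fintype.card ι)|

open Classical in
lemma unb_card [Nonempty ι] {k : ℕ} (D : Fin k → ℕ) (hD : ∀ h, 0 < D h) (ε : ℝ) (h0 : 0 < ε) (h1 : ε ≤ 1) :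
    (((VV ι D).filter (Unb ε D)).card : ℝ)
      ≤ 2 * Fintype.card ι * Real.exp (-(ε ^ 2 * k / 4)) * (VV ι D).card := by
  let S : ℝ → ι → Finset (Fin k → ι → ℕ) := fun τ i =>
    (VV ι D).filter fun v => ε * k < τ * ∑ h, ((v h i : ℝ) / D h - 1 / Fintype.card ι)
  have hsub : (VV ι D).filter (Unb ε D) ⊆ Finset.univ.biUnion fun i => S 1 i ∪ S (-1) i := by
    intro v hv
    obtain ⟨hv1, i, hi⟩ := Finset.mem_filter.mp hv
    refine Finset.mem_biUnion.mpr ⟨i, Finset.mem_univ _, Finset.mem_union.mpr ?_⟩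
    rcases lt_abs.mp hi with h | h
    · exact Or.inl (Finset.mem_filter.mpr ⟨hv1, by rwa [one_mul]⟩)
    · exact Or.inr (Finset.mem_filter.mpr ⟨hv1, by rwa [neg_one_mul]⟩)
  have h2 := (Finset.card_le_card hsub).trans Finset.card_biUnion_le
  have h3 : (((VV ι D).filter (Unb ε D)).card : ℝ) ≤ ∑ i, (((S 1 i).card : ℝ) + (S (-1) i).card) := by
    refine le_trans (by exact_mod_cast h2) (?_ : ((∑ i, (S 1 i ∪ S (-1) i).card : ℕ) : ℝ) ≤ _)
    push_cast
    exact Finset.sum_le_sum fun i _ => by exact_mod_cast Finset.card_union_le _ _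
  refine h3.trans ?_
  refine (Finset.sum_le_sum fun i _ => add_le_add (chernoff D hD i ε h0 h1 1 (by simp))
    (chernoff D hD i ε h0 h1 (-1) (by simp))).trans (le_of_eq ?_)
  simp only [Finset.sum_const, Finset.card_univ, nsmul_eq_mul]; ring

end count
end Sub

namespace Sub
open MvPolynomial NumberField

/-- exponent vector -/
noncomputable def ex {k : ℕ} {ι : Type*} [Fintype ι] (v : Fin k → ι → ℕ) : Fin k × ι →₀ ℕ :=
  Finsupp.equivFunOnFinite.symm fun p => v p.1 p.2

/-- blockwise linear forms -/
noncomputable def lf {k : ℕ} {ι κ R : Type*} [Fintype κ] [CommRing R] (M : Fin k → ι → κ → R) (p : Fin k × ι) :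
    MvPolynomial (Fin k × κ) R := ∑ j, C (M p.1 p.2 j) * X (p.1, j)

/-- multihomogeneous -/
def MH {k : ℕ} {ι R : Type*} [Fintype ι] [CommRing R] (D : Fin k → ℕ) (f : MvPolynomial (Fin k × ι) R) : Prop :=
  ∀ m, coeff m f ≠ 0 → ∀ h, ∑ i, m (h, i) = D h

section MH
variable {k : ℕ} {ι κ R : Type*} [Fintype ι] [Fintype κ] [CommRing R]

@[simp] lemma ex_apply (v : Fin k → ι → ℕ) (p) : ex v p = v p.1 p.2 := rfl

lemma MH_sum {D : Fin k → ℕ} {α : Type*} (s : Finset α) (f : α → MvPolynomial (Fin k × ι) R)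
    (h : ∀ a ∈ s, MH D (f a)) : MH D (∑ a ∈ s, f a) := by
  intro m hm
  rw [coeff_sum] at hm
  obtain ⟨i, hi, hne⟩ := Finset.exists_ne_zero_of_sum_ne_zero hm
  exact h i hi m hne

lemma MH.mul {D₁ D₂ : Fin k → ℕ} {f g : MvPolynomial (Fin k × ι) R} (hf : MH D₁ f) (hg : MH D₂ g) :
    MH (D₁ + D₂) (f * g) := by
  classical
  intro m hm h
  rw [coeff_mul] at hm
  obtain ⟨⟨a, b⟩, hab, hne⟩ := Finset.exists_ne_zero_of_sum_ne_zero hm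
  replace hab : a + b = m := by simpa using hab
  simp [← hab, Finset.sum_add_distrib, hf a (left_ne_zero_of_mul hne) h, hg b (right_ne_zero_of_mul hne) h]

lemma MH_C (c : R) : MH 0 (C c : MvPolynomial (Fin k × ι) R) := by
  classical
  intro m hm h
  rw [coeff_C] at hm
  have : 0 = m := by by_contra h0; simp [h0] at hm
  simp [← this]

lemma MH_prod {α : Type*} (s : Finset α) (D : α → Fin k → ℕ) (f : α → MvPolynomial (Fin k × ι) R)
    (h : ∀ i ∈ s, MH (D i) (f i)) : MH (∑ i ∈ s, D i) (∏ i ∈ s, f i) := by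
  classical
  induction s using Finset.induction_on with
  | empty => simpa only [Finset.sum_empty, Finset.prod_empty, C_1] using MH_C (k := k) (ι := ι) (1 : R)
  | insert a s ha ih =>
    rw [Finset.sum_insert ha, Finset.prod_insert ha]
    exact (h a (Finset.mem_insert_self _ _)).mul (ih fun i hi => h i (Finset.mem_insert_of_mem hi))

lemma MH_lf (M : Fin k → ι → κ → R) (p : Fin k × ι) : MH (Pi.single p.1 1) (lf M p) := by
  classical
  refine MH_sum _ _ fun j _ m hm h => ?_
  rw [coeff_C_mul, coeff_X] at hm
  have : Finsupp.single (p.1, j) 1 = m := by by_contra h0; simp [h0] at hm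
  rw [← this]
  by_cases hh : h = p.1
  · subst hh; simp [Finsupp.single_apply]
  · rw [Pi.single_eq_of_ne hh]
    exact Finset.sum_eq_zero fun i _ => by simp [Finsupp.single_apply, Ne.symm hh]

variable {S : Type*} [CommRing S] [Algebra S R]

lemma MH_pow {D : Fin k → ℕ} {f : MvPolynomial (Fin k × ι) R} (hf : MH D f) (n : ℕ) : MH (n • D) (f ^ n) := by
  have := MH_prod (Finset.range n) (fun _ => D) (fun _ => f) fun _ _ => hf
  simpa using this

lemma aeval_lf_eq (M : Fin k → ι → κ → R) (F : MvPolynomial (Fin k × ι) S) :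
    aeval (lf M) F = ∑ m ∈ F.support, C (algebraMap S R (coeff m F)) * ∏ p, lf M p ^ m p := by
  rw [aeval_def, eval₂_eq']
  rfl

lemma MH.aeval {D : Fin k → ℕ} {F : MvPolynomial (Fin k × ι) S} (hF : MH D F) (M : Fin k → ι → κ → R) :
    MH D (aeval (lf M) F) := by
  classical
  rw [aeval_lf_eq]
  refine MH_sum _ _ fun m hm => ?_
  have h1 := (MH_C (k := k) (ι := κ) (algebraMap S R (coeff m F))).mul
    (MH_prod Finset.univ _ _ fun p _ => MH_pow (MH_lf M p) (m p))
  convert h1 using 1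
  ext h
  rw [← hF m (mem_support_iff.mp hm) h]
  simp only [zero_add, Finset.sum_apply, Pi.smul_apply, smul_eq_mul, Fintype.sum_prod_type, Pi.single_apply,
    mul_ite, mul_one, mul_zero]
  rw [Finset.sum_comm]
  simp

lemma aeval_lf_comp {μ : Type*} [Fintype μ] (M : Fin k → ι → κ → R) (M' : Fin k → κ → μ → R)
    (F : MvPolynomial (Fin k × ι) S) : MvPolynomial.aeval (lf M') (aeval (lf M) F) =
      aeval (lf fun h i l => ∑ j, M h i j * M' h j l) F := by
  induction F using MvPolynomial.induction_on with
  | C a =>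
    simp only [aeval_C]
    rw [IsScalarTower.algebraMap_apply S R (MvPolynomial (Fin k × κ) R),
      IsScalarTower.algebraMap_apply S R (MvPolynomial (Fin k × μ) R), algebraMap_eq, aeval_C]
  | add p q hp hq => simp only [map_add, hp, hq]
  | mul_X p i hp =>
    simp only [map_mul, hp, aeval_X]
    congr 1
    simp only [lf, map_sum, map_mul, aeval_C, aeval_X, algebraMap_eq, Finset.mul_sum, Finset.sum_mul]
    rw [Finset.sum_comm]
    exact Finset.sum_congr rfl fun _ _ => Finset.sum_congr rfl fun _ _ => by ring

lemma L1_aeval_lf_le {B : Type*} [NormedCommRing B] [NormOneClass B] (φ : R →+* B) (M : Fin k → ι → κ → R)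
    (c : Fin k × ι → ℝ) (hc : ∀ p, ∑ j, ‖φ (M p.1 p.2 j)‖ ≤ c p) (F : MvPolynomial (Fin k × ι) S) :
    L1 (map φ (aeval (lf M) F)) ≤ ∑ m ∈ F.support, ‖φ (algebraMap S R (coeff m F))‖ * ∏ p, c p ^ m p := by
  rw [aeval_lf_eq, map_sum]
  refine (L1_sum_le _ _).trans (Finset.sum_le_sum fun m _ => ?_)
  rw [map_mul, map_C, map_prod]
  refine (L1_mul_le _ _).trans ?_
  rw [L1_C]
  refine mul_le_mul_of_nonneg_left ?_ (norm_nonneg _)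
  refine (L1_prod_le _ _).trans (Finset.prod_le_prod (fun _ _ => L1_nonneg _) fun p _ => ?_)
  rw [map_pow]
  refine (L1_pow_le _ _).trans (pow_le_pow_left₀ (L1_nonneg _) (le_trans ?_ (hc p)) _)
  rw [lf, map_sum]
  refine (L1_sum_le _ _).trans (Finset.sum_le_sum fun j _ => ?_)
  rw [map_mul, map_C, map_X]
  refine (L1_mul_le _ _).trans ?_
  rw [L1_C, L1_X, mul_one]

end MH

lemma coord_bound (K : Type*) [Field K] [NumberField K] : ∃ c : ℝ, 1 ≤ c ∧ ∀ (α : 𝓞 K) i,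
    |((RingOfIntegers.basis K).repr α i : ℝ)| ≤ c * house (algebraMap (𝓞 K) K α) := by
  classical
  obtain ⟨c, hc⟩ : ∃ c : ℝ, ∀ (α : 𝓞 K) i,
    |((RingOfIntegers.basis K).repr α i : ℝ)| ≤ c * house (algebraMap (𝓞 K) K α) := by
    refine ⟨_, fun α i => le_trans (le_of_eq ?_)
      (house.basis_repr_norm_le_const_mul_house (K := K) α ((equivReindex K).symm i))⟩
    simp
  exact ⟨max 1 c, le_max_left _ _, fun α i => (hc α i).trans
    (mul_le_mul_of_nonneg_right (le_max_right _ _) (house_nonneg _))⟩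

end Sub

namespace Sub
open MvPolynomial NumberField

lemma ex_inj {k : ℕ} {ι : Type*} [Fintype ι] : Function.Injective (ex : (Fin k → ι → ℕ) → _) := by
  intro a b h
  funext x y
  exact DFunLike.congr_fun h (x, y)

lemma VV_card_le {k : ℕ} {ι : Type*} [Fintype ι] [DecidableEq ι] (D : Fin k → ℕ) :
    (VV ι D).card ≤ (2 ^ Fintype.card ι) ^ ∑ h, D h := by
  rw [VV, Fintype.card_piFinset, ← Finset.prod_pow_eq_pow_sum]
  refine Finset.prod_le_prod' fun h _ => ?_
  calc (Finset.piAntidiag (Finset.univ : Finset ι) (D h)).card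
      ≤ (Fintype.piFinset fun _ : ι => Finset.range (D h + 1)).card := by
        refine Finset.card_le_card fun u hu => Fintype.mem_piFinset.mpr fun i => Finset.mem_range_succ_iff.mpr ?_
        rw [← (Finset.mem_piAntidiag.mp hu).1]
        exact Finset.single_le_sum (fun _ _ => Nat.zero_le _) (Finset.mem_univ i)
    _ = (D h + 1) ^ Fintype.card ι := by rw [Fintype.card_piFinset]; simp
    _ ≤ (2 ^ D h) ^ Fintype.card ι := Nat.pow_le_pow_left (Nat.lt_two_pow_self) _
    _ = _ := by rw [← pow_mul, ← pow_mul, mul_comm]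

section
attribute [local instance] Matrix.seminormedAddCommGroup

theorem siegel (K : Type*) [Field K] [NumberField K] {ι : Type*} [Fintype ι] [DecidableEq ι] [Nonempty ι]
    (Ms : Fin 2 → ι → ι → 𝓞 K) : ∃ C : ℝ, 1 ≤ C ∧ ∀ ε : ℝ, 0 < ε → ε ≤ 1 → ∃ k0 : ℕ, 0 < k0 ∧ ∀ k ≥ k0,
      ∀ D : Fin k → ℕ, (∀ h, 0 < D h) → ∃ F : MvPolynomial (Fin k × ι) ℤ, F ≠ 0 ∧ MH D F ∧
        L1 F ≤ C ^ (∑ h, D h) ∧ ∀ s v, Unb ε D v → coeff (ex v) (aeval (lf fun _ : Fin k => Ms s) F) = 0 := by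
  classical
  obtain ⟨c, hc1, hc⟩ := coord_bound K
  let φ : 𝓞 K →+* ((K →+* ℂ) → ℂ) := (canonicalEmbedding K).comp (algebraMap (𝓞 K) K)
  obtain ⟨Cm, hCm1, hCm⟩ : ∃ Cm : ℝ, 1 ≤ Cm ∧ ∀ s i, ∑ j, ‖φ (Ms s i j)‖ ≤ Cm := by
    refine ⟨1 + ∑ s, ∑ i, ∑ j, ‖φ (Ms s i j)‖, ?_, fun s i => ?_⟩
    · have : 0 ≤ ∑ s, ∑ i, ∑ j, ‖φ (Ms s i j)‖ := by positivity
      linarith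
    · have h1 : ∑ j, ‖φ (Ms s i j)‖ ≤ ∑ i, ∑ j, ‖φ (Ms s i j)‖ :=
        Finset.single_le_sum (f := fun i => ∑ j, ‖φ (Ms s i j)‖) (fun _ _ => by positivity) (Finset.mem_univ i)
      have h2 : ∑ i, ∑ j, ‖φ (Ms s i j)‖ ≤ ∑ s, ∑ i, ∑ j, ‖φ (Ms s i j)‖ :=
        Finset.single_le_sum (f := fun s => ∑ i, ∑ j, ‖φ (Ms s i j)‖) (fun _ _ => by positivity) (Finset.mem_univ s)
      linarith
  set N := Fintype.card ι with hN
  set d := Fintype.card (Module.Free.ChooseBasisIndex ℤ (𝓞 K)) with hd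
  refine ⟨(2 ^ N) * (2 ^ N) * (c * Cm), ?_, fun ε h0 h1 => ?_⟩
  · have : (1 : ℝ) ≤ 2 ^ N := one_le_pow₀ one_le_two
    have h2 : 1 ≤ c * Cm := one_le_mul_of_one_le_of_one_le hc1 hCm1
    exact one_le_mul_of_one_le_of_one_le (one_le_mul_of_one_le_of_one_le this this) h2
  obtain ⟨k0, hk0⟩ : ∃ k0 : ℕ, ∀ k ≥ k0, 2 * (2 * d * (2 * N * Real.exp (-(ε ^ 2 * k / 4)))) ≤ (1 : ℝ) := by
    have h2 : Tendsto (fun k : ℕ => 2 * (2 * d * (2 * N * Real.exp (-(ε ^ 2 * k / 4)))) : ℕ → ℝ) atTop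
        (nhds (2 * (2 * d * (2 * N * 0)))) := by
      refine Tendsto.const_mul _ (Tendsto.const_mul _ (Tendsto.const_mul _ ?_))
      refine Real.tendsto_exp_neg_atTop_nhds_zero.comp ?_
      refine Tendsto.congr (fun k => by ring : ∀ k : ℕ, ε ^ 2 / 4 * (k : ℝ) = ε ^ 2 * k / 4) ?_
      exact Tendsto.const_mul_atTop (by positivity) tendsto_natCast_atTop_atTop
    have := h2.eventually_le_const (u := 1) (by norm_num)
    obtain ⟨k0, hk0⟩ := eventually_atTop.mp this
    exact ⟨k0, hk0⟩
  refine ⟨k0 + 1, Nat.succ_pos _, fun k hk D hD => ?_⟩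
  set SU := (VV ι D).filter (Unb ε D) with hSU
  let α := Fin 2 × SU × Module.Free.ChooseBasisIndex ℤ (𝓞 K)
  let β := {v // v ∈ VV ι D}
  let co : Fin 2 → SU → β → 𝓞 K := fun s u v =>
    coeff (ex u.1) (aeval (lf fun _ : Fin k => Ms s) (monomial (ex v.1) (1 : ℤ)))
  let A : Matrix α β ℤ := fun a v => (RingOfIntegers.basis K).repr (co a.1 a.2.1 v) a.2.2
  have hco : ∀ s u v, house (algebraMap (𝓞 K) K (co s u v)) ≤ Cm ^ ∑ h, D h := by
    intro s u v
    have h3 := L1_aeval_lf_le φ (fun _ : Fin k => Ms s) (fun _ => Cm) (fun p => hCm s p.2)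
      (monomial (ex v.1) (1 : ℤ))
    rw [support_monomial, if_neg one_ne_zero, Finset.sum_singleton, coeff_monomial, if_pos rfl,
      map_one (algebraMap ℤ (𝓞 K)), map_one φ, norm_one, one_mul, Finset.prod_pow_eq_pow_sum, Fintype.sum_prod_type] at h3
    simp only [ex_apply, mem_VV.mp v.2] at h3
    refine le_trans (le_of_eq ?_) ((coeff_le_L1 _ (ex u.1)).trans h3)
    rw [coeff_map]; rfl
  have hDs : ∑ h, D h ≠ 0 := by
    have := Finset.single_le_sum (f := D) (fun _ _ => Nat.zero_le _) (Finset.mem_univ (⟨0, by omega⟩ : Fin k))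
    have := hD ⟨0, by omega⟩
    omega
  have hV0 : Nonempty β := by
    refine ⟨⟨fun h => Pi.single (Classical.arbitrary ι) (D h), mem_VV.mpr fun h => by simp⟩⟩
  have hcα : 2 * Fintype.card α ≤ Fintype.card β := by
    have h4 := unb_card (ι := ι) D hD ε h0 h1
    have h5 := hk0 k (by omega)
    have : ((2 * Fintype.card α : ℕ) : ℝ) ≤ (Fintype.card β : ℕ) := by
      simp only [α, β, Fintype.card_prod, Fintype.card_fin, Fintype.card_coe, ← hd]
      push_cast
      calc 2 * (2 * ((SU.card : ℝ) * d))
          ≤ 2 * (2 * ((2 * N * Real.exp (-(ε ^ 2 * k / 4)) * (VV ι D).card) * d)) := by gcongr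
        _ = 2 * (2 * d * (2 * N * Real.exp (-(ε ^ 2 * k / 4)))) * (VV ι D).card := by ring
        _ ≤ 1 * (VV ι D).card := mul_le_mul_of_nonneg_right h5 (Nat.cast_nonneg _)
        _ = _ := one_mul _
    exact_mod_cast this
  have hβ0 : 0 < Fintype.card β := Fintype.card_pos
  have hcC : 1 ≤ c * Cm ^ ∑ h, D h := one_le_mul_of_one_le_of_one_le hc1 (one_le_pow₀ hCm1)
  obtain ⟨x, hx0, hAx, hxn⟩ : ∃ x : β → ℤ, x ≠ 0 ∧ A.mulVec x = 0 ∧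
      ∀ v, |(x v : ℝ)| ≤ Fintype.card β * (c * Cm ^ ∑ h, D h) := by
    have hβ1 : (1 : ℝ) ≤ Fintype.card β := by exact_mod_cast hβ0
    rcases Nat.eq_zero_or_pos (Fintype.card α) with h | h
    · have : IsEmpty α := Fintype.card_eq_zero_iff.mp h
      refine ⟨fun _ => 1, fun h => ?_, Subsingleton.elim _ _, fun v => ?_⟩
      · have := congrFun h hV0.some; simp at this
      · simpa using one_le_mul_of_one_le_of_one_le hβ1 hcC
    · obtain ⟨x, hx0, hAx, hxn⟩ := Int.Matrix.exists_ne_zero_int_vec_norm_le A (by omega) h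
      refine ⟨x, hx0, hAx, fun v => ?_⟩
      have h6 : ‖A‖ ≤ c * Cm ^ ∑ h, D h := by
        rw [Matrix.norm_le_iff (by linarith)]
        intro a v
        rw [Int.norm_eq_abs]
        exact (hc _ _).trans (mul_le_mul_of_nonneg_left (hco _ _ _) (by linarith))
      have h7 : ((Fintype.card β : ℝ) * max 1 ‖A‖) ^ ((Fintype.card α : ℝ) / (Fintype.card β - Fintype.card α))
          ≤ Fintype.card β * max 1 ‖A‖ := by
        conv_rhs => rw [← Real.rpow_one (Fintype.card β * max 1 ‖A‖)]
        refine Real.rpow_le_rpow_of_exponent_le (one_le_mul_of_one_le_of_one_le hβ1 (le_max_left _ _)) ?_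
        have : (2 : ℝ) * Fintype.card α ≤ Fintype.card β := by exact_mod_cast hcα
        have h' : (0 : ℝ) < Fintype.card α := by exact_mod_cast h
        exact div_le_one_of_le₀ (by linarith) (by linarith)
      have h8 := (norm_le_pi_norm x v).trans (hxn.trans h7)
      rw [Int.norm_eq_abs] at h8
      exact h8.trans (mul_le_mul_of_nonneg_left (max_le hcC h6) (by positivity))
  set F : MvPolynomial (Fin k × ι) ℤ := ∑ v : β, monomial (ex v.1) (x v) with hF
  have hFc : ∀ v : β, coeff (ex v.1) F = x v := by
    intro v
    simp only [hF, coeff_sum, coeff_monomial]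
    rw [Finset.sum_eq_single v]
    · simp
    · intro b _ hb
      rw [if_neg]; intro h; exact hb (Subtype.ext (ex_inj h))
    · simp
  have hMH : MH D F := by
    refine MH_sum _ _ fun v _ m hm h => ?_
    rw [coeff_monomial] at hm
    have : ex v.1 = m := by by_contra h0; simp [h0] at hm
    rw [← this]; exact mem_VV.mp v.2 h
  refine ⟨F, ?_, hMH, ?_, ?_⟩
  · intro h
    apply hx0; funext v; rw [← hFc, h]; simp
  · have hβn : (Fintype.card β : ℝ) ≤ (2 ^ N) ^ ∑ h, D h := by
      have := VV_card_le (ι := ι) D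
      simp only [β, Fintype.card_coe]
      exact_mod_cast this
    calc L1 F ≤ ∑ v : β, |(x v : ℝ)| := by
          refine (L1_sum_le _ _).trans (Finset.sum_le_sum fun v _ => ?_)
          rw [L1_monomial, Int.norm_eq_abs]
      _ ≤ ∑ v : β, (Fintype.card β * (c * Cm ^ ∑ h, D h) : ℝ) := Finset.sum_le_sum fun v _ => hxn v
      _ = Fintype.card β * (Fintype.card β * (c * Cm ^ ∑ h, D h)) := by simp
      _ ≤ (2 ^ N) ^ (∑ h, D h) * ((2 ^ N) ^ (∑ h, D h) * (c ^ (∑ h, D h) * Cm ^ ∑ h, D h)) := by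
          gcongr
          exact le_self_pow₀ hc1 hDs
      _ = _ := by simp only [mul_pow]; ring
  · intro s v hv
    by_cases hvV : v ∈ VV ι D
    · let u : SU := ⟨v, Finset.mem_filter.mpr ⟨hvV, hv⟩⟩
      have h9 : coeff (ex v) (aeval (lf fun _ : Fin k => Ms s) F) = ∑ w : β, x w • co s u w := by
        rw [hF, map_sum, coeff_sum]
        refine Finset.sum_congr rfl fun w _ => ?_
        rw [show monomial (ex w.1) (x w) = x w • monomial (ex w.1) (1 : ℤ) by rw [smul_monomial, smul_eq_mul, mul_one],
          map_zsmul, coeff_smul]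
      rw [h9]
      apply (RingOfIntegers.basis K).repr.injective
      ext e
      have h10 := congrFun hAx (s, u, e)
      simp only [Matrix.mulVec, dotProduct, Pi.zero_apply] at h10
      simp only [map_sum, map_zsmul, map_zero, Finsupp.coe_finsetSum, Finset.sum_apply, Finsupp.coe_smul,
        Pi.smul_apply, Finsupp.coe_zero, Pi.zero_apply, smul_eq_mul]
      rw [← h10]
      exact Finset.sum_congr rfl fun w _ => mul_comm _ _
    · by_contra hne
      exact hvV (mem_VV.mpr fun h => (hMH.aeval (fun _ : Fin k => Ms s)) _ hne h)

end

end Sub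

namespace Sub
open MvPolynomial NumberField

section
variable {k : ℕ} {ι κ R S : Type*} [Fintype ι] [Fintype κ] [CommRing R] [CommRing S] [Algebra S R]

lemma coeff_scale [DecidableEq κ] (g : MvPolynomial (Fin k × κ) R) (sc : Fin k → κ → R) (m : Fin k × κ →₀ ℕ) :
    coeff m (aeval (lf fun h i j => if i = j then sc h i else 0) g) = coeff m g * ∏ p, sc p.1 p.2 ^ m p := by
  classical
  have h1 : ∀ p, lf (fun h i j => if i = j then sc h i else 0) p = C (sc p.1 p.2) * X p := by
    intro p
    rw [lf, Finset.sum_eq_single p.2]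
    · simp
    · intro b _ hb; rw [if_neg hb.symm]; simp
    · simp
  have h2 : ∀ m' : Fin k × κ →₀ ℕ, ∏ p, (C (sc p.1 p.2) * X p : MvPolynomial (Fin k × κ) R) ^ m' p =
      monomial m' (∏ p, sc p.1 p.2 ^ m' p) := by
    intro m'
    rw [monomial_eq, Finsupp.prod_fintype _ _ (by simp), map_prod, ← Finset.prod_mul_distrib]
    exact Finset.prod_congr rfl fun p _ => by rw [mul_pow, map_pow]
  rw [aeval_lf_eq]
  simp only [h1, h2, coeff_sum, coeff_C_mul, coeff_monomial, mul_ite, mul_zero, Finset.sum_ite_eq', Algebra.algebraMap_self,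
    RingHom.id_apply]
  split_ifs with h
  · rfl
  · rw [notMem_support_iff.mp h, zero_mul]

lemma aeval_lf_scale [DecidableEq κ] (M : Fin k → ι → κ → R) (sc : Fin k → κ → R) (f : MvPolynomial (Fin k × ι) S)
    (m : Fin k × κ →₀ ℕ) : coeff m (aeval (lf fun h i j => M h i j * sc h j) f) =
      coeff m (aeval (lf M) f) * ∏ p, sc p.1 p.2 ^ m p := by
  rw [← coeff_scale, aeval_lf_comp]
  simp

lemma aeval_lf_smul [DecidableEq ι] (δ : R) (D : Fin k → ℕ) (f : MvPolynomial (Fin k × ι) S) (hf : MH D f) :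
    aeval (lf fun _ i j => if i = j then δ else 0) f = C (δ ^ ∑ h, D h) * map (algebraMap S R) f := by
  have hmap : aeval (lf fun (_ : Fin k) i j => if i = j then δ else 0) f =
      aeval (lf fun (_ : Fin k) i j => if i = j then δ else 0) (map (algebraMap S R) f) := by
    rw [aeval_map_algebraMap]
  ext m
  rw [hmap, coeff_scale (sc := fun _ _ => δ), coeff_C_mul, Finset.prod_pow_eq_pow_sum, Fintype.sum_prod_type]
  by_cases h : coeff m f = 0
  · simp [coeff_map, h]
  · rw [Finset.sum_congr rfl fun h' _ => hf m h h', mul_comm]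

lemma dvd_coeff (g : Fin k × ι → R) (M o : Fin k → ι → κ → R) (hM : ∀ h i j, M h i j = g (h, i) * o h i j)
    (f : MvPolynomial (Fin k × ι) R) (G : R) (hG : ∀ m, coeff m f ≠ 0 → G ∣ ∏ p, g p ^ m p) (m : Fin k × κ →₀ ℕ) :
    G ∣ coeff m (aeval (lf M) f) := by
  rw [aeval_lf_eq, coeff_sum]
  refine Finset.dvd_sum fun m' hm' => ?_
  have : ∀ p, lf M p = C (g p) * lf o p := by
    intro p; simp only [lf, hM, Finset.mul_sum, map_mul, mul_assoc]
  simp only [this, mul_pow, Finset.prod_mul_distrib]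
  rw [coeff_C_mul]
  refine Dvd.dvd.mul_left ?_ _
  rw [show ∏ p, (C (g p) : MvPolynomial (Fin k × κ) R) ^ m' p = C (∏ p, g p ^ m' p) by simp, coeff_C_mul]
  exact Dvd.dvd.mul_right (hG m' (mem_support_iff.mp hm')) _

end

lemma int_dvd_bound {K : Type*} [Field K] [NumberField K] (a b : ℤ) (hb : b ≠ 0) (h : (a : 𝓞 K) ∣ b) :
    |(a : ℝ)| ≤ |(b : ℝ)| := by
  obtain ⟨o, ho⟩ := h
  have ho0 : o ≠ 0 := by
    rintro rfl; rw [mul_zero] at ho; exact hb (by exact_mod_cast ho)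
  obtain ⟨σ, hσ⟩ := exists_conjugate_one_le_norm ho0
  have h1 := congrArg (fun x : 𝓞 K => ‖σ (x : K)‖) ho
  simp only [map_mul, map_intCast, norm_mul, Complex.norm_intCast] at h1
  rw [h1]
  exact le_mul_of_one_le_right (abs_nonneg _) hσ

/-- deviation bound for balanced exponents -/
lemma bal {k : ℕ} {ι : Type*} [Fintype ι] (D n : Fin k → ℕ) (Q : ℕ) (ε : ℝ) (hD : ∀ h, 0 < D h)
    (h1 : ∀ h, (1 - ε) * Q ≤ n h * D h) (h2 : ∀ h, n h * D h ≤ Q) (v : Fin k → ι → ℕ)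
    (hv : ∀ h i, v h i ≤ D h) (hb : ¬ Unb ε D v) (i : ι) :
    |∑ h, (n h * v h i : ℝ) - Q * k / Fintype.card ι| ≤ 2 * ε * k * Q := by
  simp only [Unb, not_exists, not_lt] at hb
  have h3 := hb i
  have e1 : ∑ h, (n h * v h i : ℝ) - Q * k / Fintype.card ι =
      Q * ∑ h, ((v h i : ℝ) / D h - 1 / Fintype.card ι) + ∑ h, ((n h * D h - Q : ℝ)) * ((v h i : ℝ) / D h) := by
    rw [Finset.sum_sub_distrib, mul_sub, Finset.mul_sum]
    simp only [sub_mul, Finset.sum_sub_distrib, Finset.sum_const, Finset.card_univ, Fintype.card_fin, nsmul_eq_mul]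
    have : ∀ h, (n h : ℝ) * D h * (v h i / D h) = n h * v h i := fun h => by
      have : (D h : ℝ) ≠ 0 := by exact_mod_cast (hD h).ne'
      field_simp
    simp only [this]; ring
  rw [e1]
  refine (abs_add_le _ _).trans ?_
  have h4 : |(Q : ℝ) * ∑ h, ((v h i : ℝ) / D h - 1 / Fintype.card ι)| ≤ Q * (ε * k) := by
    rw [abs_mul, abs_of_nonneg (Nat.cast_nonneg Q)]
    exact mul_le_mul_of_nonneg_left h3 (Nat.cast_nonneg _)
  have h5 : |∑ h, ((n h * D h - Q : ℝ)) * ((v h i : ℝ) / D h)| ≤ k * (ε * Q) := by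
    refine (Finset.abs_sum_le_sum_abs _ _).trans ((Finset.sum_le_card_nsmul _ _ (ε * Q) fun h _ => ?_).trans (by simp))
    have h6 : (v h i : ℝ) / D h ≤ 1 := div_le_one_of_le₀ (by exact_mod_cast hv h i) (by positivity)
    have h7 : ((n h * D h : ℕ) : ℝ) ≤ Q := by exact_mod_cast h2 h
    push_cast at h7
    have h8 : |(n h * D h - Q : ℝ)| ≤ ε * Q := by
      rw [abs_le]; constructor <;> nlinarith [h1 h]
    rw [abs_mul, abs_of_nonneg (by positivity : (0 : ℝ) ≤ (v h i : ℝ) / D h)]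
    exact (mul_le_of_le_one_right (abs_nonneg _) h6).trans h8
  linarith

end Sub

namespace Sub
open MvPolynomial NumberField

section
variable {k : ℕ} {ι κ J R : Type*} [Fintype ι] [Fintype κ] [CommRing R]

lemma comp_id [DecidableEq ι] (E E' : ι → ι → R) (δ : R) (hE : ∀ i l, ∑ j, E' i j * E j l = if i = l then δ else 0)
    (B : Fin k → ι → κ → ℤ) (D : Fin k → ℕ) (F : MvPolynomial (Fin k × ι) ℤ) (hF : MH D F) :
    aeval (lf fun h i q => ∑ l, E i l * (B h l q : R)) (aeval (lf fun _ : Fin k => E') F) =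
      C (δ ^ ∑ h, D h) * map (Int.castRingHom R) (aeval (lf B) F) := by
  have h1 : map (Int.castRingHom R) (aeval (lf B) F) = aeval (lf fun h i q => (B h i q : R)) F := by
    rw [aeval_lf_eq, aeval_lf_eq]
    simp [lf]
  rw [aeval_lf_comp, h1]
  have h2 : (fun (h : Fin k) (i : ι) (q : κ) => ∑ j, E' i j * ∑ l, E j l * (B h l q : R)) =
      fun h i q => ∑ l, (if i = l then δ else 0) * (B h l q : R) := by
    funext h i q
    simp only [Finset.mul_sum, ← mul_assoc]
    rw [Finset.sum_comm]
    simp only [← Finset.sum_mul, hE]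
  rw [h2, ← aeval_lf_comp (fun (_ : Fin k) i l => if i = l then δ else 0), aeval_lf_smul δ D F hF, map_mul,
    aeval_map_algebraMap, aeval_C]
  rfl

variable [Fintype J]

lemma prod_opt {M : Type*} [CommMonoid M] (f : Fin k → Option J → M) (hf : ∀ h j, f h (some j) = 1) :
    ∏ p : Fin k × Option J, f p.1 p.2 = ∏ h, f h none := by
  rw [Fintype.prod_prod_type]
  refine Finset.prod_congr rfl fun h _ => ?_
  rw [Fintype.prod_option, Finset.prod_eq_one fun j _ => hf h j, mul_one]

variable {K : Type*} [Field K] [NumberField K] [DecidableEq ι]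

lemma Eside (E E' : ι → ι → 𝓞 K) (δ : ℕ)
    (hE : ∀ i l, ∑ j, E' i j * E j l = if i = l then (δ : 𝓞 K) else 0)
    (γ : ι → 𝓞 K) (Γ : ℤ) (hΓ0 : Γ ≠ 0) (hδ : 0 < δ) (hΓ : ∏ i, γ i = Γ) (D n : Fin k → ℕ) (F : MvPolynomial (Fin k × ι) ℤ)
    (hF : MH D F) (L : ℕ)
    (hL : ∀ m, coeff m (aeval (lf fun _ : Fin k => E') F) ≠ 0 → ∀ i, L ≤ ∑ h, n h * m (h, i))
    (B : Fin k → ι → Option J → ℤ) (hB : ∀ h i j, γ i ^ n h ∣ ∑ l, E i l * (B h l (some j) : 𝓞 K))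
    (m : Fin k × Option J →₀ ℕ) (hm : coeff m (aeval (lf B) F) ≠ 0) :
    |(Γ : ℝ)| ^ L ≤ δ ^ (∑ h, D h) * |((coeff m (aeval (lf B) F) : ℤ) : ℝ)| * |(Γ : ℝ)| ^ (∑ h, n h * m (h, none)) := by
  classical
  set c := coeff m (aeval (lf B) F)
  let sc : Fin k → Option J → 𝓞 K := fun h q => q.elim (Γ ^ n h) fun _ => 1
  have hd : ∀ h i (q : Option J), γ i ^ n h ∣ (∑ l, E i l * (B h l q : 𝓞 K)) * sc h q := by
    rintro h i (_ | j)
    · refine Dvd.dvd.mul_left ?_ _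
      change γ i ^ n h ∣ (Γ : 𝓞 K) ^ n h
      rw [← hΓ]
      exact pow_dvd_pow_of_dvd (Finset.dvd_prod_of_mem γ (Finset.mem_univ i)) _
    · exact Dvd.dvd.mul_right (hB h i j) _
  choose o ho using hd
  have key := dvd_coeff (fun p : Fin k × ι => γ p.2 ^ n p.1) (fun h i q => (∑ l, E i l * (B h l q : 𝓞 K)) * sc h q) o ho
    (aeval (lf fun _ : Fin k => E') F) ((Γ : 𝓞 K) ^ L) ?_ m
  · rw [aeval_lf_scale, comp_id E E' _ hE B D F hF, coeff_C_mul, coeff_map] at key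
    have hsc : ∏ p : Fin k × Option J, sc p.1 p.2 ^ m p = (Γ : 𝓞 K) ^ (∑ h, n h * m (h, none)) := by
      rw [prod_opt (fun h q => sc h q ^ m (h, q)) (fun h j => by simp [sc]), ← Finset.prod_pow_eq_pow_sum]
      exact Finset.prod_congr rfl fun h _ => by simp [sc, pow_mul]
    rw [hsc] at key
    have h3 := int_dvd_bound (K := K) (Γ ^ L) (δ ^ (∑ h, D h) * c * Γ ^ (∑ h, n h * m (h, none))) (by positivity)
      (by push_cast; exact key)
    push_cast at h3
    simpa only [abs_mul, abs_pow, Nat.abs_cast] using h3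
  · intro m' hm'
    have : ∏ p : Fin k × ι, (γ p.2 ^ n p.1) ^ m' p = ∏ i, γ i ^ (∑ h, n h * m' (h, i)) := by
      rw [Fintype.prod_prod_type, Finset.prod_comm]
      refine Finset.prod_congr rfl fun i _ => ?_
      rw [← Finset.prod_pow_eq_pow_sum]
      exact Finset.prod_congr rfl fun h _ => by rw [pow_mul]
    rw [this, ← hΓ, ← Finset.prod_pow]
    exact Finset.prod_dvd_prod_of_dvd _ _ fun i _ => pow_dvd_pow _ (hL m' hm' i)

lemma Pside (σ : K →+* ℂ) (E E' : ι → ι → 𝓞 K) (δ : ℕ)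
    (hE : ∀ i l, ∑ j, E' i j * E j l = if i = l then (δ : 𝓞 K) else 0)
    (w : ι → ℝ) (D n : Fin k → ℕ) (F : MvPolynomial (Fin k × ι) ℤ)
    (hF : MH D F) (Cm : ℝ) (hCm : ∀ i, ∑ j, ‖σ (E' i j)‖ ≤ Cm) (Cb : ℝ) (hCb : 1 ≤ Cb) (U : ℝ)
    (hU : ∀ m, coeff m (aeval (lf fun _ : Fin k => E') F) ≠ 0 → ∑ i, w i * ∑ h, (n h * m (h, i) : ℝ) ≤ U)
    (B : Fin k → ι → Option J → ℤ)
    (hB : ∀ h i j, ‖σ ((∑ l, E i l * (B h l (some j) : 𝓞 K) : 𝓞 K) : K)‖ ≤ Cb * Real.exp (w i * n h))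
    (hB' : ∀ h i, ‖σ ((∑ l, E i l * (B h l none : 𝓞 K) : 𝓞 K) : K)‖ ≤ Cb)
    (m : Fin k × Option J →₀ ℕ) :
    δ ^ (∑ h, D h) * |((coeff m (aeval (lf B) F) : ℤ) : ℝ)| ≤
      L1 F * (Cm * ((Fintype.card J + 1) * Cb)) ^ (∑ h, D h) * Real.exp U *
        Real.exp ((∑ i, |w i|) * ∑ h, (n h * m (h, none) : ℝ)) := by
  classical
  set W := ∑ i, |w i|
  have hW : ∀ i, -W ≤ w i := fun i => by
    have := Finset.single_le_sum (f := fun i => |w i|) (fun _ _ => abs_nonneg _) (Finset.mem_univ i)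
    have h2 := neg_abs_le (w i)
    linarith
  let φ : 𝓞 K →+* ℂ := σ.comp (algebraMap (𝓞 K) K)
  let sc : Fin k → Option J → ℂ := fun h q => q.elim (Complex.exp (-W * n h)) fun _ => 1
  let M : Fin k → ι → Option J → ℂ := fun h i q => φ (∑ l, E i l * (B h l q : 𝓞 K))
  let G := aeval (lf fun _ : Fin k => E') F
  have hG : MH D G := hF.aeval _
  set C2 := (Fintype.card J + 1) * Cb
  have hC2 : 0 ≤ C2 := by positivity
  have hrow : ∀ p : Fin k × ι, ∑ q, ‖(RingHom.id ℂ) (M p.1 p.2 q * sc p.1 q)‖ ≤ C2 * Real.exp (w p.2 * n p.1) := by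
    rintro ⟨h, i⟩
    simp only [RingHom.id_apply, norm_mul]
    refine (Finset.sum_le_card_nsmul _ _ (Cb * Real.exp (w i * n h)) fun q _ => ?_).trans (by simp [C2, mul_assoc])
    rcases q with _ | j
    · have h1 : ‖sc h none‖ = Real.exp (-W * n h) := by
        simp [sc, Complex.norm_exp]
      rw [h1]
      refine mul_le_mul (hB' h i) (Real.exp_le_exp.mpr ?_) (Real.exp_pos _).le (by linarith)
      exact mul_le_mul_of_nonneg_right (hW i) (by positivity)
    · rw [show sc h (some j) = 1 from rfl, norm_one, mul_one]; exact hB h i j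
  have e1 := L1_aeval_lf_le (S := ℂ) (RingHom.id ℂ) (fun h i q => M h i q * sc h q) _ hrow (map φ G)
  simp only [MvPolynomial.map_id, RingHom.id_apply, Algebra.algebraMap_self] at e1
  have e2 : coeff m (aeval (lf fun h i q => M h i q * sc h q) (map φ G)) =
      (δ : ℂ) ^ (∑ h, D h) * (coeff m (aeval (lf B) F) : ℤ) * ∏ p, sc p.1 p.2 ^ m p := by
    rw [aeval_lf_scale]
    congr 1
    have : aeval (lf M) (map φ G) = map φ (aeval (lf fun h i q => ∑ l, E i l * (B h l q : 𝓞 K)) G) := by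
      clear_value G
      clear hG e1
      induction G using MvPolynomial.induction_on with
      | C a => simp
      | add p q hp hq => simp only [map_add, hp, hq]
      | mul_X p i hp => simp only [map_mul, hp, map_X, aeval_X]; simp [lf, M]
    rw [this, comp_id E E' _ hE B D F hF, map_mul, map_C, coeff_C_mul, coeff_map, coeff_map]
    simp
  have hsc : ‖∏ p : Fin k × Option J, sc p.1 p.2 ^ m p‖ = Real.exp (-(W * ∑ h, (n h * m (h, none) : ℝ))) := by
    rw [prod_opt (fun h q => sc h q ^ m (h, q)) (fun h j => by simp [sc]), norm_prod, Finset.mul_sum, ← Finset.sum_neg_distrib,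
      Real.exp_sum]
    refine Finset.prod_congr rfl fun h _ => ?_
    simp only [sc, Option.elim, norm_pow, Complex.norm_exp]
    rw [← Real.exp_nat_mul]; congr 1; simp; ring
  have e3 := (coeff_le_L1 _ m).trans e1
  rw [e2, norm_mul, hsc, norm_mul, norm_pow, Complex.norm_natCast, Complex.norm_intCast] at e3
  have hCm0 : ∀ _ : ι, 0 ≤ Cm := fun i => (Finset.sum_nonneg fun _ _ => norm_nonneg _).trans (hCm i)
  have e4 : ∀ d ∈ (map φ G).support, ∏ p : Fin k × ι, (C2 * Real.exp (w p.2 * n p.1)) ^ d p ≤ C2 ^ (∑ h, D h) * Real.exp U := by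
    intro d hd
    have hd' : coeff d G ≠ 0 := by
      intro h; rw [mem_support_iff, coeff_map, h, map_zero] at hd; exact hd rfl
    simp only [mul_pow, Finset.prod_mul_distrib]
    rw [Finset.prod_pow_eq_pow_sum, Fintype.sum_prod_type, Finset.sum_congr rfl fun h _ => hG d hd' h]
    refine mul_le_mul_of_nonneg_left ?_ (by positivity)
    rw [Fintype.prod_prod_type, Finset.prod_comm]
    refine le_trans (le_of_eq ?_) (Real.exp_le_exp.mpr (hU d hd'))
    rw [Real.exp_sum]
    refine Finset.prod_congr rfl fun i _ => ?_
    rw [Finset.mul_sum, Real.exp_sum]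
    refine Finset.prod_congr rfl fun h _ => ?_
    rw [← Real.exp_nat_mul]; congr 1; ring
  have e5 : L1 (map φ G) ≤ L1 F * Cm ^ (∑ h, D h) := by
    refine (L1_aeval_lf_le φ (fun _ : Fin k => E') (fun _ => Cm) (fun p => hCm p.2) F).trans ?_
    rw [L1, Finset.sum_mul]
    refine Finset.sum_le_sum fun d hd => ?_
    rw [Finset.prod_pow_eq_pow_sum, Fintype.sum_prod_type,
      Finset.sum_congr rfl fun h _ => hF d (mem_support_iff.mp hd) h]
    refine mul_le_mul_of_nonneg_right (le_of_eq ?_) ?_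
    · simp [Int.norm_eq_abs]
    · rcases isEmpty_or_nonempty ι with hι | ⟨⟨i⟩⟩
      · have : ∑ h, D h = 0 := Finset.sum_eq_zero fun h _ => by
          rw [← hF d (mem_support_iff.mp hd) h]; simp
        rw [this]; simp
      · exact pow_nonneg (hCm0 i) _
  have e6 : ∑ d ∈ (map φ G).support, ‖coeff d (map φ G)‖ * ∏ p : Fin k × ι, (C2 * Real.exp (w p.2 * n p.1)) ^ d p ≤
      L1 (map φ G) * (C2 ^ (∑ h, D h) * Real.exp U) := by
    rw [L1, Finset.sum_mul]
    exact Finset.sum_le_sum fun d hd => mul_le_mul_of_nonneg_left (e4 d hd) (norm_nonneg _)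
  have e7 := e3.trans (e6.trans (mul_le_mul_of_nonneg_right e5 (by positivity)))
  rw [Real.exp_neg, ← div_eq_mul_inv, div_le_iff₀ (Real.exp_pos _)] at e7
  refine e7.trans (le_of_eq ?_)
  rw [mul_pow Cm C2]; ring

end
end Sub

namespace Sub
open MvPolynomial NumberField

lemma vanish_aux (X ε η W g T f S A w x : ℝ) (hX0 : 0 < X) (hW : 0 ≤ W) (hg : 0 ≤ g) (hη : 0 < η) (hX : 1 ≤ ε * X)
    (hε : ε * (3 * W + 4 * g) ≤ η / 4) (hT : T ≤ ε * X) (hx : x = A - 2 * (ε * X)) (hf : x - 1 ≤ f)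
    (hS : S ≤ X * (η / 4)) (hA : A * g - A * w = X * η)
    (h : f * g ≤ S + (A * w + W * (2 * (ε * X))) + W * T + T * g) : False := by
  have e7 : (x - 1) * g ≤ f * g := mul_le_mul_of_nonneg_right hf hg
  have e9 : W * T ≤ W * (ε * X) := mul_le_mul_of_nonneg_left hT hW
  have e10 : T * g ≤ (ε * X) * g := mul_le_mul_of_nonneg_right hT hg
  have e11 : g ≤ ε * X * g := le_mul_of_one_le_left hg hX
  have e13 : X * (ε * (3 * W + 4 * g)) ≤ X * (η / 4) := mul_le_mul_of_nonneg_left hε hX0.le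
  have e14 := mul_pos hX0 hη
  subst hx
  linarith

theorem vanish {K : Type*} [Field K] [NumberField K] {ι J : Type*} [Fintype ι] [DecidableEq ι] [Nonempty ι] [Fintype J]
    (σ : K →+* ℂ) (E E' P P' : ι → ι → 𝓞 K) (δ : ℕ) (hδ : 0 < δ)
    (hE : ∀ i l, ∑ j, E' i j * E j l = if i = l then (δ : 𝓞 K) else 0)
    (hP : ∀ i l, ∑ j, P' i j * P j l = if i = l then (δ : 𝓞 K) else 0)
    (γ : ι → 𝓞 K) (Γ : ℤ) (hΓ0 : Γ ≠ 0) (hΓ : ∏ i, γ i = Γ) (w : ι → ℝ) (hw : ∑ i, w i < Real.log |(Γ : ℝ)|)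
    (C Cb : ℝ) (hC : 1 ≤ C) (hCb : 1 ≤ Cb) :
    ∃ ε0 : ℝ, 0 < ε0 ∧ ∀ ε, 0 < ε → ε ≤ ε0 → ∃ n0 : ℕ, ∀ (k : ℕ) (D n : Fin k → ℕ) (Q : ℕ), 0 < k →
      (∀ h, n0 ≤ n h) → (∀ h, 0 < D h) → (∀ h, (1 - ε) * Q ≤ n h * D h) → (∀ h, n h * D h ≤ Q) → 1 ≤ ε * Q →
      ∀ F : MvPolynomial (Fin k × ι) ℤ, MH D F → L1 F ≤ C ^ (∑ h, D h) →
      (∀ v, Unb ε D v → coeff (ex v) (aeval (lf fun _ : Fin k => E') F) = 0) →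
      (∀ v, Unb ε D v → coeff (ex v) (aeval (lf fun _ : Fin k => P') F) = 0) →
      ∀ (B : Fin k → ι → Option J → ℤ), (∀ h i j, γ i ^ n h ∣ ∑ l, E i l * (B h l (some j) : 𝓞 K)) →
      (∀ h i j, ‖σ ((∑ l, P i l * (B h l (some j) : 𝓞 K) : 𝓞 K) : K)‖ ≤ Cb * Real.exp (w i * n h)) →
      (∀ h i, ‖σ ((∑ l, P i l * (B h l none : 𝓞 K) : 𝓞 K) : K)‖ ≤ Cb) →
      ∀ m : Fin k × Option J →₀ ℕ, ∑ h, (m (h, none) : ℝ) / D h ≤ ε * k → coeff m (aeval (lf B) F) = 0 := by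
  obtain ⟨Cm, hCm1, hCm⟩ : ∃ Cm : ℝ, 1 ≤ Cm ∧ ∀ i, ∑ j, ‖σ (P' i j)‖ ≤ Cm := by
    refine ⟨1 + ∑ i, ∑ j, ‖σ (P' i j)‖, ?_, fun i => ?_⟩
    · have : 0 ≤ ∑ i, ∑ j, ‖σ (P' i j)‖ := by positivity
      linarith
    · have h1 := Finset.single_le_sum (f := fun i => ∑ j, ‖σ (P' i j)‖) (fun _ _ => by positivity) (Finset.mem_univ i)
      linarith
  set g := Real.log |(Γ : ℝ)|
  set W := ∑ i, |w i|
  have hΓ1 : 1 ≤ |(Γ : ℝ)| := by exact_mod_cast Int.one_le_abs hΓ0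
  have hg : 0 ≤ g := Real.log_nonneg hΓ1
  have hW : 0 ≤ W := Finset.sum_nonneg fun _ _ => abs_nonneg _
  set N : ℝ := (Fintype.card ι : ℝ)
  have hN : 0 < N := by simp only [N]; exact_mod_cast Fintype.card_pos
  set η := (g - ∑ i, w i) / N
  have hη : 0 < η := div_pos (by linarith) hN
  set C3 := C * (Cm * ((Fintype.card J + 1) * Cb))
  have hC3 : 1 ≤ C3 := by
    have : 1 ≤ (Fintype.card J + 1) * Cb := by nlinarith [(Nat.cast_nonneg (Fintype.card J) : (0 : ℝ) ≤ _)]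
    exact one_le_mul_of_one_le_of_one_le hC (one_le_mul_of_one_le_of_one_le hCm1 this)
  set G3 := Real.log C3
  have hG3 : 0 ≤ G3 := Real.log_nonneg hC3
  refine ⟨η / (4 * (3 * W + 4 * g + 1)), by positivity, fun ε hε hε0 => ?_⟩
  obtain ⟨n0, hn0⟩ := exists_nat_gt (4 * G3 / η)
  have hε1 : ε * (3 * W + 4 * g) ≤ η / 4 := by
    rw [le_div_iff₀ (by positivity)] at hε0
    nlinarith
  refine ⟨n0 + 1, ?_⟩
  intro k D n Q hk hn hD h1 h2 hQ F hF hFC hvE hvP B hBE hBP hBn m hm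
  by_contra hne
  have hk1 : (1 : ℝ) ≤ k := by exact_mod_cast hk
  have hQ0 : (0 : ℝ) < Q := by
    by_contra hh; nlinarith [(Nat.cast_nonneg Q : (0 : ℝ) ≤ Q)]
  have hbal : ∀ (H : ι → ι → 𝓞 K), (∀ v, Unb ε D v → coeff (ex v) (aeval (lf fun _ : Fin k => H) F) = 0) →
      ∀ m', coeff m' (aeval (lf fun _ : Fin k => H) F) ≠ 0 → ∀ i,
        |∑ h, (n h * m' (h, i) : ℝ) - Q * k / N| ≤ 2 * ε * k * Q := by
    intro H hH m' hm' i
    have hmh := hF.aeval (fun _ : Fin k => H) m' hm'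
    have hu : ¬ Unb ε D (fun h i => m' (h, i)) := by
      intro hu
      refine hm' ?_
      rw [← hH _ hu]; congr 1; ext p; rfl
    exact bal D n Q ε hD h1 h2 (fun h i => m' (h, i)) (fun h i => by
      rw [← hmh h]; exact Finset.single_le_sum (f := fun i => m' (h, i)) (fun _ _ => Nat.zero_le _) (Finset.mem_univ i)) hu i
  set T := ∑ h, n h * m (h, none)
  have hT : (T : ℝ) ≤ ε * k * Q := by
    have : (T : ℝ) ≤ Q * ∑ h, (m (h, none) : ℝ) / D h := by
      simp only [T]; push_cast; rw [Finset.mul_sum]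
      refine Finset.sum_le_sum fun h _ => ?_
      have hDh : (0 : ℝ) < D h := by exact_mod_cast hD h
      have h3 : ((n h * D h : ℕ) : ℝ) ≤ Q := by exact_mod_cast h2 h
      push_cast at h3
      rw [mul_div_assoc', le_div_iff₀ hDh]
      nlinarith [(Nat.cast_nonneg (m (h, none)) : (0 : ℝ) ≤ _)]
    nlinarith
  set x : ℝ := Q * k / N - 2 * ε * k * Q
  have e1 := Eside E E' δ hE γ Γ hΓ0 hδ hΓ D n F hF ⌊x⌋₊ (fun m' hm' i => by
    refine Nat.floor_le_of_le ?_
    have := (abs_le.mp (hbal E' hvE m' hm' i)).1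
    push_cast; linarith) B hBE m hne
  have e2 := Pside σ P P' δ hP w D n F hF Cm hCm Cb hCb (Q * k / N * (∑ i, w i) + W * (2 * ε * k * Q)) (fun m' hm' => by
    have : ∑ i, w i * ∑ h, (n h * m' (h, i) : ℝ) - Q * k / N * (∑ i, w i) ≤ W * (2 * ε * k * Q) := by
      rw [Finset.mul_sum, ← Finset.sum_sub_distrib, Finset.sum_mul]
      refine Finset.sum_le_sum fun i _ => ?_
      rw [show w i * ∑ h, (n h * m' (h, i) : ℝ) - Q * k / N * w i = w i * (∑ h, (n h * m' (h, i) : ℝ) - Q * k / N) by ring]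
      refine (le_abs_self _).trans ?_
      rw [abs_mul]
      exact mul_le_mul_of_nonneg_left (hbal P' hvP m' hm' i) (abs_nonneg _)
    linarith) B hBP hBn m
  have e3 := e1.trans (mul_le_mul_of_nonneg_right e2 (by positivity))
  have e4 : |(Γ : ℝ)| ^ ⌊x⌋₊ ≤ C3 ^ (∑ h, D h) * Real.exp (Q * k / N * (∑ i, w i) + W * (2 * ε * k * Q)) *
      Real.exp (W * T) * |(Γ : ℝ)| ^ T := by
    refine e3.trans ?_
    have : (W * ∑ h, (n h * m (h, none) : ℝ)) = W * T := by simp [T]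
    rw [this, mul_pow C]
    gcongr
  have hΓp : 0 < |(Γ : ℝ)| := by linarith
  have e5 := Real.log_le_log (by positivity) e4
  rw [Real.log_mul (by positivity) (by positivity), Real.log_mul (by positivity) (by positivity),
    Real.log_mul (by positivity) (by positivity), Real.log_exp, Real.log_exp, Real.log_pow, Real.log_pow, Real.log_pow] at e5
  have e6 : x - 1 ≤ ⌊x⌋₊ := (Nat.sub_one_lt_floor x).le
  have hSD : ((∑ h, D h : ℕ) : ℝ) * (n0 + 1) ≤ k * Q := by
    push_cast; rw [Finset.sum_mul]
    refine (Finset.sum_le_card_nsmul _ _ (Q : ℝ) fun h _ => ?_).trans (by simp)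
    have : D h * (n0 + 1) ≤ Q := le_trans (by rw [mul_comm]; exact Nat.mul_le_mul_right _ (hn h)) (h2 h)
    exact_mod_cast this
  have hSD2 : ((∑ h, D h : ℕ) : ℝ) * G3 ≤ k * Q * (η / 4) := by
    rw [div_lt_iff₀ hη] at hn0
    have : G3 ≤ (n0 + 1) * (η / 4) := by nlinarith
    calc _ ≤ ((∑ h, D h : ℕ) : ℝ) * ((n0 + 1) * (η / 4)) := mul_le_mul_of_nonneg_left this (by positivity)
      _ = ((∑ h, D h : ℕ) : ℝ) * (n0 + 1) * (η / 4) := by ring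
      _ ≤ _ := mul_le_mul_of_nonneg_right hSD (by positivity)
  have hX : 1 ≤ ε * (k * Q) := by
    have : ε * Q ≤ ε * (k * Q) := mul_le_mul_of_nonneg_left (le_mul_of_one_le_left hQ0.le hk1) hε.le
    linarith
  have e8 : Q * k / N * g - Q * k / N * (∑ i, w i) = k * Q * η := by simp only [η]; field_simp
  exact vanish_aux (k * Q) ε η W g T _ _ (Q * k / N) (∑ i, w i) x (by positivity) hW hg hη hX hε1 (by linarith) (by simp only [x]; ring)
    e6 hSD2 e8 (e5.trans (le_of_eq (by simp only [g, G3]; ring)))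

end Sub

namespace Sub
open MvPolynomial NumberField

lemma Ix_pow_X {k : ℕ} {S : Type*} [CommRing S] (D : Fin k → ℕ) (h : Fin k) (n : ℕ) :
    Ix D ((n : ℝ) / D h) (X h ^ n : MvPolynomial (Fin k) S) := by
  classical
  intro m hm
  rw [coeff_X_pow] at hm
  have : Finsupp.single h n = m := by by_contra hh; simp [hh] at hm
  rw [← this, Finset.sum_eq_single h]
  · simp
  · intro b _ hb; simp [Finsupp.single_eq_of_ne hb]
  · simp

/-- reduction to a polynomial in one variable per block -/
lemma reduce {k : ℕ} {ι J : Type*} [Fintype ι] [DecidableEq ι] [Fintype J] (D : Fin k → ℕ)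
    (F : MvPolynomial (Fin k × ι) ℤ) (hF0 : F ≠ 0) (hF : MH D F) (a b : ι) (hab : a ≠ b) :
    ∃ f : MvPolynomial (Fin k) ℤ, f ≠ 0 ∧ L1 f ≤ L1 F ∧ (∀ h, degreeOf h f ≤ D h) ∧
      ∀ (q : Fin k → ι → ℚ) (θ : ℝ) (G : MvPolynomial (Fin k × Option J) ℚ) (L : Fin k → Option J → ι → ℚ),
        (∀ h, q h a ≠ 0) → aeval (lf L) G = map (Int.castRingHom ℚ) F → (∀ h i, L h none i = q h i / q h a) →
        (∀ m, coeff m G ≠ 0 → θ ≤ ∑ h, (m (h, none) : ℝ) / D h) →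
        Ix D θ (tr (fun h => -(q h b / q h a)) (map (Int.castRingHom ℚ) f)) := by
  classical
  let N := 1 + ∑ h, D h
  let e := Fintype.equivFin (Fin k × ι)
  let u : Fin k × ι → ℕ := fun p => if p.2 = a ∨ p.2 = b then 0 else N ^ (e p : ℕ)
  let wt : (Fin k × ι →₀ ℕ) → ℕ := fun m => ∑ p, m p * u p
  let xm : (Fin k × ι →₀ ℕ) → (Fin k →₀ ℕ) := fun m => Finsupp.equivFunOnFinite.symm fun h => m (h, a)
  have hle : ∀ m, coeff m F ≠ 0 → ∀ h i, m (h, i) ≤ D h := fun m hm h i => by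
    rw [← hF m hm h]; exact Finset.single_le_sum (f := fun i => m (h, i)) (fun _ _ => Nat.zero_le _) (Finset.mem_univ i)
  have hlt : ∀ m, coeff m F ≠ 0 → ∀ p, (if p.2 = a ∨ p.2 = b then 0 else m p) < N := fun m hm p => by
    have h1 := hle m hm p.1 p.2
    have h2 := Finset.single_le_sum (f := D) (fun _ _ => Nat.zero_le _) (Finset.mem_univ p.1)
    simp only [N]; split_ifs <;> grind
  have inj : ∀ m m', coeff m F ≠ 0 → coeff m' F ≠ 0 → wt m = wt m' → xm m = xm m' → m = m' := by
    intro m m' hm hm' hw hx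
    have key : ∀ m (hm : coeff m F ≠ 0), wt m = (finFunctionFinEquiv fun r => (⟨_, hlt m hm (e.symm r)⟩ : Fin N) : ℕ) := by
      intro m hm
      rw [finFunctionFinEquiv_apply]
      simp only [wt, u]
      rw [← e.sum_comp]
      refine Finset.sum_congr rfl fun p _ => ?_
      rw [e.symm_apply_apply]
      split_ifs <;> simp
    rw [key m hm, key m' hm'] at hw
    have h1 := finFunctionFinEquiv.injective (Fin.ext hw)
    have h2 : ∀ h i, i ≠ a → i ≠ b → m (h, i) = m' (h, i) := by
      intro h i hia hib
      have := congrArg Fin.val (congrFun h1 (e (h, i)))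
      simpa [hia, hib] using this
    have h3 : ∀ h, m (h, a) = m' (h, a) := fun h => by
      have := DFunLike.congr_fun hx h
      simpa [xm] using this
    have h4 : ∀ h i, i ≠ b → m (h, i) = m' (h, i) := fun h i hib => by
      by_cases hia : i = a
      · rw [hia]; exact h3 h
      · exact h2 h i hia hib
    ext ⟨h, i⟩
    by_cases hib : i = b
    · subst hib
      have e1 := hF m hm h
      rw [← hF m' hm' h, ← Finset.add_sum_erase _ _ (Finset.mem_univ i), ← Finset.add_sum_erase _ (fun i => m' (h, i)) (Finset.mem_univ i),
        Finset.sum_congr rfl fun j hj => h4 h j (Finset.ne_of_mem_erase hj)] at e1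
      omega
    · exact h4 h i hib
  obtain ⟨m0, hm0, hmin⟩ := Finset.exists_min_image F.support wt (by
    rw [Finset.nonempty_iff_ne_empty]; simpa using hF0)
  set M := wt m0
  let f : MvPolynomial (Fin k) ℤ := ∑ m ∈ F.support.filter (fun m => wt m = M), monomial (xm m) (coeff m F)
  refine ⟨f, ?_, ?_, ?_, ?_⟩
  · intro hf
    have h1 := congrArg (coeff (xm m0)) hf
    simp only [f, coeff_sum, coeff_monomial, coeff_zero] at h1
    rw [Finset.sum_eq_single m0] at h1
    · simp at h1; exact (mem_support_iff.mp hm0) h1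
    · intro m hm hne
      rw [if_neg]
      intro hx
      rw [Finset.mem_filter] at hm
      exact hne (inj m m0 (mem_support_iff.mp hm.1) (mem_support_iff.mp hm0) hm.2 hx)
    · intro hh; exact (hh (Finset.mem_filter.mpr ⟨hm0, rfl⟩)).elim
  · refine (L1_sum_le _ _).trans ?_
    rw [L1]
    simp only [L1_monomial]
    exact Finset.sum_le_sum_of_subset_of_nonneg (Finset.filter_subset _ _) fun _ _ _ => norm_nonneg _
  · intro h
    rw [degreeOf_le_iff]
    intro d hd
    rw [mem_support_iff] at hd
    obtain ⟨m, hm, hmd⟩ : ∃ m ∈ F.support, xm m = d := by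
      by_contra hh
      push Not at hh
      refine hd ?_
      simp only [f, coeff_sum, coeff_monomial]
      exact Finset.sum_eq_zero fun m hm => by rw [if_neg (hh m (Finset.mem_filter.mp hm).1)]
    rw [← hmd]
    exact hle m (mem_support_iff.mp hm) h a
  intro q θ G L hqa hLG hL hG
  let ψ : Fin k × ι → MvPolynomial (Fin k) (Polynomial ℚ) := fun p => C (Polynomial.X ^ u p) * (if p.2 = a then X p.1 else 1)
  let f' : MvPolynomial (Fin k) (Polynomial ℚ) :=
    ∑ m ∈ F.support, C (Polynomial.X ^ (wt m - M)) * monomial (xm m) ((coeff m F : ℤ) : Polynomial ℚ)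
  let c : Fin k → Polynomial ℚ := fun h =>
    -∑ i ∈ Finset.univ.erase a, Polynomial.C (q h i / q h a) * Polynomial.X ^ u (h, i)
  have h1 : aeval ψ F = C (Polynomial.X ^ M) * f' := by
    rw [aeval_def, eval₂_eq', Finset.mul_sum]
    refine Finset.sum_congr rfl fun m hm => ?_
    simp only [ψ, mul_pow, Finset.prod_mul_distrib]
    have e1 : ∏ p : Fin k × ι, (C (Polynomial.X ^ u p) : MvPolynomial (Fin k) (Polynomial ℚ)) ^ m p = C (Polynomial.X ^ wt m) := by
      simp only [← map_pow, ← pow_mul, ← map_prod, Finset.prod_pow_eq_pow_sum, wt, mul_comm]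
    have e2 : ∏ p : Fin k × ι, ((if p.2 = a then X p.1 else 1 : MvPolynomial (Fin k) (Polynomial ℚ))) ^ m p = monomial (xm m) 1 := by
      rw [Fintype.prod_prod_type, monomial_eq, Finsupp.prod_fintype _ _ (by simp), C_1, one_mul]
      refine Finset.prod_congr rfl fun h _ => ?_
      rw [Finset.prod_eq_single a]
      · simp [xm]
      · intro b _ hb; simp [hb]
      · simp
    rw [e1, e2, ← mul_assoc (C (Polynomial.X ^ M)), ← C_mul, ← pow_add, Nat.add_sub_cancel' (hmin m hm)]
    rw [show (algebraMap ℤ (MvPolynomial (Fin k) (Polynomial ℚ))) (coeff m F) = C ((coeff m F : ℤ) : Polynomial ℚ) by simp]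
    rw [mul_left_comm, C_mul_monomial, mul_one]
  have h2 : map (Polynomial.evalRingHom 0) f' = map (Int.castRingHom ℚ) f := by
    simp only [f', f, map_sum, map_mul, map_C, map_monomial]
    rw [Finset.sum_filter]
    refine Finset.sum_congr rfl fun m hm => ?_
    split_ifs with hh
    · simp [hh]
    · have : wt m - M ≠ 0 := by have := hmin m hm; omega
      simp [this]
  have h3 : Ix D θ (tr c (aeval ψ F)) := by
    have e1 : tr c (aeval ψ F) = aeval (fun p => tr c (ψ p)) (aeval (lf L) G) := by
      rw [hLG]
      clear h1 h2
      clear hLG hF0 hF hle hlt inj hm0 hmin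
      clear f f'
      induction F using MvPolynomial.induction_on with
      | C a => simp
      | add p q hp hq => simp only [map_add, hp, hq]
      | mul_X p i hp => simp only [map_mul, hp, map_X, aeval_X]
    have e2 : ∀ (g : MvPolynomial (Fin k × ι) ℚ →ₐ[ℚ] MvPolynomial (Fin k) (Polynomial ℚ)),
      g (aeval (lf L) G) = ∑ m ∈ G.support, algebraMap ℚ _ (coeff m G) * ∏ p, g (lf L p) ^ m p := by
      intro g
      rw [← AlgHom.comp_apply, comp_aeval, aeval_def, eval₂_eq']
    rw [e1, e2]
    refine Ix_sum _ _ fun m hm => ?_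
    have e3 : ∀ h, aeval (fun p => tr c (ψ p)) (lf L (h, none)) = X h := by
      intro h
      simp only [lf, map_sum, map_mul, aeval_X, hL, ψ]
      rw [← Finset.add_sum_erase _ _ (Finset.mem_univ a)]
      have : ∀ i ∈ Finset.univ.erase a, (aeval fun p => (tr c) (C (Polynomial.X ^ u p)) * (tr c) (if p.2 = a then X p.1 else 1)) (C (q h i / q h a)) *
          ((tr c) (C (Polynomial.X ^ u (h, i))) * (tr c) (if i = a then X h else 1)) = C (Polynomial.C (q h i / q h a) * Polynomial.X ^ u (h, i)) := by
        intro i hi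
        rw [if_neg (Finset.ne_of_mem_erase hi), aeval_C, map_one, mul_one, tr, aeval_C, map_mul]
        rfl
      rw [Finset.sum_congr rfl this, div_self (hqa h), ← map_sum]
      simp [u, tr, c]
      ring
    have e4 : θ ≤ 0 + ((∑ h, (m (h, none) : ℝ) / D h) + 0) := by
      have := hG m (mem_support_iff.mp hm); linarith
    refine Ix.mono ?_ e4
    refine (Ix_nonpos _ le_rfl).mul ?_
    rw [Fintype.prod_prod_type]
    simp only [Fintype.prod_option, Finset.prod_mul_distrib, e3]
    refine Ix.mul (Ix_prod _ _ _ fun h _ => Ix_pow_X D h _) (Ix_nonpos _ le_rfl)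
  have h4 : Ix D θ (tr c f') := by
    intro m hm
    refine h3 m ?_
    rw [h1, map_mul, tr, aeval_C]
    change coeff m (C _ * _) ≠ 0
    rw [coeff_C_mul]
    exact mul_ne_zero (pow_ne_zero _ Polynomial.X_ne_zero) hm
  have h5 : map (Polynomial.evalRingHom 0) (tr c f') = tr (fun h => (c h).eval 0) (map (Polynomial.evalRingHom 0) f') := by
    clear h1 h2 h4
    clear_value f'
    induction f' using MvPolynomial.induction_on with
    | C a => simp [tr]
    | add p q hp hq => simp only [map_add, hp, hq]
    | mul_X p i hp => simp only [map_mul, hp, map_X]; simp [tr]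
  have h6 : (fun h => (c h).eval 0) = fun h => -(q h b / q h a) := by
    funext h
    simp only [c, Polynomial.eval_neg, Polynomial.eval_finsetSum]
    rw [Finset.sum_eq_single b]
    · simp [u]
    · intro i hi hib
      have : 0 ^ u (h, i) = (0 : ℚ) := zero_pow (by simp [u, Finset.ne_of_mem_erase hi, hib, N])
      simp [this]
    · intro hh; exact absurd (Finset.mem_erase.mpr ⟨hab.symm, Finset.mem_univ b⟩) hh
  rw [← h6, ← h2, ← h5]
  intro m hm
  refine h4 m fun h0 => hm ?_
  rw [coeff_map, h0, map_zero]

end Sub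

namespace Sub
open MvPolynomial NumberField

lemma sparse (S : Set ℕ) (hS : S.Infinite) (n1 : ℕ) (A : ℝ) (hA : 1 ≤ A) (k : ℕ) :
    ∃ n : Fin k → ℕ, (∀ h, n h ∈ S) ∧ (∀ h, n1 ≤ n h) ∧ ∀ i j, i < j → A * n j ≤ n i := by
  have h1 : ∀ x : ℝ, ∃ s ∈ S, x ≤ (s : ℝ) := fun x => by
    obtain ⟨m, hm⟩ := exists_nat_ge x
    obtain ⟨s, hs, hms⟩ := hS.exists_gt m
    exact ⟨s, hs, hm.trans (by exact_mod_cast hms.le)⟩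
  choose g hgS hg using h1
  let u : ℕ → ℕ := fun j => Nat.rec (motive := fun _ => ℕ) (g n1) (fun _ v => g (A * (v : ℝ))) j
  have hu : ∀ j : ℕ, A * (u j : ℝ) ≤ (u (j+1) : ℝ) := fun j => hg (A * (u j : ℝ))
  have hu' : Monotone u := monotone_nat_of_le_succ fun j => by
    have : (u j : ℝ) ≤ u (j+1) := le_trans (le_mul_of_one_le_left (by positivity) hA) (hu j)
    exact_mod_cast this
  refine ⟨fun h => u (h.rev : ℕ), fun h => ?_, fun h => ?_, fun i j hij => ?_⟩
  · change u (h.rev : ℕ) ∈ S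
    generalize (h.rev : ℕ) = j
    cases j <;> exact hgS _
  · refine le_trans ?_ (hu' (Nat.zero_le _))
    have : (n1 : ℝ) ≤ u 0 := hg n1
    exact_mod_cast this
  · refine (hu _).trans ?_
    have : (j.rev : ℕ) + 1 ≤ (i.rev : ℕ) := by
      have := Fin.rev_lt_rev.mpr hij
      exact this
    exact_mod_cast hu' this

theorem Tthm {K : Type*} [Field K] [NumberField K] {ι J : Type*} [Fintype ι] [DecidableEq ι] [Nonempty ι] [Fintype J]
    (σ : K →+* ℂ) (E E' P P' : ι → ι → 𝓞 K) (δ : ℕ) (hδ : 0 < δ)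
    (hE : ∀ i l, ∑ j, E' i j * E j l = if i = l then (δ : 𝓞 K) else 0)
    (hP : ∀ i l, ∑ j, P' i j * P j l = if i = l then (δ : 𝓞 K) else 0)
    (γ : ι → 𝓞 K) (Γ : ℤ) (hΓ0 : Γ ≠ 0) (hΓ : ∏ i, γ i = Γ) (w : ι → ℝ) (hw : ∑ i, w i < Real.log |(Γ : ℝ)|)
    (Cb : ℝ) (c1 : ℝ) (hc1 : 0 < c1) :
    {n : ℕ | ∃ (Y : J → ι → ℤ) (q : ι → ℤ) (a b : ι) (s t : ℤ), q a ≠ 0 ∧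
      (∃ L : J → ι → ℚ, ∀ i l, (q i / q a : ℚ) * (if l = a then 1 else 0) + ∑ j, L j i * Y j l = if i = l then 1 else 0) ∧
      (∀ i j, γ i ^ n ∣ ∑ l, E i l * (Y j l : 𝓞 K)) ∧
      (∀ i j, ‖σ ((∑ l, P i l * (Y j l : 𝓞 K) : 𝓞 K) : K)‖ ≤ Cb * Real.exp (w i * n)) ∧
      IsCoprime s t ∧ t ≠ 0 ∧ q b * t = q a * s ∧ Real.exp (c1 * n) ≤ ((max |s| |t| : ℤ) : ℝ)}.Finite := by
  by_contra hinf
  obtain ⟨a, b, hS⟩ : ∃ a b : ι, {n : ℕ | ∃ (Y : J → ι → ℤ) (q : ι → ℤ) (s t : ℤ), q a ≠ 0 ∧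
      (∃ L : J → ι → ℚ, ∀ i l, (q i / q a : ℚ) * (if l = a then 1 else 0) + ∑ j, L j i * Y j l = if i = l then 1 else 0) ∧
      (∀ i j, γ i ^ n ∣ ∑ l, E i l * (Y j l : 𝓞 K)) ∧
      (∀ i j, ‖σ ((∑ l, P i l * (Y j l : 𝓞 K) : 𝓞 K) : K)‖ ≤ Cb * Real.exp (w i * n)) ∧
      IsCoprime s t ∧ t ≠ 0 ∧ q b * t = q a * s ∧ Real.exp (c1 * n) ≤ ((max |s| |t| : ℤ) : ℝ)}.Infinite := by
    by_contra hh
    simp only [not_exists, Set.not_infinite] at hh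
    refine hinf ((Set.finite_iUnion fun a => Set.finite_iUnion fun b => hh a b).subset ?_)
    rintro n ⟨Y, q, a, b, s, t, h⟩
    exact Set.mem_iUnion.mpr ⟨a, Set.mem_iUnion.mpr ⟨b, Y, q, s, t, h⟩⟩
  obtain ⟨C, hC, hsieg⟩ := siegel K (ι := ι) ![E', P']
  obtain ⟨Cb', hCb1, hCb2, hCb3⟩ : ∃ Cb' : ℝ, 1 ≤ Cb' ∧ Cb ≤ Cb' ∧ ∀ i, ‖σ (P i a)‖ ≤ Cb' := by
    refine ⟨1 + |Cb| + ∑ i, ‖σ (P i a)‖, ?_, ?_, fun i => ?_⟩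
    · have : 0 ≤ ∑ i, ‖σ (P i a)‖ := by positivity
      linarith [abs_nonneg Cb]
    · have : 0 ≤ ∑ i, ‖σ (P i a)‖ := by positivity
      linarith [le_abs_self Cb]
    · have := Finset.single_le_sum (f := fun i => ‖σ (P i a)‖) (fun _ _ => norm_nonneg _) (Finset.mem_univ i)
      linarith [abs_nonneg Cb]
  obtain ⟨ε0, hε0, hvan⟩ := vanish (J := J) σ E E' P P' δ hδ hE hP γ Γ hΓ0 hΓ w hw C Cb' hC hCb1
  set ε := min ε0 (1/2)
  have hε : 0 < ε := lt_min hε0 (by norm_num)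
  have hε2 : ε ≤ 1/2 := min_le_right _ _
  obtain ⟨n0, hvan⟩ := hvan ε hε (min_le_left _ _)
  obtain ⟨k, hk0, hsieg⟩ := hsieg ε hε (by linarith)
  have hsieg := hsieg k le_rfl
  have hkR : (0 : ℝ) < k := by exact_mod_cast hk0
  obtain ⟨ω, hω, hroth⟩ := roth k (ε * k) (by positivity)
  have hlC : 0 ≤ Real.log C := Real.log_nonneg hC
  obtain ⟨n1, hn1⟩ := exists_nat_gt (2 * k * (Real.log C + 1) / (ω * c1))
  rw [div_lt_iff₀ (by positivity)] at hn1
  obtain ⟨n, hnS, hnn, hgap⟩ := sparse _ hS (n0 + n1 + 1) (2 / ω + 1) (le_add_of_nonneg_left (by positivity)) k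
  choose Y q s t hqa hL hdiv hsize hcop ht0 hst hheight using hnS
  choose L hL using hL
  have hn1' : ∀ h, 1 ≤ n h := fun h => by have := hnn h; omega
  have hnR : ∀ h, (0 : ℝ) < n h := fun h => by exact_mod_cast hn1' h
  have hab : a ≠ b := by
    rintro rfl
    let h : Fin k := ⟨0, hk0⟩
    have e1 : t h = s h := mul_left_cancel₀ (hqa h) (hst h)
    have e2 := hcop h
    rw [e1, isCoprime_self, Int.isUnit_iff_abs_eq] at e2
    have e3 := hheight h
    rw [e1, max_self, e2, Int.cast_one] at e3
    have : 1 < Real.exp (c1 * n h) := Real.one_lt_exp_iff.mpr (mul_pos hc1 (hnR h))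
    linarith
  obtain ⟨Q, hQ⟩ := exists_nat_ge ((∑ h, (n h : ℝ)) / ε + 1 / ε)
  have hsum0 : 0 ≤ ∑ h, (n h : ℝ) := by positivity
  rw [← add_div, div_le_iff₀ hε] at hQ
  have hnQ : ∀ h, (n h : ℝ) ≤ ε * Q := fun h => by
    have := Finset.single_le_sum (f := fun h => (n h : ℝ)) (fun _ _ => by positivity) (Finset.mem_univ h)
    linarith
  have hQ0 : (0 : ℝ) < Q := by
    have : 0 < (Q : ℝ) * ε := by linarith
    exact pos_of_mul_pos_left this hε.le
  let D : Fin k → ℕ := fun h => Q / n h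
  have hD1 : ∀ h, (1 - ε) * Q ≤ n h * D h := fun h => by
    have e1 := Nat.lt_div_mul_add (hn1' h) (a := Q)
    have e2 : (Q : ℝ) < D h * n h + n h := by exact_mod_cast e1
    nlinarith [hnQ h]
  have hD2 : ∀ h, n h * D h ≤ Q := fun h => Nat.mul_div_le _ _
  have hD2' : ∀ h, (n h * D h : ℝ) ≤ Q := fun h => by exact_mod_cast hD2 h
  have hD0 : ∀ h, 0 < D h := fun h => by
    have e1 : (0 : ℝ) < n h * D h := lt_of_lt_of_le (mul_pos (by linarith) hQ0) (hD1 h)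
    have : (0 : ℝ) < D h := pos_of_mul_pos_right e1 (hnR h).le
    exact_mod_cast this
  obtain ⟨F, hF0, hF, hFC, hFv⟩ := hsieg D hD0
  let B : Fin k → ι → Option J → ℤ := fun h l κ => κ.elim (if l = a then 1 else 0) fun j => Y h j l
  have hcoef := hvan k D n Q hk0 (fun h => by have := hnn h; omega) hD0 hD1 hD2 (by linarith) F hF hFC
    (hFv 0) (hFv 1) B (fun h i j => hdiv h i j)
    (fun h i j => (hsize h i j).trans (mul_le_mul_of_nonneg_right hCb2 (Real.exp_pos _).le)) (fun h i => by
      simpa [B] using hCb3 i)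
  obtain ⟨f, hf0, hfL, hfd, hfI⟩ := reduce (J := J) D F hF0 hF a b hab
  have hI := hfI (fun h i => (q h i : ℚ)) (ε * k) (map (Int.castRingHom ℚ) (aeval (lf B) F))
    (fun h κ i => κ.elim (q h i / q h a : ℚ) fun j => L h j i) (fun h => by exact_mod_cast hqa h) ?_ (fun h i => rfl) ?_
  · have hx : (fun h => -((q h b : ℚ) / q h a)) = fun h => ((-s h : ℤ) : ℚ) / t h := by
      funext h
      have e1 : (q h a : ℚ) ≠ 0 := by exact_mod_cast hqa h
      have e2 : (t h : ℚ) ≠ 0 := by exact_mod_cast ht0 h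
      have e3 : (q h b * t h : ℚ) = q h a * s h := by exact_mod_cast hst h
      push_cast; field_simp; linarith
    rw [hx] at hI
    have hSD : ((∑ h, D h : ℕ) : ℝ) * n1 ≤ k * Q := by
      push_cast; rw [Finset.sum_mul]
      refine (Finset.sum_le_card_nsmul _ _ (Q : ℝ) fun h _ => ?_).trans (by simp)
      have : D h * n1 ≤ Q := le_trans (by rw [mul_comm]; exact Nat.mul_le_mul_right _ (by have := hnn h; omega)) (hD2 h)
      exact_mod_cast this
    have hn1p : (0 : ℝ) < n1 := by
      have : 0 < (n1 : ℝ) * (ω * c1) := lt_of_le_of_lt (by positivity) hn1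
      exact pos_of_mul_pos_left this (by positivity)
    have hSD2 : ((∑ h, D h : ℕ) : ℝ) * (Real.log C + 1) ≤ ω * (c1 * Q / 2) := by
      have e1 : ((∑ h, D h : ℕ) : ℝ) ≤ k * Q / n1 := by rwa [le_div_iff₀ hn1p]
      calc _ ≤ k * Q / n1 * (Real.log C + 1) := mul_le_mul_of_nonneg_right e1 (by positivity)
        _ = Q * (2 * k * (Real.log C + 1)) / (2 * n1) := by field_simp
        _ ≤ Q * (n1 * (ω * c1)) / (2 * n1) := by gcongr
        _ = _ := by field_simp
    have hS0 : (0 : ℝ) ≤ ((∑ h, D h : ℕ) : ℝ) := Nat.cast_nonneg _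
    refine hroth D (fun h => -s h) t (c1 * Q / 2) f hD0 (fun h => (hcop h).neg_left) ht0 (by positivity) (fun h => ?_)
      (fun i j hij => ?_) ?_ ?_ hf0 hfd hI
    · rw [abs_neg]
      have e1 : c1 * n h ≤ Real.log ((max |s h| |t h| : ℤ) : ℝ) := by
        rw [← Real.log_exp (c1 * n h)]
        exact Real.log_le_log (Real.exp_pos _) (hheight h)
      have e2 : c1 * ((1 - ε) * Q) ≤ c1 * (n h * D h) := mul_le_mul_of_nonneg_left (hD1 h) hc1.le
      have e3 : (D h : ℝ) * (c1 * n h) ≤ D h * Real.log ((max |s h| |t h| : ℤ) : ℝ) := mul_le_mul_of_nonneg_left e1 (by positivity)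
      have e4 : c1 * (Q / 2) ≤ c1 * ((1 - ε) * Q) := mul_le_mul_of_nonneg_left (by nlinarith) hc1.le
      linarith
    · have e1 := hgap i j hij
      have e2 : 2 * (n j : ℝ) ≤ ω * n i := by
        have : 2 / ω * n j ≤ (n i : ℝ) := by linarith [hnR j]
        rw [div_mul_eq_mul_div, div_le_iff₀ hω] at this
        linarith
      have e3 : (Q : ℝ) / 2 ≤ n j * D j := le_trans (by nlinarith) (hD1 j)
      have e4 := hD2' i
      have e5 : (n i : ℝ) * D i ≤ 2 * n j * D j := by linarith
      have e6 : 2 * n j * (D j : ℝ) ≤ ω * n i * D j := mul_le_mul_of_nonneg_right e2 (by positivity)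
      refine le_of_mul_le_mul_left (a := (n i : ℝ)) ?_ (hnR i)
      linarith
    · have hL0 : 0 < L1 f := lt_of_lt_of_le one_pos (one_le_L1_int _ hf0)
      have := Real.log_le_log hL0 (hfL.trans hFC)
      rw [Real.log_pow] at this
      nlinarith
    · nlinarith [mul_nonneg hS0 hlC]
  · have e1 : map (Int.castRingHom ℚ) (aeval (lf B) F) = aeval (lf fun h i κ => (B h i κ : ℚ)) F := by
      rw [aeval_lf_eq, aeval_lf_eq]; simp [lf]
    rw [e1, aeval_lf_comp]
    have e2 : ∀ h i l, ∑ κ, ((B h i κ : ℤ) : ℚ) * (κ.elim (q h l / q h a : ℚ) fun j => L h j l) = if i = l then 1 else 0 := by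
      intro h i l
      have := hL h l i
      rw [Fintype.sum_option]
      simp only [B, Option.elim]
      rw [show (if i = l then (1 : ℚ) else 0) = if l = i then 1 else 0 by simp [eq_comm], ← this]
      push_cast
      congr 1
      · ring
      · exact Finset.sum_congr rfl fun _ _ => mul_comm _ _
    simp only [e2]
    rw [aeval_lf_smul 1 D F hF]
    simp
  · intro m hm
    by_contra hh
    refine hm ?_
    rw [coeff_map, hcoef m (not_le.mp hh).le, map_zero]

end Sub

namespace Sub
open MvPolynomial NumberField

lemma htlow {K : Type*} [Field K] [NumberField K] (β : K) (hβ : β ≠ 0)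
    (hru : ∀ k : ℕ, 0 < k → β ^ k ≠ 1) : ∃ c : ℝ, 0 < c ∧ ∀ (n : ℕ) (s t : 𝓞 K) (B : ℝ), t ≠ 0 →
      β ^ n * t = s → (∀ τ : K →+* ℂ, ‖τ s‖ ≤ B) → (∀ τ : K →+* ℂ, ‖τ t‖ ≤ B) →
      Real.exp (c * n) ≤ B := by
  have hh : 1 < Height.mulHeight₁ β := by
    by_contra hle
    have hfin := NumberField.finite_setOfPred_mulHeight₁_le K 1
    have hm : ∀ n : ℕ, β ^ n ∈ {x : K | Height.mulHeight₁ x ≤ 1} := fun n => by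
      simp only [Set.mem_ofPred_eq, Height.mulHeight₁_pow]
      exact pow_le_one₀ (Height.mulHeight₁_pos β).le (not_lt.1 hle)
    have : ¬ Function.Injective (fun n : ℕ => β ^ n) := fun hi =>
      Set.infinite_of_injective_forall_mem hi hm hfin
    obtain ⟨a, b, hab, hne⟩ : ∃ a b : ℕ, β ^ a = β ^ b ∧ a < b := by
      rw [Function.Injective] at this
      push Not at this
      obtain ⟨a, b, h1, h2⟩ := this
      rcases lt_or_gt_of_ne h2 with h | h
      exacts [⟨a, b, h1, h⟩, ⟨b, a, h1.symm, h⟩]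
    refine hru (b - a) (by omega) ?_
    have : β ^ a * β ^ (b - a) = β ^ a * 1 := by rw [← pow_add, mul_one, hab]; congr 1; omega
    exact mul_left_cancel₀ (pow_ne_zero _ hβ) this
  have hd := Module.finrank_pos (R := ℚ) (M := K)
  set d := Module.finrank ℚ K with hdd
  refine ⟨Real.log (Height.mulHeight₁ β) / d, div_pos (Real.log_pos hh) (by exact_mod_cast hd),
    fun n s t B ht hst hs hB => ?_⟩
  have htK : (t : K) ≠ 0 := by exact_mod_cast ht
  have hx : (![s, t] : Fin 2 → 𝓞 K) ≠ 0 := fun h => ht (by simpa using congrFun h 1)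
  have hxK : (![(s : K), t] : Fin 2 → K) ≠ 0 := fun h => htK (by simpa using congrFun h 1)
  have h1 : Height.mulHeight₁ β ^ n ≤ B ^ d := by
    rw [← Height.mulHeight₁_pow, show β ^ n = s / t by rw [← hst]; field_simp,
      Height.mulHeight₁_div_eq_mulHeight, NumberField.mulHeight_eq hxK]
    have hB0 : 0 ≤ B := by
      have := hB (Classical.arbitrary _)
      exact (norm_nonneg _).trans this
    have hf : ∏ᶠ v : FinitePlace K, ⨆ i, v ((![(s : K), t] : Fin 2 → K) i) ≤ 1 := by
      have h := NumberField.absNorm_mul_finprod_finitePlace_eq_one hx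
      have e : ∀ i, (((![s, t] : Fin 2 → 𝓞 K) i : 𝓞 K) : K) = (![(s : K), t] : Fin 2 → K) i := fun i => by
        fin_cases i <;> rfl
      simp only [e] at h
      rcases Nat.eq_zero_or_pos (Ideal.span (Set.range ![s, t])).absNorm with h0 | h0
      · rw [h0] at h; norm_num at h
      · have h0' : (1:ℝ) ≤ (Ideal.span (Set.range ![s, t])).absNorm := by exact_mod_cast h0
        by_contra hc
        nlinarith
    have hf0 : 0 ≤ ∏ᶠ v : FinitePlace K, ⨆ i, v ((![(s : K), t] : Fin 2 → K) i) :=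
      finprod_nonneg fun v => Real.iSup_nonneg fun i => by positivity
    have hi : ∏ v : InfinitePlace K, (⨆ i, v ((![(s : K), t] : Fin 2 → K) i)) ^ v.mult ≤ B ^ d := by
      rw [hdd, ← InfinitePlace.sum_mult_eq, ← Finset.prod_pow_eq_pow_sum]
      refine Finset.prod_le_prod (fun v _ => pow_nonneg (Real.iSup_nonneg fun i => by positivity) _)
        fun v _ => pow_le_pow_left₀ (Real.iSup_nonneg fun i => by positivity) (ciSup_le fun i => ?_) _
      fin_cases i
      · simpa [InfinitePlace.norm_embedding_eq] using hs v.embedding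
      · simpa [InfinitePlace.norm_embedding_eq] using hB v.embedding
    calc _ ≤ B ^ d * 1 := mul_le_mul hi hf hf0 (by positivity)
      _ = _ := mul_one _
  have hB0 : 0 < B := by
    have := hB (Classical.arbitrary _)
    exact lt_of_lt_of_le (norm_pos_iff.2 ((map_ne_zero _).2 htK)) this
  rw [← Real.le_log_iff_exp_le hB0]
  have h2 := Real.log_le_log (by positivity) h1
  rw [Real.log_pow, Real.log_pow] at h2
  have : (0:ℝ) < d := by exact_mod_cast hd
  rw [div_mul_eq_mul_div, div_le_iff₀ this]; linarith

/-- index type of `p`-subsets -/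
abbrev Wd (m p : ℕ) := Set.powersetCard (Fin m) p
/-- increasing enumeration -/
noncomputable abbrev en {m p : ℕ} (I : Wd m p) : Fin p → Fin m :=
  fun r => Set.powersetCard.ofFinEmbEquiv.symm I r

lemma alt_expand {R : Type*} [CommRing R] {m p : ℕ} (f : (Fin m → R) [⋀^Fin p]→ₗ[R] R)
    (y : Fin p → Fin m → R) :
    f y = ∑ L : Wd m p, Matrix.det (fun r c => y r (en L c)) * f (fun r => Pi.single (en L r) 1) := by
  have h := (Module.Basis.exteriorPower p (Pi.basisFun R (Fin m))).sum_repr (exteriorPower.ιMulti R p y)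
  have h2 := congrArg (exteriorPower.alternatingMapLinearEquiv f) h
  rw [exteriorPower.alternatingMapLinearEquiv_apply_ιMulti, map_sum] at h2
  rw [← h2]
  refine Finset.sum_congr rfl fun L _ => ?_
  rw [map_smul, smul_eq_mul, exteriorPower.basis_repr_apply, exteriorPower.basis_apply,
    exteriorPower.ιMultiDual_apply_ιMulti, exteriorPower.ιMulti_family,
    exteriorPower.alternatingMapLinearEquiv_apply_ιMulti]
  congr 1
  congr 1
  ext r c
  simp [en]

/-- compound matrix -/
noncomputable def cmp {R : Type*} [CommRing R] {m : ℕ} (p : ℕ) (M : Fin m → Fin m → R) :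
    Wd m p → Wd m p → R := fun I J => Matrix.det (fun r c => M (en I r) (en J c))

lemma cmp_one {R : Type*} [CommRing R] {m p : ℕ} (d : R) (I J : Wd m p) :
    cmp p (fun i j : Fin m => if i = j then d else 0) I J = if I = J then d ^ p else 0 := by
  unfold cmp
  split_ifs with h
  · subst h
    have : (fun r c => if en I r = en I c then d else 0) = (Matrix.diagonal fun _ : Fin p => d) := by
      ext r c
      simp [Matrix.diagonal_apply, en]
    rw [this, Matrix.det_diagonal]; simp
  · obtain ⟨i, his, hit⟩ := (Set.powersetCard.exists_mem_notMem_iff_ne I J).mp h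
    obtain ⟨k, rfl⟩ := (Set.powersetCard.mem_range_ofFinEmbEquiv_symm_iff_mem I i).mpr his
    refine Matrix.det_eq_zero_of_row_eq_zero k fun c => if_neg fun hc => hit ?_
    exact (Set.powersetCard.mem_range_ofFinEmbEquiv_symm_iff_mem J _).mp ⟨c, hc.symm⟩

lemma cmp_mul {R : Type*} [CommRing R] {m p : ℕ} (M N : Fin m → Fin m → R) (I J : Wd m p) :
    cmp p (fun i j => ∑ l, M i l * N l j) I J = ∑ L, cmp p M I L * cmp p N L J := by
  have h := alt_expand ((Matrix.detRowAlternating (R := R) (n := Fin p)).compLinearMap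
    (Matrix.toLin' (Matrix.of (fun (c : Fin p) l => N l (en J c))))) (fun r => M (en I r))
  simp only [AlternatingMap.compLinearMap_apply] at h
  convert h using 1
  · unfold cmp; refine congrArg Matrix.det ?_; ext r c
    simp [Matrix.mulVec, dotProduct, mul_comm]
  · refine Finset.sum_congr rfl fun L _ => ?_
    congr 1
    unfold cmp; refine congrArg Matrix.det ?_; ext r c
    simp

end Sub

namespace Sub
open MvPolynomial NumberField

lemma relmax {ι : Type*} [Fintype ι] [DecidableEq ι] (W : Submodule ℝ (ι → ℝ)) (S : Finset ι)
    (h : Module.finrank ℝ W < S.card) :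
    ∃ s ∈ S, ∀ v ∈ W, |v s| ≤ ∑ i ∈ S.erase s, |v i| := by
  let R : (ι → ℝ) →ₗ[ℝ] (S → ℝ) := LinearMap.pi fun i => LinearMap.proj (i : ι)
  have h1 : W.map R < ⊤ := by
    rw [lt_top_iff_ne_top]
    intro e
    have := Submodule.finrank_map_le R W
    rw [e, finrank_top] at this
    simp at this
    omega
  obtain ⟨f, hf, hW⟩ := Submodule.exists_le_ker_of_lt_top _ h1
  have hne : S.Nonempty := Finset.card_pos.1 (by omega)
  let c : ι → ℝ := fun i => if h : i ∈ S then f (Pi.single ⟨i, h⟩ 1) else 0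
  have hc : ∀ v ∈ W, ∑ i ∈ S, c i * v i = 0 := fun v hv => by
    have h2 : f (R v) = 0 := hW (Submodule.mem_map_of_mem hv)
    rw [LinearMap.pi_apply_eq_sum_univ f] at h2
    rw [← h2, ← Finset.sum_coe_sort]
    refine Finset.sum_congr rfl fun i _ => ?_
    simp only [c, i.2, dite_true, smul_eq_mul, R, LinearMap.pi_apply, LinearMap.proj_apply]
    rw [mul_comm]
    congr 2
    ext j
    simp [Pi.single_apply, eq_comm]
  obtain ⟨s, hs, hmax⟩ := S.exists_max_image (fun i => |c i|) hne
  have hcs : 0 < |c s| := by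
    rw [abs_pos]
    intro h0
    apply hf
    refine LinearMap.pi_ext' fun i => LinearMap.ext_ring ?_
    have h3 := hmax i i.2
    rw [h0, abs_zero] at h3
    have h4 : c i = 0 := abs_eq_zero.1 (le_antisymm h3 (abs_nonneg _))
    simpa [c] using h4
  refine ⟨s, hs, fun v hv => ?_⟩
  have h5 := hc v hv
  rw [← Finset.add_sum_erase _ _ hs] at h5
  have h6 : |c s| * |v s| ≤ |c s| * ∑ i ∈ S.erase s, |v i| := by
    rw [← abs_mul, show c s * v s = -∑ i ∈ S.erase s, c i * v i by linarith, abs_neg, Finset.mul_sum]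
    refine (Finset.abs_sum_le_sum_abs _ _).trans (Finset.sum_le_sum fun i hi => ?_)
    rw [abs_mul]
    exact mul_le_mul_of_nonneg_right (hmax i (Finset.mem_of_mem_erase hi)) (abs_nonneg _)
  exact le_of_mul_le_mul_left h6 hcs

lemma dav1 {ι : Type*} [Fintype ι] [DecidableEq ι] {N : ℕ} (r0 : ι ≃ Fin N)
    (V : ℕ → Submodule ℝ (ι → ℝ)) (hV : Monotone V) (hd : ∀ j, Module.finrank ℝ (V j) ≤ j) :
    ∃ r : ι ≃ Fin N, ∀ j ≤ N, ∀ v ∈ V j, ∀ i, j ≤ (r i : ℕ) →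
      |v i| ≤ 2 ^ N * ∑ i' with (r i' : ℕ) < j, |v i'| := by
  suffices ∀ d ≤ N, ∃ r : ι ≃ Fin N, ∀ j ≤ N, N - d ≤ j → ∀ v ∈ V j, ∀ i, j ≤ (r i : ℕ) →
      |v i| ≤ 2 ^ d * ∑ i' with (r i' : ℕ) < j, |v i'| by
    obtain ⟨r, hr⟩ := this N le_rfl
    exact ⟨r, fun j hj => hr j hj (by omega)⟩
  intro d
  induction d with
  | zero => exact fun _ => ⟨r0, fun j hj h v _ i hi => absurd hi (by have := (r0 i).2; omega)⟩
  | succ d ih =>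
    intro hdN
    obtain ⟨r, hr⟩ := ih (by omega)
    obtain ⟨j0, hj0⟩ : ∃ j0, N - d = j0 + 1 := ⟨N - d - 1, by omega⟩
    have hj0N : j0 < N := by omega
    set S : Finset ι := Finset.univ.filter fun i => (r i : ℕ) < j0 + 1 with hS
    have hcard : S.card = j0 + 1 := by
      have : S.map r.toEmbedding = Finset.univ.filter fun x : Fin N => (x : ℕ) < j0 + 1 := by
        ext x; simp [hS]
      rw [← Finset.card_map r.toEmbedding, this, Fin.card_filter_val_lt]; omega
    obtain ⟨s, hs, hsv⟩ := relmax (V j0) S (by have := hd j0; omega)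
    have hs' : (r s : ℕ) < j0 + 1 := by simpa [hS] using hs
    let r' : ι ≃ Fin N := r.trans (Equiv.swap (r s) ⟨j0, hj0N⟩)
    have hlt : ∀ i j, j0 + 1 ≤ j → ((r' i : ℕ) < j ↔ (r i : ℕ) < j) := fun i j hj => by
      simp only [r', Equiv.trans_apply, Equiv.swap_apply_def]
      split_ifs with h1 h2
      · rw [h1]; simp; omega
      · rw [h2]; simp; omega
      · rfl
    have hrs : ∀ i, (r' i : ℕ) < j0 ↔ i ∈ S.erase s := fun i => by
      simp only [r', Equiv.trans_apply, Equiv.swap_apply_def, hS, Finset.mem_erase, Finset.mem_filter,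
        Finset.mem_univ, true_and]
      split_ifs with h1 h2
      · have := r.injective h1; simp [this]
      · have h3 : i ≠ s := fun e => h1 (by rw [e])
        have h4 : (r s : ℕ) ≠ j0 := fun e => h1 (by rw [h2]; exact Fin.ext e.symm)
        simp [h2, h3]; omega
      · have h3 : i ≠ s := fun e => h1 (by rw [e])
        have h4 : (r i : ℕ) ≠ j0 := fun e => h2 (Fin.ext e)
        simp only [h3, ne_eq, not_false_eq_true, true_and]; omega
    refine ⟨r', fun j hj hj' v hv i hi => ?_⟩
    rcases Nat.lt_or_ge j (j0 + 1) with hlt' | hge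
    · obtain rfl : j = j0 := by omega
      have e : (Finset.univ.filter fun i' => (r' i' : ℕ) < j) = S.erase s := by
        ext i'; simp [hrs]
      rw [e]
      have hsum := Finset.sum_nonneg (s := S.erase s) (fun i _ => abs_nonneg (v i))
      have h2d : (1:ℝ) ≤ 2 ^ (d+1) := one_le_pow₀ (by norm_num)
      have hs2 := hsv v hv
      rcases eq_or_ne i s with rfl | his
      · exact hs2.trans (le_mul_of_one_le_left hsum h2d)
      · have hiS : i ∉ S := fun h => by
          have := (hrs i).2 (Finset.mem_erase.2 ⟨his, h⟩); omega
        have h3 := hr (j+1) (by omega) (by omega) v (hV (Nat.le_succ j) hv) i (by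
          simp [hS] at hiS; omega)
        rw [← hS, ← Finset.add_sum_erase _ _ hs] at h3
        have : (0:ℝ) < 2 ^ d := by positivity
        calc |v i| ≤ _ := h3
          _ ≤ 2 ^ d * (2 * ∑ i ∈ S.erase s, |v i|) := by gcongr; linarith
          _ = _ := by ring
    · have h3 := hr j hj (by omega) v hv i (by
        have := hlt i j hge; omega)
      have e : (Finset.univ.filter fun i' => (r' i' : ℕ) < j) = Finset.univ.filter fun i' => (r i' : ℕ) < j := by
        ext i'; simp [hlt i' j hge]
      rw [e]
      refine h3.trans (mul_le_mul_of_nonneg_right ?_ (Finset.sum_nonneg fun i _ => abs_nonneg _))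
      exact pow_le_pow_right₀ (by norm_num) (Nat.le_succ d)

/-- flag spanned by the first `j` vectors -/
noncomputable def fl {M ι : Type*} (T : M → ι → ℝ) (y : ℕ → M) (j : ℕ) : Submodule ℝ (ι → ℝ) :=
  Submodule.span ℝ ((fun l => T (y l)) '' Set.Iio j)

lemma fl_mono {M ι : Type*} (T : M → ι → ℝ) (y : ℕ → M) : Monotone (fl T y) := fun _ _ h =>
  Submodule.span_mono (Set.image_mono (Set.Iio_subset_Iio h))

lemma fl_rank {M ι : Type*} [Fintype ι] (T : M → ι → ℝ) (y : ℕ → M) (j : ℕ) :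
    Module.finrank ℝ (fl T y j) ≤ j := by
  classical
  have e : (fun l => T (y l)) '' Set.Iio j = ((Finset.range j).image fun l => T (y l) : Finset _) := by
    ext; simp
  rw [fl, e]
  exact (finrank_span_finset_le_card _).trans (Finset.card_image_le.trans (by simp))

lemma fl_congr {M ι : Type*} (T : M → ι → ℝ) (y y' : ℕ → M) (j : ℕ) (h : ∀ l < j, y l = y' l) :
    fl T y j = fl T y' j := by
  unfold fl
  congr 1
  exact Set.image_congr fun l hl => by rw [h l hl]

lemma minima {M ι : Type*} [AddCommGroup M] [Fintype ι] (T : M → ι → ℝ)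
    (hspan : Submodule.span ℝ (Set.range T) = ⊤) (hfin : ∀ c, {x | ‖T x‖ ≤ c}.Finite) :
    ∃ y : ℕ → M, ∀ l < Fintype.card ι, T (y l) ∉ fl T y l ∧
      ∀ x, T x ∉ fl T y l → ‖T (y l)‖ ≤ ‖T x‖ := by
  suffices ∀ k ≤ Fintype.card ι, ∃ y : ℕ → M, ∀ l < k, T (y l) ∉ fl T y l ∧
      ∀ x, T x ∉ fl T y l → ‖T (y l)‖ ≤ ‖T x‖ from this _ le_rfl
  intro k
  induction k with
  | zero => exact fun _ => ⟨fun _ => 0, fun l hl => absurd hl (by omega)⟩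
  | succ k ih =>
    intro hk
    obtain ⟨y, hy⟩ := ih (by omega)
    obtain ⟨x0, hx0⟩ : ∃ x, T x ∉ fl T y k := by
      by_contra! hc
      have h1 : fl T y k = ⊤ := by
        rw [eq_top_iff, ← hspan, Submodule.span_le]
        rintro _ ⟨x, rfl⟩
        exact hc x
      have := fl_rank T y k
      rw [h1, finrank_top, Module.finrank_fintype_fun_eq_card] at this
      omega
    obtain ⟨x1, hx1, hmin⟩ := ((hfin ‖T x0‖).subset
      (fun x (hx : x ∈ {x | ‖T x‖ ≤ ‖T x0‖ ∧ T x ∉ fl T y k}) => hx.1)).exists_minimalFor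
        (fun x => ‖T x‖) _ ⟨x0, le_rfl, hx0⟩
    refine ⟨Function.update y k x1, fun l hl => ?_⟩
    have e : fl T (Function.update y k x1) l = fl T y l := fl_congr _ _ _ _ fun i hi => by
      rw [Function.update_of_ne (by omega)]
    rw [e]
    rcases eq_or_ne l k with rfl | h
    · rw [Function.update_self]
      refine ⟨hx1.2, fun x hx => ?_⟩
      by_contra! hlt
      exact absurd (hmin ⟨hlt.le.trans hx1.1, hx⟩ hlt.le) (not_le.2 hlt)
    · rw [Function.update_of_ne h]
      exact hy l (by omega)

end Sub

namespace Sub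
open MvPolynomial NumberField

lemma fl_rank_eq {M ι : Type*} [Fintype ι] (T : M → ι → ℝ) (y : ℕ → M) (N : ℕ)
    (h : ∀ l < N, T (y l) ∉ fl T y l) (j : ℕ) (hj : j ≤ N) : Module.finrank ℝ (fl T y j) = j := by
  refine le_antisymm (fl_rank T y j) ?_
  induction j with
  | zero => omega
  | succ j ih =>
    have : fl T y j < fl T y (j+1) := by
      refine lt_of_le_of_ne (fl_mono T y (Nat.le_succ j)) fun e => h j (by omega) ?_
      rw [e]
      exact Submodule.subset_span ⟨j, by simp, rfl⟩
    have h2 := Submodule.finrank_lt_finrank_of_lt this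
    have := ih (by omega)
    omega

lemma mink2 {M ι : Type*} [AddCommGroup M] [Fintype ι] (T : M → ι → ℝ) (y : ℕ → M)
    (N : ℕ) (hN : Fintype.card ι = N)
    (hy : ∀ l < N, T (y l) ∉ fl T y l ∧ ∀ x, T x ∉ fl T y l → ‖T (y l)‖ ≤ ‖T x‖)
    (r : ι ≃ Fin N) (hr : ∀ j ≤ N, ∀ v ∈ fl T y j, ∀ i, j ≤ (r i : ℕ) →
      |v i| ≤ 2 ^ N * ∑ i' with (r i' : ℕ) < j, |v i'|) (D : ℝ)
    (hM : ∀ ε : ι → ℝ, (∀ i, 0 < ε i) → (∀ x, (∀ i, |T x i| < ε i) → T x = 0) → ∏ i, ε i ≤ D) :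
    (∀ l < N, 0 < ‖T (y l)‖) ∧ (∀ a b, a ≤ b → b < N → ‖T (y a)‖ ≤ ‖T (y b)‖) ∧
    ∏ l ∈ Finset.range N, ‖T (y l)‖ ≤ (2 ^ N * N + 1) ^ N * D := by
  have hpos : ∀ l < N, 0 < ‖T (y l)‖ := fun l hl => by
    rw [norm_pos_iff]
    intro h0
    exact (hy l hl).1 (by rw [h0]; exact zero_mem _)
  have hmono : ∀ a b, a ≤ b → b < N → ‖T (y a)‖ ≤ ‖T (y b)‖ := fun a b hab hb =>
    (hy a (by omega)).2 _ fun h => (hy b hb).1 (fl_mono T y hab h)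
  refine ⟨hpos, hmono, ?_⟩
  set c : ℝ := 2 ^ N * N + 1 with hc
  have hc0 : 1 ≤ c := by rw [hc]; have : (0:ℝ) ≤ 2 ^ N * N := by positivity
                         linarith
  have h1 := hM (fun i => ‖T (y (r i))‖ / c) (fun i => div_pos (hpos _ (r i).2) (by linarith)) (by
    intro x hx
    by_contra hx0
    have htop : fl T y N = ⊤ := Submodule.eq_top_of_finrank_eq (by
      rw [fl_rank_eq T y N (fun l hl => (hy l hl).1) N le_rfl, Module.finrank_fintype_fun_eq_card, hN])
    have hex : ∃ j, T x ∈ fl T y j := ⟨N, by rw [htop]; trivial⟩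
    classical
    obtain ⟨j, hj⟩ : ∃ j, Nat.find hex = j + 1 := by
      refine Nat.exists_eq_succ_of_ne_zero fun h0 => hx0 ?_
      have := Nat.find_spec hex
      rw [h0] at this
      simpa [fl] using this
    have hj1 : T x ∈ fl T y (j+1) := hj ▸ Nat.find_spec hex
    have hj2 : T x ∉ fl T y j := Nat.find_min hex (by omega)
    have hjN : j < N := by
      by_contra hh
      exact hj2 (fl_mono T y (not_lt.1 hh) (by rw [htop]; trivial))
    have hle := (hy j hjN).2 x hj2
    refine absurd hle (not_le.2 ?_)
    have hlj := hpos j hjN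
    have hs : ∀ i, (r i : ℕ) < j + 1 → |T x i| ≤ ‖T (y j)‖ / c := fun i hi =>
      (hx i).le.trans (div_le_div_of_nonneg_right (hmono _ _ (by omega) hjN) (by linarith))
    rw [pi_norm_lt_iff hlj]
    intro i
    rw [Real.norm_eq_abs]
    rcases Nat.lt_or_ge (r i) (j+1) with hi | hi
    · exact (hx i).trans_le ((div_le_div_of_nonneg_right (hmono _ _ (by omega) hjN)
        (by linarith)).trans (div_le_self hlj.le hc0))
    · have h2 := hr (j+1) (by omega) _ hj1 i hi
      have h3 : ∑ i' with (r i' : ℕ) < j + 1, |T x i'| ≤ N * (‖T (y j)‖ / c) := by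
        refine (Finset.sum_le_sum fun i' hi' => hs i' (by simpa using hi')).trans ?_
        rw [Finset.sum_const, nsmul_eq_mul]
        refine mul_le_mul_of_nonneg_right ?_ (by positivity)
        exact_mod_cast (Finset.card_le_univ _).trans hN.le
      calc |T x i| ≤ 2 ^ N * (N * (‖T (y j)‖ / c)) := h2.trans (by gcongr)
        _ = (2 ^ N * N / c) * ‖T (y j)‖ := by ring
        _ < 1 * ‖T (y j)‖ := by
            gcongr
            rw [div_lt_one (by linarith)]; linarith
        _ = _ := one_mul _)
  rw [Finset.prod_div_distrib, Finset.prod_const, Finset.card_univ, hN, div_le_iff₀ (by positivity)] at h1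
  rw [mul_comm, Finset.prod_range (fun l => ‖T (y l)‖)]
  refine le_trans (le_of_eq ?_) h1
  exact (Equiv.prod_comp r (fun l : Fin N => ‖T (y l)‖)).symm

lemma dav2 {M ι : Type*} [AddCommGroup M] [Fintype ι] [DecidableEq ι] (T : M →+ (ι → ℝ)) (y : ℕ → M)
    (N : ℕ) (hN : Fintype.card ι = N) (hy : ∀ l < N, T (y l) ∉ fl T y l)
    (r : ι ≃ Fin N) (hr : ∀ j ≤ N, ∀ v ∈ fl T y j, ∀ i, j ≤ (r i : ℕ) →
      |v i| ≤ 2 ^ N * ∑ i' with (r i' : ℕ) < j, |v i'|) (Λ : ℕ → ℝ) (h0 : ∀ l, 0 ≤ Λ l)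
    (hΛ : ∀ a b, a ≤ b → b < N → Λ a ≤ Λ b) (hT : ∀ l < N, ‖T (y l)‖ ≤ Λ l) :
    ∃ y' : ℕ → M, (∀ l < N, ∀ i, |T (y' l) i| ≤ (1 + 2 ^ N * N) * 2 ^ N * Λ (min (r i) l)) ∧
      ∀ j ≤ N, Submodule.span ℤ (y' '' Set.Iio j) = Submodule.span ℤ (y '' Set.Iio j) := by
  suffices ∀ k ≤ N, ∃ y' : ℕ → M,
      (∀ l < k, ∀ i, |T (y' l) i| ≤ (1 + 2 ^ N * N) * 2 ^ l * Λ (min (r i) l)) ∧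
      ∀ j ≤ k, Submodule.span ℤ (y' '' Set.Iio j) = Submodule.span ℤ (y '' Set.Iio j) by
    obtain ⟨y', h1, h2⟩ := this N le_rfl
    refine ⟨y', fun l hl i => (h1 l hl i).trans ?_, h2⟩
    have := h0 (min (r i) l)
    gcongr
    norm_num
  intro k
  induction k with
  | zero => exact fun _ => ⟨y, fun l hl => absurd hl (by omega), fun j hj => rfl⟩
  | succ k ih =>
    intro hk
    obtain ⟨y', hb, hs⟩ := ih (by omega)
    have hfl : fl T y k ≤ fl T y' k := by
      rw [fl, Submodule.span_le]
      rintro _ ⟨l, hl, rfl⟩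
      have h1 : y l ∈ Submodule.span ℤ (y' '' Set.Iio k) := by
        rw [hs k le_rfl]; exact Submodule.subset_span ⟨l, hl, rfl⟩
      change T (y l) ∈ fl T y' k
      generalize y l = x at h1
      induction h1 using Submodule.span_induction with
      | mem x hx =>
        obtain ⟨l, hl, rfl⟩ := hx
        exact Submodule.subset_span ⟨l, hl, rfl⟩
      | zero => rw [map_zero]; exact zero_mem _
      | add x y _ _ h1 h2 => rw [map_add]; exact add_mem h1 h2
      | smul a x _ h => rw [map_zsmul]; exact zsmul_mem h a
    obtain ⟨v, hv, hvS⟩ : ∃ v ∈ fl T y k, ∀ i, (r i : ℕ) < k → v i = T (y k) i := by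
      let S : Finset ι := Finset.univ.filter fun i => (r i : ℕ) < k
      have hcard : S.card = k := by
        have : S.map r.toEmbedding = Finset.univ.filter fun x : Fin N => (x : ℕ) < k := by
          ext x; simp [S]
        rw [← Finset.card_map r.toEmbedding, this, Fin.card_filter_val_lt]; omega
      let R : fl T y k →ₗ[ℝ] (S → ℝ) :=
        (LinearMap.pi fun i : S => (LinearMap.proj (i : ι) : (ι → ℝ) →ₗ[ℝ] ℝ)).comp (fl T y k).subtype
      have hinj : Function.Injective R := by
        rw [← LinearMap.ker_eq_bot, LinearMap.ker_eq_bot']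
        intro w hw
        have hw' : ∀ i, (r i : ℕ) < k → (w : ι → ℝ) i = 0 := fun i hi =>
          congrFun hw ⟨i, by simp [S, hi]⟩
        ext i
        rcases Nat.lt_or_ge (r i) k with hi | hi
        · exact hw' i hi
        · have := hr k (by omega) w w.2 i hi
          rw [Finset.sum_eq_zero (fun i' hi' => by rw [hw' i' (by simpa using hi'), abs_zero]), mul_zero] at this
          simpa using this
      have hsurj : Function.Surjective R := (LinearMap.injective_iff_surjective_of_finrank_eq_finrank (by
        rw [fl_rank_eq T y N hy k (by omega), Module.finrank_fintype_fun_eq_card, Fintype.card_coe, hcard])).1 hinj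
      obtain ⟨w, hw⟩ := hsurj fun i => T (y k) i
      exact ⟨w, w.2, fun i hi => congrFun hw ⟨i, by simp [S, hi]⟩⟩
    obtain ⟨ρ, hρ⟩ : ∃ ρ : ℕ → ℝ, ∑ l ∈ Finset.range k, ρ l • T (y' l) = v := by
      have h1 := hfl hv
      rw [fl, show Set.Iio k = ((Finset.range k : Finset ℕ) : Set ℕ) by ext; simp] at h1
      obtain ⟨c, hc⟩ := (Submodule.mem_span_image_finset_iff_exists_fun ℝ).1 h1
      refine ⟨fun l => if h : l ∈ Finset.range k then c ⟨l, h⟩ else 0, ?_⟩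
      rw [← hc, ← Finset.sum_coe_sort]
      exact Finset.sum_congr rfl fun l _ => by simp only [dif_pos l.2]
    have hvb : ∀ i, |v i| ≤ 2 ^ N * N * Λ k ∨ (r i : ℕ) < k := fun i => by
      by_contra! hc
      refine absurd (hr k (by omega) v hv i hc.2) (not_le.2 (lt_of_le_of_lt ?_ hc.1))
      have hle : ∑ i' with (r i' : ℕ) < k, |v i'| ≤ N * Λ k := by
        refine (Finset.sum_le_sum fun i' hi' => (?_ : |v i'| ≤ Λ k)).trans ?_
        · rw [hvS i' (by simpa using hi')]
          exact (norm_le_pi_norm (T (y k)) i').trans (hT k (by omega))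
        · rw [Finset.sum_const, nsmul_eq_mul]
          refine mul_le_mul_of_nonneg_right ?_ (h0 k)
          exact_mod_cast (Finset.card_le_univ _).trans hN.le
      calc _ ≤ 2 ^ N * (N * Λ k) := by gcongr
        _ = _ := by ring
    set z : M := y k - ∑ l ∈ Finset.range k, ⌊ρ l⌋ • y' l with hz
    have hTz : T z = (T (y k) - v) + ∑ l ∈ Finset.range k, Int.fract (ρ l) • T (y' l) := by
      rw [hz, map_sub, map_sum, ← hρ, sub_add, ← Finset.sum_sub_distrib]
      congr 1
      refine Finset.sum_congr rfl fun l _ => ?_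
      rw [map_zsmul, ← sub_smul, Int.self_sub_fract, Int.cast_smul_eq_zsmul]
    refine ⟨Function.update y' k z, fun l hl i => ?_, fun j hj => ?_⟩
    · rcases eq_or_ne l k with rfl | hlk
      · rw [Function.update_self, hTz]
        have hsum : |(∑ j ∈ Finset.range l, Int.fract (ρ j) • T (y' j)) i| ≤
            (1 + 2 ^ N * N) * (2 ^ l - 1) * Λ (min (r i) l) := by
          rw [Finset.sum_apply]
          have hg : ∑ j ∈ Finset.range l, (2:ℝ) ^ j = 2 ^ l - 1 := by
            rw [geom_sum_eq (by norm_num)]; norm_num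
          rw [← hg, Finset.mul_sum, Finset.sum_mul]
          refine (Finset.abs_sum_le_sum_abs _ _).trans (Finset.sum_le_sum fun j hj => ?_)
          have hjl := Finset.mem_range.1 hj
          rw [Pi.smul_apply, smul_eq_mul, abs_mul, abs_of_nonneg (Int.fract_nonneg _)]
          calc _ ≤ 1 * |T (y' j) i| := by gcongr; exact (Int.fract_lt_one _).le
            _ ≤ (1 + 2 ^ N * N) * 2 ^ j * Λ (min (r i) j) := by rw [one_mul]; exact hb j hjl i
            _ ≤ _ := by gcongr; exact hΛ _ _ (by omega) (by omega)
        have h1 : |(T (y l) - v) i| ≤ (1 + 2 ^ N * N) * Λ (min (r i) l) := by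
          rw [Pi.sub_apply]
          rcases Nat.lt_or_ge (r i) l with hi | hi
          · rw [hvS i hi, sub_self, abs_zero]
            have := h0 (min (r i) l)
            positivity
          · rw [min_eq_right hi, add_mul, one_mul]
            refine (abs_sub _ _).trans (add_le_add ?_ ((hvb i).resolve_right (by omega)))
            exact (norm_le_pi_norm (T (y l)) i).trans (hT l (by omega))
        rw [Pi.add_apply]
        refine (abs_add_le _ _).trans ((add_le_add h1 hsum).trans (le_of_eq ?_))
        ring
      · rw [Function.update_of_ne hlk]
        exact hb l (by omega) i
    · have hup : ∀ j ≤ k, Function.update y' k z '' Set.Iio j = y' '' Set.Iio j := fun j hj =>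
        Set.image_congr fun l hl => Function.update_of_ne (by simp at hl; omega) _ _
      rcases Nat.lt_or_ge j (k+1) with hjk | hjk
      · rw [hup j (by omega)]; exact hs j (by omega)
      · obtain rfl : j = k + 1 := by omega
        have e : Set.Iio (k+1) = insert k (Set.Iio k) := by ext; simp; try omega
        rw [e, Set.image_insert_eq, Set.image_insert_eq, hup k le_rfl, Function.update_self,
          Submodule.span_insert, Submodule.span_insert, hs k le_rfl]
        have hmem : y k - z ∈ Submodule.span ℤ (y '' Set.Iio k) := by
          rw [hz, sub_sub_cancel, ← hs k le_rfl]
          exact Submodule.sum_mem _ fun l hl => Submodule.smul_mem _ _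
            (Submodule.subset_span ⟨l, by simpa using hl, rfl⟩)
        refine le_antisymm (sup_le ?_ le_sup_right) (sup_le ?_ le_sup_right) <;>
          rw [Submodule.span_singleton_le_iff_mem]
        · rw [← sub_sub_cancel (y k) z]
          exact sub_mem (Submodule.mem_sup_left (Submodule.mem_span_singleton_self _)) (Submodule.mem_sup_right hmem)
        · rw [← sub_add_cancel (y k) z]
          exact add_mem (Submodule.mem_sup_right hmem) (Submodule.mem_sup_left (Submodule.mem_span_singleton_self _))

end Sub

namespace Sub
open MvPolynomial NumberField

lemma minkbox {m : ℕ} (B : Matrix (Fin m) (Fin m) ℝ) (hB : B.det ≠ 0) (ε : Fin m → ℝ) (hε : ∀ i, 0 < ε i)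
    (h : ∀ x : Fin m → ℤ, (∀ i, |∑ l, B i l * (x l : ℝ)| < ε i) → x = 0) : ∏ i, ε i ≤ |B.det| := by
  by_contra hc
  rw [not_le] at hc
  let s : Set (Fin m → ℝ) := (Matrix.toLin' B) ⁻¹' (Set.pi Set.univ fun i => Set.Ioo (-ε i) (ε i))
  have hdet : LinearMap.det (Matrix.toLin' B) ≠ 0 := by rwa [LinearMap.det_toLin']
  have hvol : MeasureTheory.volume s = ENNReal.ofReal (|B.det|⁻¹ * ∏ i, (2 * ε i)) := by
    rw [MeasureTheory.Measure.addHaar_preimage_linearMap _ hdet, LinearMap.det_toLin',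
      MeasureTheory.volume_pi, MeasureTheory.Measure.pi_pi, abs_inv,
      ENNReal.ofReal_mul (by positivity), ENNReal.ofReal_prod_of_nonneg (fun i _ => by have := hε i; positivity)]
    congr 1
    refine Finset.prod_congr rfl fun i _ => ?_
    rw [Real.volume_Ioo]; congr 1; ring
  have : Countable (Submodule.span ℤ (Set.range (Pi.basisFun ℝ (Fin m)))).toAddSubgroup :=
    inferInstanceAs (Countable (Submodule.span ℤ (Set.range (Pi.basisFun ℝ (Fin m)))))
  obtain ⟨x, hx0, hx⟩ := MeasureTheory.exists_ne_zero_mem_lattice_of_measure_mul_two_pow_lt_measure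
    (s := s) (ZSpan.isAddFundamentalDomain' (Pi.basisFun ℝ (Fin m)) MeasureTheory.volume) (fun x hx => by
      simp only [s, Set.mem_preimage, Set.mem_pi, Set.mem_univ, true_implies, Set.mem_Ioo, map_neg, Pi.neg_apply] at hx ⊢
      exact fun i => ⟨by linarith [(hx i).2], by linarith [(hx i).1]⟩)
    ((convex_pi fun i _ => convex_Ioo _ _).linear_preimage _) (by
      rw [hvol, ZSpan.volume_fundamentalDomain]
      have : Matrix.of (Pi.basisFun ℝ (Fin m)) = 1 := by
        ext i j; simp [Matrix.one_apply, Pi.single_apply, eq_comm]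
      rw [this, Matrix.det_one, abs_one, ENNReal.ofReal_one, one_mul, Finset.prod_mul_distrib,
        Module.finrank_fintype_fun_eq_card, Fintype.card_fin, Finset.prod_const, Finset.card_univ, Fintype.card_fin,
        show (2:ENNReal) ^ m = ENNReal.ofReal (2 ^ m) by rw [ENNReal.ofReal_pow (by norm_num)]; simp]
      rw [ENNReal.ofReal_lt_ofReal_iff_of_nonneg (by positivity)]
      have h1 : 0 < |B.det| := abs_pos.2 hB
      rw [← mul_assoc, mul_comm _ ((2:ℝ) ^ m), mul_assoc]
      have : 1 < |B.det|⁻¹ * ∏ i, ε i := by rw [inv_mul_eq_div, one_lt_div h1]; exact hc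
      nlinarith [show (0:ℝ) < 2 ^ m by positivity])
  have hm := (Module.Basis.mem_span_iff_repr_mem ℤ (Pi.basisFun ℝ (Fin m)) (x : Fin m → ℝ)).1 x.2
  choose z hz using hm
  have hz' : ∀ l, (z l : ℝ) = (x : Fin m → ℝ) l := fun l => by simpa using hz l
  have h2 := h z fun i => by
    simp only [s, Set.mem_preimage, Set.mem_pi, Set.mem_univ, true_implies, Set.mem_Ioo] at hx
    rw [abs_lt]
    simpa [hz', Matrix.mulVec, dotProduct] using hx i
  refine hx0 (Subtype.ext (funext fun l => ?_))
  rw [← hz', h2]; simp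

theorem Tthm2 {K : Type*} [Field K] [NumberField K] {ι J : Type*} [Fintype ι] [DecidableEq ι] [Nonempty ι] [Fintype J]
    (σ : K →+* ℂ) (E E' P P' : ι → ι → 𝓞 K) (δ : ℕ) (hδ : 0 < δ)
    (hE : ∀ i l, ∑ j, E' i j * E j l = if i = l then (δ : 𝓞 K) else 0)
    (hP : ∀ i l, ∑ j, P' i j * P j l = if i = l then (δ : 𝓞 K) else 0)
    (γ : ι → 𝓞 K) (Γ : ℤ) (hΓ0 : Γ ≠ 0) (hΓ : ∏ i, γ i = Γ) (Bw η : ℝ) (hη : 0 < η)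
    (Cb : ℝ) (hCb : 0 ≤ Cb) (c1 : ℝ) (hc1 : 0 < c1) :
    {n : ℕ | ∃ w : ι → ℝ, (∀ i, |w i| ≤ Bw) ∧ ∑ i, w i ≤ Real.log |(Γ : ℝ)| - η ∧
      ∃ (Y : J → ι → ℤ) (q : ι → ℤ) (a b : ι), q a ≠ 0 ∧
      (∀ v : ι → ℚ, ∑ i, v i * q i = 0 → v ∈ Submodule.span ℚ (Set.range fun j l => (Y j l : ℚ))) ∧
      (∀ i j, γ i ^ n ∣ ∑ l, E i l * (Y j l : 𝓞 K)) ∧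
      (∀ i j, ‖σ ((∑ l, P i l * (Y j l : 𝓞 K) : 𝓞 K) : K)‖ ≤ Cb * Real.exp (w i * n)) ∧
      Real.exp (c1 * n) ≤ max |((q b / q a : ℚ).num : ℝ)| ((q b / q a : ℚ).den)}.Finite := by
  set k : ℝ := (Fintype.card ι : ℝ) with hk
  have hk0 : 0 < k := by rw [hk]; exact_mod_cast Fintype.card_pos
  set h : ℝ := η / (2 * k) with hh
  have hh0 : 0 < h := by positivity
  obtain ⟨G, hG⟩ := exists_nat_ge (Bw / h + 1)
  have hfin : ({g : ι → ℤ | (∀ i, g i ∈ Set.Icc (-(G:ℤ)) G) ∧ ∑ i, h * (g i : ℝ) < Real.log |(Γ : ℝ)|}).Finite :=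
    (Set.Finite.pi (fun _ : ι => Set.finite_Icc (-(G:ℤ)) G)).subset fun g hg i _ => hg.1 i
  refine (hfin.biUnion fun g hg => Tthm (J := J) σ E E' P P' δ hδ hE hP γ Γ hΓ0 hΓ (fun i => h * g i) hg.2 Cb c1 hc1).subset ?_
  rintro n ⟨w, hw1, hw2, Y, q, a, b, hqa, hv, hd, hb, hht⟩
  simp only [Set.mem_iUnion]
  have hc : ∀ i, w i ≤ h * ⌈w i / h⌉ := fun i => by
    have := Int.le_ceil (w i / h)
    rwa [div_le_iff₀' hh0] at this
  refine ⟨fun i => ⌈w i / h⌉, ⟨fun i => ?_, ?_⟩, Y, q, a, b, (q b / q a : ℚ).num, (q b / q a : ℚ).den, hqa, ?_, hd, fun i j => ?_, ?_, ?_, ?_, ?_⟩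
  · have h1 := abs_le.1 (hw1 i)
    have h3 : -(Bw / h) ≤ w i / h := by rw [← neg_div]; gcongr; exact h1.1
    have h4 : w i / h ≤ Bw / h := by gcongr; exact h1.2
    have h5 := Int.le_ceil (w i / h)
    have h6 := Int.ceil_lt_add_one (w i / h)
    constructor
    · have : (-(G:ℝ)) ≤ (⌈w i / h⌉ : ℝ) := by linarith
      exact_mod_cast this
    · have : (⌈w i / h⌉ : ℝ) ≤ G := by linarith
      exact_mod_cast this
  · calc ∑ i, h * ((⌈w i / h⌉ : ℤ) : ℝ) ≤ ∑ i, (w i + h) := Finset.sum_le_sum fun i _ => by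
          have h6 := Int.ceil_lt_add_one (w i / h)
          have : h * (w i / h) = w i := by field_simp
          nlinarith
      _ = ∑ i, w i + η / 2 := by
          rw [Finset.sum_add_distrib, Finset.sum_const, Finset.card_univ, nsmul_eq_mul, ← hk, hh]; field_simp
      _ < _ := by linarith
  · have : ∀ i, ∃ L : J → ℚ, ∑ j, L j • (fun l => (Y j l : ℚ)) = fun l => (if i = l then 1 else 0) - (q i / q a : ℚ) * (if l = a then 1 else 0) := fun i => by
      refine (Submodule.mem_span_range_iff_exists_fun ℚ).1 (hv _ ?_)
      have : (q a : ℚ) ≠ 0 := by exact_mod_cast hqa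
      simp only [sub_mul, Finset.sum_sub_distrib, ite_mul, one_mul, zero_mul, Finset.sum_ite_eq, Finset.mem_univ, if_true, mul_ite, mul_one, mul_zero, Finset.sum_ite_eq']
      field_simp
      ring
    choose L hL using this
    refine ⟨fun j i => L i j, fun i l => ?_⟩
    have := congrFun (hL i) l
    simp only [Finset.sum_apply, Pi.smul_apply, smul_eq_mul] at this
    rw [this]; ring
  · refine (hb i j).trans ?_
    gcongr
    exact hc i
  · rw [Int.isCoprime_iff_gcd_eq_one]
    exact (q b / q a : ℚ).reduced
  · exact_mod_cast (q b / q a : ℚ).den_ne_zero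
  · have : (q a : ℚ) ≠ 0 := by exact_mod_cast hqa
    have h1 : (q b : ℚ) * (q b / q a : ℚ).den = q a * (q b / q a : ℚ).num := by
      have := Rat.num_div_den (q b / q a : ℚ)
      have hd0 : ((q b / q a : ℚ).den : ℚ) ≠ 0 := by exact_mod_cast (q b / q a : ℚ).den_ne_zero
      rw [div_eq_div_iff hd0 ‹_›] at this
      linarith
    exact_mod_cast h1
  · refine hht.trans (le_of_eq ?_)
    push_cast
    simp

end Sub

namespace Sub
open MvPolynomial NumberField

lemma en_prod {R : Type*} [CommMonoid R] {m p : ℕ} (f : Fin m → R) (I : Wd m p) :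
    ∏ r, f (en I r) = ∏ i ∈ I.1, f i := by
  rw [← Finset.prod_image (s := Finset.univ) (g := en I) (fun a _ b _ h => (Set.powersetCard.ofFinEmbEquiv.symm I).injective h)]
  congr 1
  ext i
  simp only [Finset.mem_image, Finset.mem_univ, true_and]
  exact Set.powersetCard.mem_range_ofFinEmbEquiv_symm_iff_mem I i

lemma wd_prod {R : Type*} [CommMonoid R] {m p : ℕ} (f : Fin m → R) :
    ∏ I : Wd m p, ∏ r, f (en I r) = (∏ i, f i) ^ ((m - 1).choose (p - 1)) ∨ p = 0 := by
  classical
  rcases Nat.eq_zero_or_pos p with h0 | h0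
  · exact Or.inr h0
  left
  simp only [en_prod]
  have h1 : ∏ I : Wd m p, ∏ i ∈ I.1, f i = ∏ s ∈ (Finset.univ : Finset (Fin m)).powersetCard p, ∏ i ∈ s, f i := by
    refine Finset.prod_bij (fun I _ => I.1) (fun I _ => ?_) (fun I _ J _ h => Subtype.ext h) (fun s hs => ?_) (fun _ _ => rfl)
    · simp
    · exact ⟨⟨s, by simpa [Finset.mem_powersetCard] using hs⟩, Finset.mem_univ _, rfl⟩
  rw [h1, Finset.prod_comm' (t' := Finset.univ) (s' := fun i => (Finset.univ.powersetCard p).filter ({i} ⊆ ·)) (by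
    intro s i; simp), ← Finset.prod_pow]
  refine Finset.prod_congr rfl fun i _ => ?_
  rw [Finset.prod_const, Finset.card_filter_powersetCard_subset _ _ _ (Finset.subset_univ _) (by rw [Finset.card_singleton]; exact h0)]
  simp

/-- the top index -/
noncomputable def Jst (k p : ℕ) : Wd (k + p) p := Set.powersetCard.ofFinEmbEquiv (Fin.natAddOrderEmb k)

lemma en_Jst (k p : ℕ) (r : Fin p) : en (Jst k p) r = Fin.natAdd k r := by simp [en, Jst]

lemma low_of_ne {k p : ℕ} (J : Wd (k + p) p) (h : J ≠ Jst k p) : ∃ r, (en J r : ℕ) < k := by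
  obtain ⟨i, his, hit⟩ := (Set.powersetCard.exists_mem_notMem_iff_ne J (Jst k p)).mp h
  obtain ⟨r, rfl⟩ := (Set.powersetCard.mem_range_ofFinEmbEquiv_symm_iff_mem J i).mpr his
  refine ⟨r, ?_⟩
  by_contra hc
  refine hit ((Set.powersetCard.mem_range_ofFinEmbEquiv_symm_iff_mem (Jst k p) _).mp ?_)
  have hlt := (en J r).2
  refine ⟨⟨en J r - k, by omega⟩, ?_⟩
  change en (Jst k p) _ = en J r
  rw [en_Jst]
  ext
  simp; omega

lemma app_upd {X : Type*} {k p : ℕ} (y : Fin k → X) (v : Fin p → X) (i : Fin p) (x : X) :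
    Fin.append y (Function.update v i x) = Function.update (Fin.append y v) (Fin.natAdd k i) x := by
  ext j
  refine Fin.addCases (fun l => ?_) (fun l => ?_) j
  · rw [Fin.append_left, Function.update_of_ne, Fin.append_left]
    exact fun h => by have := congrArg Fin.val h; simp at this; omega
  · rw [Fin.append_right]
    rcases eq_or_ne l i with rfl | h
    · rw [Function.update_self, Function.update_self]
    · rw [Function.update_of_ne h, Function.update_of_ne, Fin.append_right]
      exact fun h' => h (Fin.ext (by have := congrArg Fin.val h'; simp at this; omega))

/-- partially applied determinant -/
noncomputable def af {R : Type*} [CommRing R] {k p : ℕ} (y : Fin k → Fin (k + p) → R) :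
    (Fin (k + p) → R) [⋀^Fin p]→ₗ[R] R where
  toFun v := Matrix.detRowAlternating (Fin.append y v)
  map_update_add' v i x x' := by
    rename_i inst
    obtain rfl := Subsingleton.elim inst (instDecidableEqFin p)
    rw [app_upd, app_upd, app_upd, AlternatingMap.map_update_add]
  map_update_smul' v i c x := by
    rename_i inst
    obtain rfl := Subsingleton.elim inst (instDecidableEqFin p)
    rw [app_upd, app_upd, AlternatingMap.map_update_smul]
  map_eq_zero_of_eq' v i j h hij := AlternatingMap.map_eq_zero_of_eq _ _ (i := Fin.natAdd k i) (j := Fin.natAdd k j)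
    (by rw [Fin.append_right, Fin.append_right, h]) (fun h' => hij (Fin.natAdd_injective _ _ h'))

lemma af_apply {R : Type*} [CommRing R] {k p : ℕ} (y : Fin k → Fin (k + p) → R) (v : Fin p → Fin (k + p) → R) :
    af y v = Matrix.det (Matrix.of (Fin.append y v)) := rfl

lemma af_mul {R : Type*} [CommRing R] {k p : ℕ} (B : Matrix (Fin (k + p)) (Fin (k + p)) R)
    (y : Fin k → Fin (k + p) → R) (v : Fin p → Fin (k + p) → R) :
    af (fun i => B.mulVec (y i)) (fun i => B.mulVec (v i)) = B.det * af y v := by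
  rw [af_apply, af_apply, ← Matrix.det_transpose B, mul_comm, ← Matrix.det_mul]
  congr 1
  ext i j
  refine Fin.addCases (fun l => ?_) (fun l => ?_) i <;>
    simp [Matrix.mul_apply, Matrix.mulVec, dotProduct, mul_comm]

lemma af_map {R S : Type*} [CommRing R] [CommRing S] (φ : R →+* S) {k p : ℕ} (y : Fin k → Fin (k + p) → R)
    (v : Fin p → Fin (k + p) → R) : φ (af y v) = af (fun i l => φ (y i l)) (fun i l => φ (v i l)) := by
  rw [af_apply, af_apply, RingHom.map_det]
  congr 1
  ext i j
  refine Fin.addCases (fun l => ?_) (fun l => ?_) i <;> simp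

/-- normal vector -/
noncomputable def qv {k p : ℕ} (z : Fin k → Fin (k + p) → ℤ) (L : Wd (k + p) p) : ℤ :=
  af z (fun r => Pi.single (en L r) 1)

lemma af_qv {R : Type*} [CommRing R] {k p : ℕ} (z : Fin k → Fin (k + p) → ℤ) (v : Fin p → Fin (k + p) → R) :
    af (fun i l => (z i l : R)) v = ∑ L, Matrix.det (fun r c => v r (en L c)) * (qv z L : R) := by
  rw [alt_expand]
  refine Finset.sum_congr rfl fun L _ => ?_
  congr 1
  have := af_map (Int.castRingHom R) z (fun r => Pi.single (en L r) 1)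
  simp only [eq_intCast] at this
  rw [qv, this]
  congr 1
  ext r c
  simp [Pi.single_apply]

lemma cmp_map {R S : Type*} [CommRing R] [CommRing S] (φ : R →+* S) {m p : ℕ} (M : Fin m → Fin m → R) (I J : Wd m p) :
    φ (cmp p M I J) = cmp p (fun i j => φ (M i j)) I J :=
  RingHom.map_det φ (Matrix.of fun r c => M (en I r) (en J c))

lemma fun_inv {F : Type*} [Field F] {m : ℕ} (Z : Fin m → Fin m → F) (hZ : Matrix.det (Matrix.of Z) ≠ 0) :
    ∃ Y : Fin m → Fin m → F, ∀ i j, ∑ l, Z i l * Y l j = if i = j then 1 else 0 :=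
  ⟨((Matrix.of Z)⁻¹ : Matrix _ _ F), fun i j => by
    rw [← Matrix.one_apply (n := Fin m) (α := F), ← Matrix.mul_nonsing_inv (Matrix.of Z) (isUnit_iff_ne_zero.2 hZ),
      Matrix.mul_apply]; rfl⟩

lemma qker {k p : ℕ} (z : Fin (k + p) → Fin (k + p) → ℤ) (hz : Matrix.det (Matrix.of z) ≠ 0) (v : Wd (k + p) p → ℚ)
    (hv : ∑ L, v L * (qv (fun i => z (Fin.castAdd p i)) L : ℚ) = 0) :
    v ∈ Submodule.span ℚ ((fun J L => ((cmp p (fun l j => z j l) L J : ℤ) : ℚ)) '' {J | J ≠ Jst k p}) := by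
  set q := qv (fun i => z (Fin.castAdd p i)) with hq
  have hqu : ∀ J, ∑ L, (cmp p (fun l j => z j l) L J) * q L = af (fun i => z (Fin.castAdd p i)) (fun r => z (en J r)) := fun J => by
    have := af_qv (R := ℤ) (fun i => z (Fin.castAdd p i)) (fun r => z (en J r))
    simp only [Int.cast_id] at this
    rw [this]
    refine Finset.sum_congr rfl fun L _ => ?_
    exact congrArg (· * q L) (Matrix.det_transpose (Matrix.of fun r c => z (en J r) (en L c)))
  have h0 : ∀ J, J ≠ Jst k p → ∑ L, (cmp p (fun l j => z j l) L J) * q L = 0 := fun J hJ => by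
    obtain ⟨r, hr⟩ := low_of_ne J hJ
    rw [hqu, af_apply]
    refine Matrix.det_zero_of_row_eq (i := Fin.castAdd p ⟨_, hr⟩) (j := Fin.natAdd k r) ?_ ?_
    · intro h; have := congrArg Fin.val h; simp at this; omega
    · change Fin.append (fun i => z (Fin.castAdd p i)) (fun r => z (en J r)) _ = Fin.append (fun i => z (Fin.castAdd p i)) (fun r => z (en J r)) _
      rw [Fin.append_left, Fin.append_right]; rfl
  have h1 : ∑ L, (cmp p (fun l j => z j l) L (Jst k p)) * q L ≠ 0 := by
    rw [hqu, af_apply]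
    simp only [en_Jst]
    convert hz using 2
    ext i j
    refine Fin.addCases (fun l => ?_) (fun l => ?_) i <;> simp
  obtain ⟨Y, hY⟩ := fun_inv (fun l j => (z j l : ℚ)) (by
    have : Matrix.det (Matrix.of fun l j => (z j l : ℚ)) = ((Matrix.det (Matrix.of z) : ℤ) : ℚ) := by
      rw [← Matrix.det_transpose, ← eq_intCast (Int.castRingHom ℚ), RingHom.map_det]; rfl
    rw [this]; exact_mod_cast hz)
  have hinv : ∀ I J, ∑ L, cmp p (fun l j => (z j l : ℚ)) I L * cmp p Y L J = if I = J then 1 else 0 := fun I J => by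
    rw [← cmp_mul]
    simp only [hY]
    rw [cmp_one, one_pow]
  have hcast : ∀ L J, ((cmp p (fun l j => z j l) L J : ℤ) : ℚ) = cmp p (fun l j => (z j l : ℚ)) L J := fun L J =>
    cmp_map (Int.castRingHom ℚ) _ L J
  let c : Wd (k + p) p → ℚ := fun J => ∑ M, cmp p Y J M * v M
  have hvc : ∀ L, v L = ∑ J, c J * ((cmp p (fun l j => z j l) L J : ℤ) : ℚ) := fun L => by
    simp only [c, hcast, Finset.sum_mul]
    rw [Finset.sum_comm]
    have : ∀ M, ∑ J, cmp p Y J M * v M * cmp p (fun l j => (z j l : ℚ)) L J = (if L = M then 1 else 0) * v M := fun M => by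
      rw [← hinv L M, Finset.sum_mul]
      exact Finset.sum_congr rfl fun J _ => by ring
    simp [this]
  have hcst : c (Jst k p) = 0 := by
    have h2 : ∑ J, c J * ((∑ L, (cmp p (fun l j => z j l) L J) * q L : ℤ) : ℚ) = 0 := by
      rw [← hv]
      simp only [hvc, Finset.sum_mul]
      rw [Finset.sum_comm]
      refine Finset.sum_congr rfl fun J _ => ?_
      rw [Int.cast_sum, Finset.mul_sum]
      simp only [Int.cast_mul]
      exact Finset.sum_congr rfl fun L _ => by ring
    rw [Finset.sum_eq_single (Jst k p) (fun J _ hJ => by rw [h0 J hJ]; simp) (by simp)] at h2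
    exact (mul_eq_zero.1 h2).resolve_right (by exact_mod_cast h1)
  have hve : v = ∑ J, c J • (fun L => ((cmp p (fun l j => z j l) L J : ℤ) : ℚ)) := by
    ext L; rw [hvc]; simp [Finset.sum_apply]
  rw [hve]
  refine Submodule.sum_mem _ fun J _ => ?_
  by_cases hJ : J = Jst k p
  · rw [hJ, hcst, zero_smul]; exact zero_mem _
  · exact Submodule.smul_mem _ _ (Submodule.subset_span ⟨J, hJ, rfl⟩)

end Sub

namespace Sub
open MvPolynomial NumberField

lemma det_cols {p : ℕ} (A : Matrix (Fin p) (Fin p) ℝ) (μ : Fin p → ℝ) (h : ∀ r c, |A r c| ≤ μ c) :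
    |A.det| ≤ p.factorial * ∏ c, μ c := by
  rw [Matrix.det_apply']
  refine (Finset.abs_sum_le_sum_abs _ _).trans ?_
  have : ∀ s ∈ (Finset.univ : Finset (Equiv.Perm (Fin p))), |((Equiv.Perm.sign s : ℤ) : ℝ) * ∏ i, A (s i) i| ≤ ∏ c, μ c := fun s _ => by
    have h1 : |((Equiv.Perm.sign s : ℤ) : ℝ)| = 1 := by
      rcases Int.units_eq_one_or (Equiv.Perm.sign s) with h | h <;> simp [h]
    rw [abs_mul, h1, one_mul, Finset.abs_prod]
    exact Finset.prod_le_prod (fun _ _ => abs_nonneg _) fun i _ => h _ _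
  refine (Finset.sum_le_card_nsmul _ _ _ this).trans (le_of_eq ?_)
  rw [Finset.card_univ, Fintype.card_perm, Fintype.card_fin, nsmul_eq_mul]

lemma fun_inv' {F : Type*} [Field F] {m : ℕ} (Z : Fin m → Fin m → F) (hZ : Matrix.det (Matrix.of Z) ≠ 0) :
    ∃ Y : Fin m → Fin m → F, ∀ i j, ∑ l, Y i l * Z l j = if i = j then 1 else 0 :=
  ⟨((Matrix.of Z)⁻¹ : Matrix _ _ F), fun i j => by
    rw [← Matrix.one_apply (n := Fin m) (α := F), ← Matrix.nonsing_inv_mul (Matrix.of Z) (isUnit_iff_ne_zero.2 hZ),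
      Matrix.mul_apply]; rfl⟩

lemma cmp_li {F : Type*} [Field F] {m p : ℕ} (M : Fin m → Fin m → F) (hM : Matrix.det (Matrix.of M) ≠ 0) :
    LinearIndependent F (fun J I : Wd m p => cmp p M I J) := by
  rw [Fintype.linearIndependent_iff]
  intro g hg J
  obtain ⟨Y, hY⟩ := fun_inv' M hM
  have h1 : ∀ I, ∑ J, g J * cmp p M I J = 0 := fun I => by simpa [Finset.sum_apply] using congrFun hg I
  have h2 : ∑ I, cmp p Y J I * ∑ J', g J' * cmp p M I J' = g J := by
    simp only [Finset.mul_sum]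
    rw [Finset.sum_comm]
    have : ∀ J', ∑ I, cmp p Y J I * (g J' * cmp p M I J') = g J' * (if J = J' then 1 else 0) := fun J' => by
      have := cmp_mul (p := p) Y M J J'
      simp only [hY, cmp_one, one_pow] at this
      rw [this, Finset.mul_sum]
      exact Finset.sum_congr rfl fun I _ => by ring
    simp [this]
  rw [← h2]
  simp [h1]

lemma en_le {k p : ℕ} (J : Wd (k + p) p) (r : Fin p) : (en J r : ℕ) ≤ k + r := by
  have hm : StrictMono (en J) := (Set.powersetCard.ofFinEmbEquiv.symm J).strictMono
  have : ∀ d : ℕ, ∀ r : Fin p, (r : ℕ) + d + 1 = p → (en J r : ℕ) ≤ k + r := by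
    intro d
    induction d with
    | zero => intro r hr; have := (en J r).2; omega
    | succ d ih =>
      intro r hr
      have h1 := ih ⟨r + 1, by omega⟩ (by simp; omega)
      have h2 : en J r < en J ⟨r + 1, by omega⟩ := hm (by rw [Fin.lt_def]; simp)
      rw [Fin.lt_def] at h2
      simp only at h1
      omega
  exact this (p - 1 - r) r (by have := r.2; omega)

lemma gapJ {k p : ℕ} (μ : Fin (k + p) → ℝ) (hμ : ∀ i, 0 < μ i) (hmono : Monotone μ) (G : ℝ)
    (hG : ∀ a b : Fin (k + p), (a : ℕ) < k → k ≤ (b : ℕ) → G * μ a ≤ μ b) (J : Wd (k + p) p) (hJ : J ≠ Jst k p) :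
    G * ∏ r, μ (en J r) ≤ ∏ r, μ (en (Jst k p) r) := by
  obtain ⟨r, hr⟩ := low_of_ne J hJ
  rw [← Finset.mul_prod_erase _ _ (Finset.mem_univ r), ← Finset.mul_prod_erase _ (fun r => μ (en (Jst k p) r)) (Finset.mem_univ r), ← mul_assoc]
  refine mul_le_mul (hG _ _ hr ?_) (Finset.prod_le_prod (fun _ _ => (hμ _).le) fun s _ => hmono ?_)
    (Finset.prod_nonneg fun _ _ => (hμ _).le) (hμ _).le
  · rw [en_Jst]; simp
  · rw [en_Jst, Fin.le_def]; simpa using en_le J s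

lemma stepP1 {k p : ℕ} (hk : 0 < k) (hp : 0 < p) : ∃ C : ℝ, 0 < C ∧ ∀ (B : Fin (k + p) → Fin (k + p) → ℝ)
    (hB : Matrix.det (Matrix.of B) ≠ 0)
    (y : Fin (k + p) → Fin (k + p) → ℤ) (hy : Matrix.det (Matrix.of y) ≠ 0) (μ : Fin (k + p) → ℝ)
    (hμ : ∀ i, 0 < μ i) (hmono : Monotone μ) (hBy : ∀ i j, |∑ l, B i l * (y j l : ℝ)| ≤ μ j) (G : ℝ) (hG1 : 1 < G)
    (hG : ∀ a b : Fin (k + p), (a : ℕ) < k → k ≤ (b : ℕ) → G * μ a ≤ μ b),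
    ∃ (t : Wd (k + p) p → ℝ) (Y : Fin (Fintype.card (Wd (k + p) p) - 1) → Wd (k + p) p → ℤ),
      (∀ I, ∃ J : Wd (k + p) p, t I = ∏ r, μ (en J r)) ∧ G * ∏ I, t I ≤ ∏ J : Wd (k + p) p, ∏ r, μ (en J r) ∧
      (∀ I j, |∑ L, cmp p B I L * (Y j L : ℝ)| ≤ C * t I) ∧
      Submodule.span ℤ (Set.range Y) =
        Submodule.span ℤ ((fun J L => cmp p (fun l j => y j l) L J) '' {J | J ≠ Jst k p}) := by
  classical
  set N := Fintype.card (Wd (k + p) p) with hN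
  refine ⟨(1 + 2 ^ N * N) * 2 ^ N * p.factorial, by positivity, ?_⟩
  intro B hB y hy μ hμ hmono hBy G hG1 hG
  set Λ : Wd (k + p) p → ℝ := fun J => ∏ r, μ (en J r) with hΛ
  have hΛ0 : ∀ J, 0 < Λ J := fun J => Finset.prod_pos fun _ _ => hμ _
  have hgap : ∀ J, J ≠ Jst k p → G * Λ J ≤ Λ (Jst k p) := fun J hJ => gapJ μ hμ hmono G hG J hJ
  obtain ⟨q, hq⟩ : ∃ q, N = q + 2 := by
    have : Nontrivial (Wd (k + p) p) := Set.powersetCard.nontrivial' hp (by simp; omega)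
    have : 1 < N := Fintype.one_lt_card
    exact ⟨N - 2, by omega⟩
  let e0 : Fin N ≃ Wd (k + p) p := (Fintype.equivFin _).symm
  let e : Fin N ≃ Wd (k + p) p := (Tuple.sort (Λ ∘ e0)).trans e0
  have he : Monotone (Λ ∘ e) := Tuple.monotone_sort (Λ ∘ e0)
  have hlast : ∀ l : Fin N, e l = Jst k p ↔ (l : ℕ) = q + 1 := by
    have h1 : e ⟨q + 1, by omega⟩ = Jst k p := by
      by_contra hne
      obtain ⟨l, hl⟩ := e.surjective (Jst k p)
      have h2 : Λ (e l) ≤ Λ (e ⟨q + 1, by omega⟩) := he (by rw [Fin.le_def]; have := l.2; simp; omega)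
      have h3 := hgap _ hne
      have := hΛ0 (e ⟨q + 1, by omega⟩)
      rw [hl] at h2
      nlinarith
    intro l
    rw [← h1, e.injective.eq_iff, Fin.ext_iff]
  let z : ℕ → Wd (k + p) p → ℤ := fun l => if h : l < N then fun L => cmp p (fun l j => y j l) L (e ⟨l, h⟩) else 0
  let Λs : ℕ → ℝ := fun l => if h : l < N then Λ (e ⟨l, h⟩) else 1
  have hΛs0 : ∀ l, 0 < Λs l := fun l => by dsimp only [Λs]; split_ifs; exacts [hΛ0 _, one_pos]
  have hΛsm : ∀ a b, a ≤ b → b < N → Λs a ≤ Λs b := fun a b hab hb => by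
    dsimp only [Λs]; rw [dif_pos hb, dif_pos (by omega)]; exact he (by simpa [Fin.le_def] using hab)
  let T : (Wd (k + p) p → ℤ) →+ (Wd (k + p) p → ℝ) :=
    { toFun := fun x I => ∑ L, cmp p B I L * (x L : ℝ)
      map_zero' := by ext I; simp
      map_add' := fun x x' => by ext I; simp [mul_add, Finset.sum_add_distrib] }
  let M : Fin (k + p) → Fin (k + p) → ℝ := fun i j => ∑ l, B i l * (y j l : ℝ)
  have hM : Matrix.det (Matrix.of M) ≠ 0 := by
    have : Matrix.of M = Matrix.of B * (Matrix.of fun l j => (y j l : ℝ)) := by ext i j; simp [M, Matrix.mul_apply]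
    rw [this, Matrix.det_mul]
    refine mul_ne_zero hB ?_
    have : Matrix.det (Matrix.of fun l j => (y j l : ℝ)) = ((Matrix.det (Matrix.of y) : ℤ) : ℝ) := by
      rw [← Matrix.det_transpose, ← eq_intCast (Int.castRingHom ℝ), RingHom.map_det]; rfl
    rw [this]; exact_mod_cast hy
  have hTz : ∀ l (h : l < N), T (z l) = fun I => cmp p M I (e ⟨l, h⟩) := fun l h => by
    ext I
    change ∑ L, cmp p B I L * (z l L : ℝ) = _
    dsimp only [z]
    rw [dif_pos h, show M = fun i j => ∑ l, B i l * (fun l j => (y j l : ℝ)) l j from rfl, cmp_mul]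
    refine Finset.sum_congr rfl fun L _ => ?_
    congr 1
    exact cmp_map (Int.castRingHom ℝ) (fun l j => y j l) L _
  have hli := cmp_li (p := p) M hM
  have hyN : ∀ l < N, T (z l) ∉ fl T z l := fun l hl hmem => by
    rw [hTz l hl] at hmem
    refine hli.notMem_span_image (s := {J | (e.symm J : ℕ) < l}) (x := e ⟨l, hl⟩) (by simp) ?_
    refine Submodule.span_mono ?_ hmem
    rintro _ ⟨l', hl', rfl⟩
    exact ⟨e ⟨l', lt_trans hl' hl⟩, by simpa using hl', (hTz l' _).symm⟩
  obtain ⟨r, hr⟩ := dav1 e.symm (fl T z) (fl_mono T z) (fl_rank T z)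
  obtain ⟨y', hy'1, hy'2⟩ := dav2 T z N rfl hyN r hr (fun l => p.factorial * Λs l) (fun l => by have := hΛs0 l; positivity)
    (fun a b hab hb => mul_le_mul_of_nonneg_left (hΛsm a b hab hb) (by positivity)) (fun l hl => by
      rw [hTz l hl, pi_norm_le_iff_of_nonneg (by have := hΛs0 l; positivity)]
      intro I
      rw [Real.norm_eq_abs]
      refine (det_cols _ (fun c => μ (en (e ⟨l, hl⟩) c)) fun s c => hBy _ _).trans (le_of_eq ?_)
      dsimp only [Λs]; rw [dif_pos hl])
  refine ⟨fun I => Λs (min (r I) q), fun j => y' j, fun I => ?_, ?_, fun I j => ?_, ?_⟩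
  · have : min (r I : ℕ) q < N := by omega
    refine ⟨e ⟨_, this⟩, ?_⟩
    dsimp only [Λs]; rw [dif_pos this]
  · have h1 : ∏ I, Λs (min (r I) q) = ∏ l ∈ Finset.range N, Λs (min l q) := by
      rw [← Fin.prod_univ_eq_prod_range (fun l => Λs (min l q)), ← Equiv.prod_comp r]
    have h2 : ∏ J : Wd (k + p) p, Λ J = ∏ l ∈ Finset.range N, Λs l := by
      rw [← Fin.prod_univ_eq_prod_range, ← Equiv.prod_comp e]
      exact Finset.prod_congr rfl fun l _ => by dsimp only [Λs]; rw [dif_pos l.2]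
    rw [h1, h2, hq, Finset.prod_range_succ, Finset.prod_range_succ _ (q + 1), Finset.prod_congr rfl (g := Λs) (fun l hl => by
      rw [min_eq_left (by rw [Finset.mem_range] at hl; omega)])]
    have h3 : G * Λs q ≤ Λs (q + 1) := by
      dsimp only [Λs]
      rw [dif_pos (by omega), dif_pos (by omega), (hlast ⟨q + 1, by omega⟩).2 rfl]
      exact hgap _ fun h => by simpa using (hlast ⟨q, by omega⟩).1 h
    rw [min_eq_right (by omega)]
    have := Finset.prod_pos (s := Finset.range (q + 1)) fun l _ => hΛs0 l
    nlinarith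
  · have hj : (j : ℕ) < N := by have := j.2; omega
    refine (hy'1 j hj I).trans ?_
    dsimp only
    rw [← mul_assoc]
    refine mul_le_mul_of_nonneg_left (hΛsm _ _ ?_ (by omega)) (by positivity)
    have := j.2; omega
  · have h1 : Set.range (fun j : Fin (N - 1) => y' j) = y' '' Set.Iio (N - 1) := by
      ext x; constructor
      · rintro ⟨j, rfl⟩; exact ⟨j, j.2, rfl⟩
      · rintro ⟨j, hj, rfl⟩; exact ⟨⟨j, hj⟩, rfl⟩
    rw [h1, hy'2 _ (by omega)]
    congr 1
    ext x; constructor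
    · rintro ⟨l, hl, rfl⟩
      rw [Set.mem_Iio] at hl
      refine ⟨e ⟨l, by omega⟩, fun h => ?_, ?_⟩
      · have := (hlast _).1 h; simp at this; omega
      · dsimp only [z]; rw [dif_pos (by omega)]
    · rintro ⟨J, hJ, rfl⟩
      refine ⟨e.symm J, ?_, ?_⟩
      · have h2 := mt (hlast (e.symm J)).2 (by simpa using hJ)
        have := (e.symm J).2
        rw [Set.mem_Iio]; omega
      · dsimp only [z]; rw [dif_pos (e.symm J).2]; simp

end Sub

namespace Sub
open MvPolynomial NumberField

lemma pos_lb {α : Type*} [Finite α] (P : α → ℝ → Prop) (hP : ∀ a, ∃ c, 0 < c ∧ P a c)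
    (hm : ∀ a c c', c' ≤ c → P a c → P a c') : ∃ c, 0 < c ∧ ∀ a, P a c := by
  choose c hc hPc using hP
  obtain ⟨d, hd, hd'⟩ : ∃ d, 0 < d ∧ ∀ a, d ≤ c a := by
    rcases isEmpty_or_nonempty α with h | h
    · exact ⟨1, one_pos, fun a => h.elim a⟩
    · obtain ⟨a, ha⟩ := Finite.exists_min c
      exact ⟨c a, hc a, ha⟩
  exact ⟨d, hd, fun a => hm a _ _ (hd' a) (hPc a)⟩

lemma det_norm {K : Type*} [Field K] (τ : K →+* ℂ) {p : ℕ} (M : Matrix (Fin p) (Fin p) (𝓞 K)) (X : ℝ)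
    (h : ∀ i j, ‖τ (M i j : K)‖ ≤ X) : ‖τ ((M.det : 𝓞 K) : K)‖ ≤ p.factorial * X ^ p := by
  have h1 : τ ((M.det : 𝓞 K) : K) = (M.map (fun x : 𝓞 K => τ (x : K))).det :=
    RingHom.map_det (τ.comp (algebraMap (𝓞 K) K)) M
  rw [h1]
  have := Matrix.det_le (A := M.map (fun x : 𝓞 K => τ (x : K))) (abv := IsAbsoluteValue.toAbsoluteValue (norm : ℂ → ℝ)) (x := X)
    (fun i j => h i j)
  simpa using this

lemma exp_f {R : Type*} [CommRing R] {m p : ℕ} (f : (Fin m → R) [⋀^Fin p]→ₗ[R] R) (E E' : Fin m → Fin m → R) (d : R)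
    (hE : ∀ i l, ∑ j, E' i j * E j l = if i = l then d else 0) (hf : ∀ I : Fin p → Fin m, f (fun r i => E' i (I r)) = 0)
    (x : Fin p → Fin m → R) : d ^ p * f x = 0 := by
  have h1 : (fun r => d • x r) = fun r => ∑ j, (∑ l, E j l * x r l) • (fun i => E' i j) := by
    ext r i
    simp only [Pi.smul_apply, smul_eq_mul, Finset.sum_apply, Finset.sum_mul]
    rw [Finset.sum_comm]
    have : ∀ l, ∑ j, E j l * x r l * E' i j = (if i = l then d else 0) * x r l := fun l => by
      rw [← hE, Finset.sum_mul]; exact Finset.sum_congr rfl fun j _ => by ring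
    simp [this]
  have h2 : f (fun r => d • x r) = d ^ p * f x := by
    have := f.toMultilinearMap.map_smul_univ (fun _ => d) x
    simpa using this
  rw [← h2, h1]
  have := f.toMultilinearMap.map_sum (fun r j => (∑ l, E j l * x r l) • (fun i => E' i j))
  rw [AlternatingMap.coe_multilinearMap] at this
  rw [this]
  refine Finset.sum_eq_zero fun I _ => ?_
  have := f.toMultilinearMap.map_smul_univ (fun r => ∑ l, E (I r) l * x r l) (fun r i => E' i (I r))
  rw [AlternatingMap.coe_multilinearMap] at this
  rw [this, hf, smul_zero]

lemma clearden {ι : Type*} [Fintype ι] [DecidableEq ι] (q : ι → ℤ) (a : ι) (ha : q a ≠ 0) (H : ℝ) (hH : 1 ≤ H)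
    (h : ∀ b, max |((q b / q a : ℚ).num : ℝ)| ((q b / q a : ℚ).den) ≤ H) :
    ∃ (D : ℤ) (Q : ι → ℤ), D ≠ 0 ∧ (∀ b, q a * Q b = D * q b) ∧ ∀ b, |(Q b : ℝ)| ≤ H ^ (Fintype.card ι) := by
  refine ⟨∏ b, ((q b / q a : ℚ).den : ℤ), fun b => (q b / q a : ℚ).num * ∏ b' ∈ Finset.univ.erase b, ((q b' / q a : ℚ).den : ℤ),
    Finset.prod_ne_zero_iff.2 fun b _ => by exact_mod_cast (q b / q a : ℚ).den_nz, fun b => ?_, fun b => ?_⟩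
  · rw [← Finset.mul_prod_erase _ _ (Finset.mem_univ b)]
    have h1 : (q a : ℤ) * (q b / q a : ℚ).num = (q b / q a : ℚ).den * q b := by
      have h2 := Rat.num_div_den (q b / q a : ℚ)
      have h3 : ((q b / q a : ℚ).den : ℚ) ≠ 0 := by exact_mod_cast (q b / q a : ℚ).den_nz
      have h4 : (q a : ℚ) ≠ 0 := by exact_mod_cast ha
      rw [div_eq_div_iff h3 h4] at h2
      have : (q a : ℚ) * (q b / q a : ℚ).num = (q b / q a : ℚ).den * q b := by linarith
      exact_mod_cast this
    linear_combination (∏ b' ∈ Finset.univ.erase b, ((q b' / q a : ℚ).den : ℤ)) * h1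
  · push_cast
    rw [abs_mul, Finset.abs_prod, ← Finset.card_univ, ← Finset.prod_const, ← Finset.mul_prod_erase _ _ (Finset.mem_univ b)]
    refine mul_le_mul ((le_max_left _ _).trans (h b)) (Finset.prod_le_prod (fun _ _ => abs_nonneg _) fun b' _ => ?_)
      (Finset.prod_nonneg fun _ _ => abs_nonneg _) (by linarith)
    rw [Nat.abs_cast]
    exact (le_max_right _ _).trans (h b')

lemma powev {R : Type*} [CommRing R] {m : ℕ} (A : Matrix (Fin m) (Fin m) R) (v : Fin m → R) (b : R)
    (h : A.mulVec v = b • v) (n : ℕ) : (A ^ n).mulVec v = b ^ n • v := by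
  induction n with
  | zero => simp
  | succ n ih => rw [pow_succ, ← Matrix.mulVec_mulVec, h, Matrix.mulVec_smul, ih, smul_smul, pow_succ']

lemma stepP2 {K : Type*} [Field K] [NumberField K] {k p : ℕ} (hp : 0 < p) (β : Fin (k + p) → 𝓞 K) (hβ : ∀ i, β i ≠ 0)
    (hru : ∀ i j, i ≠ j → ∀ e : ℕ, 0 < e → ((β i : K) / β j) ^ e ≠ 1) (A : Matrix (Fin (k + p)) (Fin (k + p)) ℤ)
    (hA : A.det ≠ 0) (E E' : Fin (k + p) → Fin (k + p) → 𝓞 K) (δ : ℕ) (hδ : 0 < δ)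
    (hE : ∀ i l, ∑ j, E' i j * E j l = if i = l then (δ : 𝓞 K) else 0)
    (hAE : ∀ i j, ∑ l, (A i l : 𝓞 K) * E' l j = β j * E' i j) (x0 : Fin (k + p) → ℤ)
    (hx0 : ∀ i, ∑ l, E i l * (x0 l : 𝓞 K) ≠ 0) : ∃ c1 ε0 : ℝ, 0 < c1 ∧ 0 < ε0 ∧ ∀ C0 : ℝ,
    {n : ℕ | ∃ y : Fin (k + p) → Fin (k + p) → ℤ, (∀ (i : Fin k) l, |(y (Fin.castAdd p i) l : ℝ)| ≤ C0 * Real.exp (ε0 * n)) ∧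
      Matrix.det (Matrix.of y) ≠ 0 ∧
      (∃ (d : ℤ) (c : Fin k → ℤ), d ≠ 0 ∧ ∀ l, d * x0 l = ∑ i, c i * y (Fin.castAdd p i) l) ∧
      ∀ a b, qv (fun i : Fin k => (A ^ n).mulVec (y (Fin.castAdd p i))) a ≠ 0 →
        max |((qv (fun i : Fin k => (A ^ n).mulVec (y (Fin.castAdd p i))) b / qv (fun i : Fin k => (A ^ n).mulVec (y (Fin.castAdd p i))) a : ℚ).num : ℝ)|
          ((qv (fun i : Fin k => (A ^ n).mulVec (y (Fin.castAdd p i))) b / qv (fun i : Fin k => (A ^ n).mulVec (y (Fin.castAdd p i))) a : ℚ).den)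
          ≤ Real.exp (c1 * n)}.Finite := by
  classical
  have hβK : ∀ i, (β i : K) ≠ 0 := fun i => by exact_mod_cast hβ i
  obtain ⟨c, hc, hH⟩ := pos_lb (α := {x : Fin (k + p) × Fin (k + p) // x.1 ≠ x.2}) (fun x c => ∀ (n : ℕ) (s t : 𝓞 K) (B : ℝ), t ≠ 0 →
      ((β x.1.1 : K) / β x.1.2) ^ n * t = s → (∀ τ : K →+* ℂ, ‖τ s‖ ≤ B) → (∀ τ : K →+* ℂ, ‖τ t‖ ≤ B) →
      Real.exp (c * n) ≤ B) (fun x => htlow _ (div_ne_zero (hβK _) (hβK _)) (hru _ _ x.2))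
    (fun x c c' hcc h n s t B ht hst hs hB => (Real.exp_le_exp.2 (by gcongr)).trans (h n s t B ht hst hs hB))
  obtain ⟨CE, hCE⟩ : ∃ CE : ℝ, ∀ x : (K →+* ℂ) × Fin (k + p) × Fin (k + p), ‖x.1 (E' x.2.1 x.2.2 : K)‖ ≤ CE := by
    obtain ⟨C, hC⟩ := (Set.finite_range fun x : (K →+* ℂ) × Fin (k + p) × Fin (k + p) => ‖x.1 (E' x.2.1 x.2.2 : K)‖).bddAbove
    exact ⟨C, fun x => hC ⟨x, rfl⟩⟩
  set N := Fintype.card (Wd (k + p) p) with hN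
  refine ⟨c / (4 * (N + 1)), c / (4 * (k + p)), by positivity, by positivity, fun C0 => ?_⟩
  set C : ℝ := max 1 (max CE C0)
  have hC1 : 1 ≤ C := le_max_left _ _
  set C2 : ℝ := (N * (p.factorial * C ^ p)) * ((k + p).factorial * C ^ (k + p))
  refine (Set.finite_Iic ⌊Real.log C2 * 2 / c⌋₊).subset ?_
  rintro n ⟨y, hyb, hdet, ⟨d, cc, hd, hcc⟩, hq⟩
  set z : Fin k → Fin (k + p) → ℤ := fun i => (A ^ n).mulVec (y (Fin.castAdd p i)) with hz
  set F0 := af (R := 𝓞 K) (fun (i : Fin k) l => (y (Fin.castAdd p i) l : 𝓞 K)) with hF0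
  let vv : Fin (k + p) → Fin (k + p) → 𝓞 K := fun j i => E' i j
  have hδK : (δ : 𝓞 K) ≠ 0 := by exact_mod_cast hδ.ne'
  obtain ⟨I, hI⟩ : ∃ I : Fin p → Fin (k + p), F0 (fun r => vv (I r)) ≠ 0 := by
    by_contra hcon
    push Not at hcon
    have h1 := exp_f F0 E E' δ hE hcon (fun r l => (y (Fin.natAdd k r) l : 𝓞 K))
    have h2 := (mul_eq_zero.1 h1).resolve_left (pow_ne_zero _ hδK)
    rw [hF0] at h2
    have h3 := af_map (Int.castRingHom (𝓞 K)) (fun (i : Fin k) l => y (Fin.castAdd p i) l) (fun r l => y (Fin.natAdd k r) l)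
    simp only [eq_intCast] at h3
    rw [h2, Int.cast_eq_zero, af_apply] at h3
    apply hdet
    rw [← h3]
    congr 1
    ext i j
    refine Fin.addCases (fun l => ?_) (fun l => ?_) i <;> simp
  let i0 : Fin p := ⟨0, hp⟩
  have hx : F0 (Function.update (fun r => vv (I r)) i0 (fun l => (x0 l : 𝓞 K))) = 0 := by
    have h1 : (d : 𝓞 K) • (fun l => (x0 l : 𝓞 K)) = ∑ i : Fin k, (cc i : 𝓞 K) • fun l => (y (Fin.castAdd p i) l : 𝓞 K) := by
      ext l
      have := congrArg (Int.cast (R := 𝓞 K)) (hcc l)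
      push_cast at this
      simp only [Pi.smul_apply, smul_eq_mul, Finset.sum_apply, this]
    have h2 : (d : 𝓞 K) • F0 (Function.update (fun r => vv (I r)) i0 (fun l => (x0 l : 𝓞 K))) = 0 := by
      rw [← AlternatingMap.map_update_smul, h1, AlternatingMap.map_update_sum]
      refine Finset.sum_eq_zero fun i _ => ?_
      rw [AlternatingMap.map_update_smul]
      have : F0 (Function.update (fun r => vv (I r)) i0 (fun l => (y (Fin.castAdd p i) l : 𝓞 K))) = 0 := by
        rw [hF0, af_apply]
        refine Matrix.det_zero_of_row_eq (i := Fin.castAdd p i) (j := Fin.natAdd k i0) ?_ ?_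
        · intro h; have := congrArg Fin.val h; simp at this; omega
        · refine funext fun l => ?_
          rw [Matrix.of_apply, Matrix.of_apply, app_upd, Function.update_self, Function.update_of_ne, Fin.append_left]
          intro h; have := congrArg Fin.val h; simp at this; omega
      rw [this, smul_zero]
    exact (smul_eq_zero.1 h2).resolve_left (by exact_mod_cast hd)
  obtain ⟨j, hj, hJ⟩ : ∃ j, j ≠ I i0 ∧ F0 (fun r => vv (Function.update I i0 j r)) ≠ 0 := by
    by_contra hcon
    push Not at hcon
    have h1 : (δ : 𝓞 K) • (fun l => (x0 l : 𝓞 K)) = ∑ j, (∑ l, E j l * (x0 l : 𝓞 K)) • vv j := by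
      ext i
      simp only [Pi.smul_apply, smul_eq_mul, Finset.sum_apply, Finset.sum_mul]
      rw [Finset.sum_comm]
      have : ∀ l, ∑ j, E j l * (x0 l : 𝓞 K) * vv j i = (if i = l then (δ : 𝓞 K) else 0) * (x0 l : 𝓞 K) := fun l => by
        rw [← hE, Finset.sum_mul]; exact Finset.sum_congr rfl fun j _ => by ring
      simp [this]
    have hupd : ∀ j, Function.update (fun r => vv (I r)) i0 (vv j) = fun r => vv (Function.update I i0 j r) := fun j => by
      ext r : 1
      rcases eq_or_ne r i0 with rfl | h
      · simp
      · simp [h]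
    have h2 : F0 (Function.update (fun r => vv (I r)) i0 ((δ : 𝓞 K) • fun l => (x0 l : 𝓞 K))) = 0 := by
      rw [AlternatingMap.map_update_smul, hx, smul_zero]
    rw [h1, AlternatingMap.map_update_sum, Finset.sum_eq_single (I i0)] at h2
    · rw [AlternatingMap.map_update_smul, hupd, Function.update_eq_self, smul_eq_mul] at h2
      exact (mul_ne_zero (hx0 _) hI) h2
    · intro j _ hj
      rw [AlternatingMap.map_update_smul, hupd, hcon j hj, smul_zero]
    · simp
  let AK : Matrix (Fin (k + p)) (Fin (k + p)) (𝓞 K) := A.map (Int.castRingHom (𝓞 K))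
  have hAv : ∀ j, AK.mulVec (vv j) = β j • vv j := fun j => by
    exact funext fun i => hAE i j
  have hrel : ∀ I : Fin p → Fin (k + p), (∏ r, β (I r) ^ n) * (∑ L, Matrix.det (fun r c => vv (I r) (en L c)) * (qv z L : 𝓞 K))
      = (A.det : 𝓞 K) ^ n * F0 (fun r => vv (I r)) := fun I => by
    have hdK : AK.det = (A.det : 𝓞 K) := ((Int.castRingHom (𝓞 K)).map_det A).symm
    have h1 := af_mul (AK ^ n) (fun (i : Fin k) l => (y (Fin.castAdd p i) l : 𝓞 K)) (fun r => vv (I r))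
    rw [Matrix.det_pow, hdK] at h1
    rw [hF0, ← h1, ← af_qv]
    have h2 : (fun i : Fin k => (AK ^ n).mulVec (fun l => (y (Fin.castAdd p i) l : 𝓞 K))) = fun i l => (z i l : 𝓞 K) := by
      ext i : 1
      have := (Int.castRingHom (𝓞 K)).map_mulVec (A ^ n) (y (Fin.castAdd p i))
      ext l : 1
      have h3 := this l
      rw [Matrix.map_pow] at h3
      exact h3.symm
    have h4 := (af (R := 𝓞 K) (fun (i : Fin k) l => (z i l : 𝓞 K))).toMultilinearMap.map_smul_univ (fun r => β (I r) ^ n) (fun r => vv (I r))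
    rw [AlternatingMap.coe_multilinearMap, smul_eq_mul] at h4
    rw [h2, ← h4]
    congr 1
    ext r : 1
    exact (powev AK _ _ (hAv _) n).symm
  have hqne : ∃ a, qv z a ≠ 0 := by
    by_contra hcon
    push Not at hcon
    have := hrel I
    simp only [hcon, Int.cast_zero, mul_zero, Finset.sum_const_zero] at this
    exact mul_ne_zero (pow_ne_zero _ (by exact_mod_cast hA)) hI this.symm
  obtain ⟨a, ha⟩ := hqne
  obtain ⟨D, Q, hD, hDQ, hQb⟩ := clearden (qv z) a ha _ (Real.one_le_exp (by positivity)) (fun b => hq a b ha)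
  let FF : (Fin p → Fin (k + p)) → 𝓞 K := fun I => ∑ L, Matrix.det (fun r c => vv (I r) (en L c)) * (Q L : 𝓞 K)
  have hFF : ∀ I, (qv z a : 𝓞 K) * ((∏ r, β (I r) ^ n) * FF I) = D * ((A.det : 𝓞 K) ^ n * F0 (fun r => vv (I r))) := fun I => by
    rw [← hrel I, mul_left_comm, mul_left_comm (D : 𝓞 K)]
    congr 1
    rw [Finset.mul_sum, Finset.mul_sum]
    refine Finset.sum_congr rfl fun L _ => ?_
    have := congrArg (Int.cast (R := 𝓞 K)) (hDQ L)
    push_cast at this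
    linear_combination Matrix.det (fun r c => vv (I r) (en L c)) * this
  have hDK : (D : 𝓞 K) ≠ 0 := by exact_mod_cast hD
  have hAK : (A.det : 𝓞 K) ^ n ≠ 0 := pow_ne_zero _ (by exact_mod_cast hA)
  have haK : (qv z a : 𝓞 K) ≠ 0 := by exact_mod_cast ha
  set J := Function.update I i0 j with hJd
  have hFI : FF I ≠ 0 := fun h => by
    have := hFF I
    rw [h, mul_zero, mul_zero] at this
    exact mul_ne_zero hDK (mul_ne_zero hAK hI) this.symm
  have hkey : β (I i0) ^ n * (FF I * F0 (fun r => vv (J r))) = β j ^ n * (FF J * F0 (fun r => vv (I r))) := by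
    have h1 := hFF I
    have h2 := hFF J
    rw [← Finset.mul_prod_erase _ _ (Finset.mem_univ i0)] at h1 h2
    have h3 : ∏ r ∈ Finset.univ.erase i0, β (J r) ^ n = ∏ r ∈ Finset.univ.erase i0, β (I r) ^ n :=
      Finset.prod_congr rfl fun r hr => by rw [hJd, Function.update_of_ne (Finset.ne_of_mem_erase hr)]
    have h4 : J i0 = j := by simp [hJd]
    rw [h3, h4] at h2
    have h5 : ∏ r ∈ Finset.univ.erase i0, β (I r) ^ n ≠ 0 := Finset.prod_ne_zero_iff.2 fun r _ => pow_ne_zero _ (hβ _)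
    refine mul_left_cancel₀ (mul_ne_zero (mul_ne_zero (mul_ne_zero haK h5) hDK) hAK) ?_
    linear_combination D * (A.det : 𝓞 K) ^ n * F0 (fun r => vv (J r)) * h1 - D * (A.det : 𝓞 K) ^ n * F0 (fun r => vv (I r)) * h2
  have he1 : ∀ (τ : K →+* ℂ) I, ‖τ ((FF I : 𝓞 K) : K)‖ ≤ N * (p.factorial * C ^ p) * Real.exp (c / (4 * (N + 1)) * n) ^ N := fun τ I => by
    have : τ ((FF I : 𝓞 K) : K) = ∑ L, τ ((Matrix.det (fun r c => vv (I r) (en L c)) : 𝓞 K) : K) * (Q L : ℂ) := by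
      simp only [FF, map_sum, map_mul, map_intCast]
    rw [this, mul_assoc]
    refine (norm_sum_le_of_le _ (f := _) (n := fun _ => (p.factorial * C ^ p) * Real.exp (c / (4 * (N + 1)) * n) ^ N) fun L _ => ?_).trans (le_of_eq ?_)
    · rw [norm_mul, Complex.norm_intCast]
      refine mul_le_mul (det_norm τ _ _ fun r c => ?_) (hQb L) (abs_nonneg _) (by positivity)
      exact (hCE (τ, _, _)).trans ((le_max_left _ _).trans (le_max_right _ _))
    · rw [Finset.sum_const, Finset.card_univ, nsmul_eq_mul]
  have he2 : ∀ (τ : K →+* ℂ) (I : Fin p → Fin (k + p)), ‖τ ((F0 (fun r => vv (I r)) : 𝓞 K) : K)‖ ≤ (k + p).factorial * (C * Real.exp (c / (4 * (k + p)) * n)) ^ (k + p) := fun τ I => by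
    rw [hF0, af_apply]
    refine det_norm τ _ _ fun i l => ?_
    have h1 : 1 ≤ Real.exp (c / (4 * (k + p)) * n) := Real.one_le_exp (by positivity)
    refine Fin.addCases (fun i => ?_) (fun i => ?_) i
    · simp only [Matrix.of_apply, Fin.append_left, map_intCast, Complex.norm_intCast]
      refine (hyb i l).trans (mul_le_mul_of_nonneg_right ((le_max_right _ _).trans (le_max_right _ _)) (by positivity))
    · simp only [Matrix.of_apply, Fin.append_right]
      refine (hCE (τ, _, _)).trans (((le_max_left _ _).trans (le_max_right _ _)).trans (le_mul_of_one_le_right (by positivity) h1))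
  have he3 : (N * (p.factorial * C ^ p) * Real.exp (c / (4 * (N + 1)) * n) ^ N) * ((k + p).factorial * (C * Real.exp (c / (4 * (k + p)) * n)) ^ (k + p))
      ≤ C2 * Real.exp (c / 2 * n) := by
    rw [mul_pow, ← Real.exp_nat_mul, ← Real.exp_nat_mul]
    have : Real.exp (N * (c / (4 * (N + 1)) * n)) * Real.exp ((k + p : ℕ) * (c / (4 * (k + p)) * n)) ≤ Real.exp (c / 2 * n) := by
      rw [← Real.exp_add, Real.exp_le_exp]
      have hkp : (0:ℝ) < k + p := by positivity
      have e1 : ((k + p : ℕ) : ℝ) * (c / (4 * (k + p)) * n) = c / 4 * n := by push_cast; field_simp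
      have e2 : (N : ℝ) * (c / (4 * (N + 1)) * n) ≤ c / 4 * n := by
        rw [show (N : ℝ) * (c / (4 * (N + 1)) * n) = (c / 4 * n) * (N / (N + 1)) by field_simp]
        refine mul_le_of_le_one_right (by positivity) ?_
        rw [div_le_one (by positivity)]; linarith
      linarith
    calc _ = C2 * (Real.exp (N * (c / (4 * (N + 1)) * n)) * Real.exp ((k + p : ℕ) * (c / (4 * (k + p)) * n))) := by simp only [C2]; ring
      _ ≤ _ := mul_le_mul_of_nonneg_left this (by positivity)
  have hbd : ∀ (τ : K →+* ℂ) (I J : Fin p → Fin (k + p)), ‖τ ((FF I * F0 (fun r => vv (J r)) : 𝓞 K) : K)‖ ≤ C2 * Real.exp (c / 2 * n) := fun τ I J => by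
    rw [show τ ((FF I * F0 (fun r => vv (J r)) : 𝓞 K) : K) = τ (FF I : K) * τ ((F0 (fun r => vv (J r)) : 𝓞 K) : K) from
      map_mul (τ.comp (algebraMap (𝓞 K) K)) _ _, norm_mul]
    exact (mul_le_mul (he1 τ I) (he2 τ J) (norm_nonneg _) (by positivity)).trans he3
  have hfin := hH ⟨(I i0, j), hj.symm⟩ n (FF J * F0 (fun r => vv (I r))) (FF I * F0 (fun r => vv (J r))) _ (mul_ne_zero hFI hJ) (by
    have := congrArg (algebraMap (𝓞 K) K) hkey
    rw [map_mul, map_mul (algebraMap (𝓞 K) K) (β j ^ n), map_pow, map_pow] at this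
    rw [div_pow, div_mul_eq_mul_div, div_eq_iff (pow_ne_zero _ (hβK _)), mul_comm _ ((β j : K) ^ n)]
    exact this) (fun τ => hbd τ _ _) (fun τ => hbd τ _ _)
  rw [Set.mem_Iic]
  apply Nat.le_floor
  rw [le_div_iff₀ hc]
  have hC20 : 0 < C2 := by
    by_contra h
    have := Real.exp_pos (c * n)
    have := Real.exp_pos (c / 2 * n)
    nlinarith
  have h1 : Real.exp (c / 2 * n) ≤ C2 := by
    have h2 := Real.exp_pos (c / 2 * n)
    have h3 : Real.exp (c * n) = Real.exp (c / 2 * n) * Real.exp (c / 2 * n) := by rw [← Real.exp_add]; congr 1; ring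
    rw [h3] at hfin
    exact le_of_mul_le_mul_right hfin h2
  have := (Real.le_log_iff_exp_le hC20).2 h1
  linarith

end Sub

namespace Sub
open MvPolynomial NumberField

/-- the scaled matrices -/
noncomputable def Bn {m : ℕ} (A : Matrix (Fin m) (Fin m) ℤ) (ρ : Fin m → Fin m → ℝ) (w : Fin m → ℝ) (n : ℕ) (i l : Fin m) : ℝ :=
  Real.exp (-(w i) * n) * ∑ j, ρ i j * ((A ^ n) j l : ℝ)

lemma Bn_det {m : ℕ} (A : Matrix (Fin m) (Fin m) ℤ) (ρ : Fin m → Fin m → ℝ) (w : Fin m → ℝ) (n : ℕ) :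
    Matrix.det (Matrix.of (Bn A ρ w n)) = Real.exp (-(∑ i, w i) * n) * (Matrix.det (Matrix.of ρ) * (A.det : ℝ) ^ n) := by
  have h1 : Matrix.of (Bn A ρ w n) = Matrix.diagonal (fun i => Real.exp (-(w i) * n)) * (Matrix.of ρ * (A ^ n).map (Int.castRingHom ℝ)) := by
    ext i l
    rw [Matrix.diagonal_mul, Matrix.mul_apply]; rfl
  have h2 : ((A ^ n).map (Int.castRingHom ℝ)).det = (A.det : ℝ) ^ n := by
    have := (RingHom.map_det (Int.castRingHom ℝ) (A ^ n)).symm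
    rw [Matrix.det_pow A] at this
    exact this.trans (map_pow (Int.castRingHom ℝ) _ _)
  rw [h1, Matrix.det_mul, Matrix.det_mul, Matrix.det_diagonal, ← Real.exp_sum, h2]
  congr 2
  rw [← Finset.sum_mul, Finset.sum_neg_distrib]

lemma cmp_row {R : Type*} [CommRing R] {m p : ℕ} (s : Fin m → R) (M : Fin m → Fin m → R) (I J : Wd m p) :
    cmp p (fun i l => s i * M i l) I J = (∏ r, s (en I r)) * cmp p M I J :=
  Matrix.det_mul_column (fun r => s (en I r)) (Matrix.of fun r c => M (en I r) (en J c))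

lemma EApow {R : Type*} [CommRing R] {m : ℕ} (A : Matrix (Fin m) (Fin m) ℤ) (E : Fin m → Fin m → R) (β : Fin m → R)
    (h : ∀ i l, ∑ j, E i j * (A j l : R) = β i * E i l) (n : ℕ) (i l : Fin m) :
    ∑ j, E i j * ((A ^ n) j l : R) = β i ^ n * E i l := by
  induction n generalizing l with
  | zero => simp [Matrix.one_apply]
  | succ n ih =>
    have : ∀ j, ((A ^ (n + 1)) j l : R) = ∑ t, ((A ^ n) j t : R) * (A t l : R) := fun j => by
      rw [pow_succ, Matrix.mul_apply]; push_cast; rfl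
    simp only [this, Finset.mul_sum]
    rw [Finset.sum_comm]
    have h2 : ∀ t, ∑ j, E i j * (((A ^ n) j t : R) * (A t l : R)) = β i ^ n * (E i t * (A t l : R)) := fun t => by
      rw [← mul_assoc, ← ih, Finset.sum_mul]; exact Finset.sum_congr rfl fun j _ => by ring
    simp only [h2]
    rw [← Finset.mul_sum, h]; ring

lemma step {K : Type*} [Field K] [NumberField K] (σ : K →+* ℂ) {k p : ℕ} (hk : 0 < k) (hp : 0 < p) (β : Fin (k + p) → 𝓞 K) (hβ : ∀ i, β i ≠ 0)
    (hru : ∀ i j, i ≠ j → ∀ e : ℕ, 0 < e → ((β i : K) / β j) ^ e ≠ 1) (A : Matrix (Fin (k + p)) (Fin (k + p)) ℤ)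
    (hA : A.det ≠ 0) (hdet : ∏ i, β i = (A.det : 𝓞 K)) (E E' P P' : Fin (k + p) → Fin (k + p) → 𝓞 K) (δ : ℕ) (hδ : 0 < δ)
    (hE : ∀ i l, ∑ j, E' i j * E j l = if i = l then (δ : 𝓞 K) else 0)
    (hP : ∀ i l, ∑ j, P' i j * P j l = if i = l then (δ : 𝓞 K) else 0)
    (hEA : ∀ i l, ∑ j, E i j * (A j l : 𝓞 K) = β i * E i l)
    (hAE : ∀ i j, ∑ l, (A i l : 𝓞 K) * E' l j = β j * E' i j) (x0 : Fin (k + p) → ℤ)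
    (hx0 : ∀ i, ∑ l, E i l * (x0 l : 𝓞 K) ≠ 0) (ρ : Fin (k + p) → Fin (k + p) → ℝ) (hρ : ∀ i l, σ (P i l : K) = ρ i l)
    (hρd : Matrix.det (Matrix.of ρ) ≠ 0) (w : Fin (k + p) → ℝ) (c : ℝ) (hw : ∑ i, w i = Real.log |(A.det : ℝ)| - c) :
    ∃ ε0 : ℝ, 0 < ε0 ∧ ∀ δ1 Bμ C0 C2 : ℝ, 0 < δ1 →
    {n : ℕ | ∃ (y : Fin (k + p) → Fin (k + p) → ℤ) (μ : Fin (k + p) → ℝ),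
      (∀ (i : Fin k) l, |(y (Fin.castAdd p i) l : ℝ)| ≤ C0 * Real.exp (ε0 * n)) ∧
      Matrix.det (Matrix.of y) ≠ 0 ∧
      (∃ (d : ℤ) (c : Fin k → ℤ), d ≠ 0 ∧ ∀ l, d * x0 l = ∑ i, c i * y (Fin.castAdd p i) l) ∧
      (∀ i, 0 < μ i) ∧ Monotone μ ∧ (∀ i j, |∑ l, Bn A ρ w n i l * (y j l : ℝ)| ≤ μ j) ∧
      (∀ a b : Fin (k + p), (a : ℕ) < k → k ≤ (b : ℕ) → Real.exp (δ1 * n) * μ a ≤ μ b) ∧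
      ∏ i, μ i ≤ C2 * Real.exp (c * n) ∧ ∀ i, |Real.log (μ i)| ≤ Bμ * n}.Finite := by
  classical
  obtain ⟨c1, ε0, hc1, hε0, hP2⟩ := stepP2 hp β hβ hru A hA E E' δ hδ hE hAE x0 hx0
  refine ⟨ε0, hε0, fun δ1 Bμ C0 C2 hδ1 => ?_⟩
  obtain ⟨C, hC, hP1⟩ := stepP1 hk hp
  set ch := (k + p - 1).choose (p - 1) with hch
  have : Nonempty (Wd (k + p) p) := ⟨Jst k p⟩
  have hcmpE : ∀ (X X' : Fin (k + p) → Fin (k + p) → 𝓞 K), (∀ i l, ∑ j, X' i j * X j l = if i = l then (δ : 𝓞 K) else 0) →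
      ∀ I L : Wd (k + p) p, ∑ J, cmp p X' I J * cmp p X J L = if I = L then ((δ ^ p : ℕ) : 𝓞 K) else 0 := fun X X' h I L => by
    rw [← cmp_mul]; simp only [h]; rw [cmp_one]; push_cast; rfl
  have hT := Tthm2 (J := Fin (Fintype.card (Wd (k + p) p) - 1)) σ (cmp p E) (cmp p E') (cmp p P) (cmp p P') (δ ^ p) (by positivity)
    (hcmpE _ _ hE) (hcmpE _ _ hP) (fun I => ∏ r, β (en I r)) (A.det ^ ch) (pow_ne_zero _ hA)
    (by rw [(wd_prod β).resolve_right hp.ne', hdet]; push_cast; rfl)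
    ((∑ i, |w i|) * p + p * Bμ) (δ1 / 2) (by positivity) C hC.le c1 hc1
  refine ((hT.union (hP2 C0)).union (Set.finite_Iic ⌊2 * (ch * Real.log C2) / δ1⌋₊)).subset ?_
  rintro n ⟨y, μ, hy1, hy2, hy3, hμ0, hμm, hBy, hgap, hprod, hlog⟩
  by_contra hcon
  simp only [Set.mem_union, not_or] at hcon
  obtain ⟨⟨hc1', hc2⟩, hc3⟩ := hcon
  rw [Set.mem_Iic, not_le] at hc3
  have hn0 : 0 < n := lt_of_le_of_lt (Nat.zero_le _) hc3
  have hnR : (0:ℝ) < n := by exact_mod_cast hn0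
  have hn : 2 * (ch * Real.log C2) / δ1 < n := Nat.lt_of_floor_lt hc3
  rw [div_lt_iff₀ hδ1] at hn
  set z : Fin (k + p) → Fin (k + p) → ℤ := fun i => (A ^ n).mulVec (y i) with hz
  have hab : ∃ a b, qv (fun i : Fin k => z (Fin.castAdd p i)) a ≠ 0 ∧
      Real.exp (c1 * n) ≤ max |((qv (fun i : Fin k => z (Fin.castAdd p i)) b / qv (fun i : Fin k => z (Fin.castAdd p i)) a : ℚ).num : ℝ)|
          ((qv (fun i : Fin k => z (Fin.castAdd p i)) b / qv (fun i : Fin k => z (Fin.castAdd p i)) a : ℚ).den) := by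
    by_contra h
    push Not at h
    exact hc2 ⟨y, hy1, hy2, hy3, fun a b ha => (h a b ha).le⟩
  obtain ⟨a, b, ha, hab⟩ := hab
  have hBd : Matrix.det (Matrix.of (Bn A ρ w n)) ≠ 0 := by
    rw [Bn_det]
    exact mul_ne_zero (Real.exp_pos _).ne' (mul_ne_zero hρd (pow_ne_zero _ (by exact_mod_cast hA)))
  obtain ⟨t, Y', ht, htG, hY', hspan⟩ := hP1 _ hBd y hy2 μ hμ0 hμm hBy _ (Real.one_lt_exp_iff.2 (by positivity : 0 < δ1 * n)) hgap
  have ht0 : ∀ I, 0 < t I := fun I => by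
    obtain ⟨J, hJ⟩ := ht I; rw [hJ]; exact Finset.prod_pos fun _ _ => hμ0 _
  refine hc1' ⟨fun I => ∑ r, w (en I r) + Real.log (t I) / n, fun I => ?_, ?_,
    fun j L => ∑ L', cmp p (fun i l => (A ^ n) i l) L L' * Y' j L', qv (fun i : Fin k => z (Fin.castAdd p i)), a, b, ha, ?_, fun I j => ?_, fun I j => ?_, hab⟩
  · refine (abs_add_le _ _).trans (add_le_add ?_ ?_)
    · refine (Finset.abs_sum_le_sum_abs _ _).trans ((Finset.sum_le_card_nsmul _ _ (∑ i, |w i|) fun r _ => ?_).trans (le_of_eq ?_))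
      · exact Finset.single_le_sum (f := fun i => |w i|) (fun _ _ => abs_nonneg _) (Finset.mem_univ _)
      · simp [mul_comm]
    · obtain ⟨J, hJ⟩ := ht I
      rw [hJ, Real.log_prod (fun r _ => (hμ0 _).ne'), abs_div, abs_of_pos hnR, div_le_iff₀ hnR]
      refine (Finset.abs_sum_le_sum_abs _ _).trans ((Finset.sum_le_card_nsmul _ _ (Bμ * n) fun r _ => hlog _).trans (le_of_eq ?_))
      simp [mul_assoc]
  · have h1 : ∑ I : Wd (k + p) p, ∑ r, w (en I r) = ch * ∑ i, w i := by
      have := (wd_prod (p := p) (fun i => Multiplicative.ofAdd (w i))).resolve_right hp.ne'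
      have h2 := congrArg Multiplicative.toAdd this
      simpa [toAdd_prod] using h2
    have h3 : ∑ I, Real.log (t I) = Real.log (∏ I, t I) := (Real.log_prod (fun I _ => (ht0 I).ne')).symm
    have hC2 : 0 < C2 := by
      have h5 := Finset.prod_pos fun i (_ : i ∈ Finset.univ) => hμ0 i
      by_contra h
      have := Real.exp_pos (c * n)
      nlinarith
    have h4 : δ1 * n + Real.log (∏ I, t I) ≤ ch * (Real.log C2 + c * n) := by
      have h5 := Finset.prod_pos fun i (_ : i ∈ Finset.univ) => hμ0 i
      rw [(wd_prod μ).resolve_right hp.ne'] at htG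
      have h6 := Real.log_le_log (mul_pos (Real.exp_pos _) (Finset.prod_pos fun I _ => ht0 I)) htG
      rw [Real.log_mul (Real.exp_pos _).ne' (Finset.prod_pos fun I _ => ht0 I).ne', Real.log_exp, Real.log_pow] at h6
      refine h6.trans (mul_le_mul_of_nonneg_left ?_ (by positivity))
      refine (Real.log_le_log h5 hprod).trans (le_of_eq ?_)
      rw [Real.log_mul hC2.ne' (Real.exp_pos _).ne', Real.log_exp]
    rw [Finset.sum_add_distrib, h1, ← Finset.sum_div, h3, hw]
    push_cast
    rw [abs_pow, Real.log_pow]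
    have h7 : Real.log (∏ I, t I) / n ≤ ch * c - δ1 / 2 := by
      rw [div_le_iff₀ hnR]; nlinarith
    linarith
  · intro v hv
    have hzd : Matrix.det (Matrix.of z) ≠ 0 := by
      have : Matrix.of z = Matrix.of y * (A ^ n).transpose := by
        ext i j; simp [-Matrix.transpose_pow, z, Matrix.mulVec, dotProduct, Matrix.mul_apply, mul_comm]
      rw [this, Matrix.det_mul, Matrix.det_transpose, Matrix.det_pow]
      exact mul_ne_zero hy2 (pow_ne_zero _ hA)
    have h1 := qker z hzd v hv
    let φ : (Wd (k + p) p → ℤ) →ₗ[ℤ] (Wd (k + p) p → ℚ) :=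
      { toFun := fun x L => ((∑ L', cmp p (fun i l => (A ^ n) i l) L L' * x L' : ℤ) : ℚ)
        map_add' := fun x x' => by ext L; simp [mul_add, Finset.sum_add_distrib]
        map_smul' := fun s x => by
          ext L; simp only [Pi.smul_apply, smul_eq_mul, RingHom.id_apply, zsmul_eq_mul]
          rw [← Int.cast_mul, Finset.mul_sum]; congr 1; exact Finset.sum_congr rfl fun _ _ => by ring }
    refine (Submodule.span_le.2 ?_) h1
    rintro _ ⟨J, hJ, rfl⟩
    have h2 : (fun L => cmp p (fun l j => y j l) L J) ∈ Submodule.span ℤ (Set.range Y') := by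
      rw [hspan]; exact Submodule.subset_span ⟨J, hJ, rfl⟩
    have h3 : Submodule.span ℤ (Set.range Y') ≤ ((Submodule.span ℚ (Set.range fun j => φ (Y' j))).restrictScalars ℤ).comap φ := by
      rw [Submodule.span_le]
      rintro _ ⟨j, rfl⟩
      exact Submodule.subset_span ⟨j, rfl⟩
    have h4 := h3 h2
    rw [Submodule.mem_comap, Submodule.restrictScalars_mem] at h4
    refine (congrArg (· ∈ Submodule.span ℚ (Set.range fun j => φ (Y' j))) (funext fun L => ?_ : _ = _)).mpr h4
    change _ = ((∑ L', cmp p (fun i l => (A ^ n) i l) L L' * cmp p (fun l j => y j l) L' J : ℤ) : ℚ)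
    rw [← cmp_mul]
    rfl
  · have h1 : ∑ L, cmp p E I L * ((∑ L', cmp p (fun i l => (A ^ n) i l) L L' * Y' j L' : ℤ) : 𝓞 K)
        = (∏ r, β (en I r)) ^ n * ∑ L', cmp p E I L' * (Y' j L' : 𝓞 K) := by
      have h2 : ∀ L', ∑ L, cmp p E I L * ((cmp p (fun i l => (A ^ n) i l) L L' : ℤ) : 𝓞 K) = (∏ r, β (en I r)) ^ n * cmp p E I L' := fun L' => by
        have h3 : ∀ L, ((cmp p (fun i l => (A ^ n) i l) L L' : ℤ) : 𝓞 K) = cmp p (fun i l => ((A ^ n) i l : 𝓞 K)) L L' := fun L =>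
          cmp_map (Int.castRingHom (𝓞 K)) _ L L'
        simp only [h3]
        rw [← cmp_mul]
        simp only [EApow A E β hEA n]
        rw [cmp_row, Finset.prod_pow]
      rw [Finset.mul_sum]
      simp only [← mul_assoc, ← h2, Finset.sum_mul]
      rw [Finset.sum_comm]
      refine Finset.sum_congr rfl fun L _ => ?_
      rw [Int.cast_sum, Finset.mul_sum]
      simp only [Int.cast_mul, mul_assoc]
    rw [h1]; exact Dvd.intro _ rfl
  · have h1 : σ ((∑ L, cmp p P I L * ((∑ L', cmp p (fun i l => (A ^ n) i l) L L' * Y' j L' : ℤ) : 𝓞 K) : 𝓞 K) : K)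
        = ((Real.exp ((∑ r, w (en I r)) * n) * ∑ L', cmp p (Bn A ρ w n) I L' * (Y' j L' : ℝ) : ℝ) : ℂ) := by
      have h2 : ∀ L', cmp p (Bn A ρ w n) I L' = Real.exp (-(∑ r, w (en I r)) * n) * ∑ L, cmp p ρ I L * ((cmp p (fun i l => (A ^ n) i l) L L' : ℤ) : ℝ) := fun L' => by
        have h3 : ∀ L, ((cmp p (fun i l => (A ^ n) i l) L L' : ℤ) : ℝ) = cmp p (fun i l => ((A ^ n) i l : ℝ)) L L' := fun L =>
          cmp_map (Int.castRingHom ℝ) _ L L'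
        simp only [h3]
        rw [← cmp_mul]
        have h4 := cmp_row (fun i => Real.exp (-(w i) * n)) (fun i l => ∑ j, ρ i j * ((A ^ n) j l : ℝ)) I L'
        rw [← Real.exp_sum, ← Finset.sum_mul, Finset.sum_neg_distrib] at h4
        exact h4
      have h5 : ∀ L, σ ((cmp p P I L : 𝓞 K) : K) = ((cmp p ρ I L : ℝ) : ℂ) := fun L => by
        have h6 := cmp_map (σ.comp (algebraMap (𝓞 K) K)) P I L
        have h7 := cmp_map Complex.ofRealHom ρ I L
        refine h6.trans (Eq.trans ?_ h7.symm)
        congr 1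
        ext i l
        exact hρ i l
      have h8 : Real.exp ((∑ r, w (en I r)) * n) * ∑ L', cmp p (Bn A ρ w n) I L' * (Y' j L' : ℝ)
          = ∑ L, cmp p ρ I L * ((∑ L', cmp p (fun i l => (A ^ n) i l) L L' * Y' j L' : ℤ) : ℝ) := by
        set W := ∑ r, w (en I r)
        simp only [h2, Int.cast_sum, Int.cast_mul, Finset.mul_sum, Finset.sum_mul]
        rw [Finset.sum_comm]
        refine Finset.sum_congr rfl fun L _ => Finset.sum_congr rfl fun L' _ => ?_
        have : Real.exp (W * n) * Real.exp (-W * n) = 1 := by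
          rw [← Real.exp_add]; simp
        linear_combination (cmp p ρ I L * ((cmp p (fun i l => (A ^ n) i l) L L' : ℤ) : ℝ) * (Y' j L' : ℝ)) * this
      rw [h8]
      have h9 : ∀ x : Wd (k + p) p → ℤ, σ ((∑ L, cmp p P I L * (x L : 𝓞 K) : 𝓞 K) : K) = ((∑ L, cmp p ρ I L * (x L : ℝ) : ℝ) : ℂ) := fun x => by
        rw [Complex.ofReal_sum]
        refine (map_sum (σ.comp (algebraMap (𝓞 K) K)) _ _).trans (Finset.sum_congr rfl fun L _ => ?_)
        rw [map_mul, map_intCast, Complex.ofReal_mul, ← h5, Complex.ofReal_intCast]; rfl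
      exact h9 _
    rw [h1, Complex.norm_real, Real.norm_eq_abs, abs_mul, abs_of_pos (Real.exp_pos _)]
    have h2 : Real.exp ((∑ r, w (en I r) + Real.log (t I) / n) * n) = Real.exp ((∑ r, w (en I r)) * n) * t I := by
      rw [add_mul, div_mul_cancel₀ _ hnR.ne', Real.exp_add, Real.exp_log (ht0 I)]
    rw [h2]
    calc _ ≤ Real.exp ((∑ r, w (en I r)) * n) * (C * t I) := mul_le_mul_of_nonneg_left (hY' I j) (Real.exp_pos _).le
      _ = _ := by ring

end Sub

namespace Sub
open MvPolynomial NumberField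

lemma step' {K : Type*} [Field K] [NumberField K] (σ : K →+* ℂ) {m : ℕ} (k : ℕ) (hk : 0 < k) (hkm : k < m) (β : Fin m → 𝓞 K) (hβ : ∀ i, β i ≠ 0)
    (hru : ∀ i j, i ≠ j → ∀ e : ℕ, 0 < e → ((β i : K) / β j) ^ e ≠ 1) (A : Matrix (Fin m) (Fin m) ℤ)
    (hA : A.det ≠ 0) (hdet : ∏ i, β i = (A.det : 𝓞 K)) (E E' P P' : Fin m → Fin m → 𝓞 K) (δ : ℕ) (hδ : 0 < δ)
    (hE : ∀ i l, ∑ j, E' i j * E j l = if i = l then (δ : 𝓞 K) else 0)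
    (hP : ∀ i l, ∑ j, P' i j * P j l = if i = l then (δ : 𝓞 K) else 0)
    (hEA : ∀ i l, ∑ j, E i j * (A j l : 𝓞 K) = β i * E i l)
    (hAE : ∀ i j, ∑ l, (A i l : 𝓞 K) * E' l j = β j * E' i j) (x0 : Fin m → ℤ)
    (hx0 : ∀ i, ∑ l, E i l * (x0 l : 𝓞 K) ≠ 0) (ρ : Fin m → Fin m → ℝ) (hρ : ∀ i l, σ (P i l : K) = ρ i l)
    (hρd : Matrix.det (Matrix.of ρ) ≠ 0) (w : Fin m → ℝ) (c : ℝ) (hw : ∑ i, w i = Real.log |(A.det : ℝ)| - c) :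
    ∃ ε0 : ℝ, 0 < ε0 ∧ ∀ δ1 Bμ C0 C2 : ℝ, 0 < δ1 → 0 ≤ C0 →
    {n : ℕ | ∃ (y : Fin m → Fin m → ℤ) (μ : Fin m → ℝ),
      (∀ (i : Fin m) l, (i : ℕ) < k → |(y i l : ℝ)| ≤ C0 * Real.exp (ε0 * n)) ∧
      Matrix.det (Matrix.of y) ≠ 0 ∧
      (∃ (d : ℤ) (c : Fin m → ℤ), d ≠ 0 ∧ (∀ i : Fin m, k ≤ (i : ℕ) → c i = 0) ∧ ∀ l, d * x0 l = ∑ i, c i * y i l) ∧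
      (∀ i, 0 < μ i) ∧ Monotone μ ∧ (∀ i j, |∑ l, Bn A ρ w n i l * (y j l : ℝ)| ≤ μ j) ∧
      (∀ a b : Fin m, (a : ℕ) < k → k ≤ (b : ℕ) → Real.exp (δ1 * n) * μ a ≤ μ b) ∧
      ∏ i, μ i ≤ C2 * Real.exp (c * n) ∧ ∀ i, |Real.log (μ i)| ≤ Bμ * n}.Finite := by
  obtain ⟨p, rfl⟩ : ∃ p, m = k + p := ⟨m - k, by omega⟩
  obtain ⟨ε0, h0, h⟩ := step σ hk (by omega : 0 < p) β hβ hru A hA hdet E E' P P' δ hδ hE hP hEA hAE x0 hx0 ρ hρ hρd w c hw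
  refine ⟨ε0, h0, fun δ1 Bμ C0 C2 hδ1 _ => (h δ1 Bμ C0 C2 hδ1).subset ?_⟩
  rintro n ⟨y, μ, h1, h2, ⟨d, cc, hd, hc0, hc⟩, h3⟩
  refine ⟨y, μ, fun i l => h1 _ l (by simp), h2, ⟨d, fun i => cc (Fin.castAdd p i), hd, fun l => ?_⟩, h3⟩
  rw [hc, Fin.sum_univ_add]
  rw [Finset.sum_eq_zero (s := Finset.univ) (f := fun i : Fin p => cc (Fin.natAdd k i) * y (Fin.natAdd k i) l) fun i _ => by
    rw [hc0 _ (by simp), zero_mul], add_zero]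

theorem core {K : Type*} [Field K] [NumberField K] (σ : K →+* ℂ) {m : ℕ} (hm : 0 < m) (β : Fin m → 𝓞 K) (hβ : ∀ i, β i ≠ 0)
    (hru : ∀ i j, i ≠ j → ∀ e : ℕ, 0 < e → ((β i : K) / β j) ^ e ≠ 1) (A : Matrix (Fin m) (Fin m) ℤ)
    (hA : A.det ≠ 0) (hdet : ∏ i, β i = (A.det : 𝓞 K)) (E E' P P' : Fin m → Fin m → 𝓞 K) (δ : ℕ) (hδ : 0 < δ)
    (hE : ∀ i l, ∑ j, E' i j * E j l = if i = l then (δ : 𝓞 K) else 0)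
    (hP : ∀ i l, ∑ j, P' i j * P j l = if i = l then (δ : 𝓞 K) else 0)
    (hEA : ∀ i l, ∑ j, E i j * (A j l : 𝓞 K) = β i * E i l)
    (hAE : ∀ i j, ∑ l, (A i l : 𝓞 K) * E' l j = β j * E' i j) (x0 : Fin m → ℤ)
    (hx0 : ∀ i, ∑ l, E i l * (x0 l : 𝓞 K) ≠ 0) (ρ : Fin m → Fin m → ℝ) (hρ : ∀ i l, σ (P i l : K) = ρ i l)
    (hρd : Matrix.det (Matrix.of ρ) ≠ 0) (w : Fin m → ℝ) (c : ℝ) (hc : 0 < c) (hw : ∑ i, w i = Real.log |(A.det : ℝ)| - c)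
    (C0 : ℝ) (hC0 : ∀ (n : ℕ) (x : Fin m → ℤ) (X : ℝ), (∀ i, |∑ l, Bn A ρ w n i l * (x l : ℝ)| ≤ X) → ∀ l, |(x l : ℝ)| ≤ C0 * X) (C1 : ℝ) :
    {n : ℕ | ∀ i, |∑ l, Bn A ρ w n i l * (x0 l : ℝ)| ≤ C1}.Finite := by
  classical
  obtain ⟨ε0, hε0, hS⟩ := pos_lb (α := {k : Fin m // 0 < (k : ℕ)}) _ (fun k => step' σ k.1 k.2 k.1.2 β hβ hru A hA hdet E E' P P' δ hδ hE hP hEA hAE x0 hx0 ρ hρ hρd w c hw)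
    (fun k e e' hee h δ1 Bμ C0 C2 hδ1 hC0 => (h δ1 Bμ C0 C2 hδ1 hC0).subset (by
      rintro n ⟨y, μ, h1, h2⟩
      exact ⟨y, μ, fun i l hi => (h1 i l hi).trans (by gcongr), h2⟩))
  have hmR : (0:ℝ) < m := by exact_mod_cast hm
  set ε := min ε0 (c / 2) / (m * m) with hε
  have hε1 : 0 < ε := by have := lt_min hε0 (half_pos hc); positivity
  have hεm : ε * m ≤ ε0 := by
    have h1 : ε * m = min ε0 (c / 2) / m := by rw [hε]; field_simp
    rw [h1, div_le_iff₀ hmR]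
    have : (1:ℝ) ≤ m := by exact_mod_cast hm
    have := min_le_left ε0 (c / 2)
    nlinarith
  have hεc : ε * m * m ≤ c / 2 := by
    have h1 : ε * m * m = min ε0 (c / 2) := by rw [hε]; field_simp
    rw [h1]; exact min_le_right _ _
  set CC := max 1 C0
  set C' := max 1 C1
  have hCC1 : 1 ≤ CC := le_max_left _ _
  have hC'1 : 1 ≤ C' := le_max_left _ _
  have hCX : ∀ (n : ℕ) (x : Fin m → ℤ) (X : ℝ), (∀ i, |∑ l, Bn A ρ w n i l * (x l : ℝ)| ≤ X) → ∀ l, |(x l : ℝ)| ≤ CC * X := fun n x X h l =>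
    (hC0 n x X h l).trans (mul_le_mul_of_nonneg_right (le_max_right _ _) ((abs_nonneg _).trans (h l)))
  set dρ := |Matrix.det (Matrix.of ρ)| with hdρ
  have hdρ0 : 0 < dρ := abs_pos.2 hρd
  set C2 := (2 ^ m * m + 1) ^ m * dρ with hC2
  have hC20 : 0 < C2 := by positivity
  set Bμ := Real.log CC + (|Real.log (C2 * CC ^ m)| + c) with hBμ
  set n0 := ⌊Real.log (m.factorial * C' ^ m / dρ) * 2 / c⌋₊
  refine ((Set.finite_Iic n0).union (Set.finite_iUnion fun k => hS k ε Bμ (CC * C') C2 hε1 (by positivity))).subset ?_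
  intro n hn
  rw [Set.mem_union, or_iff_not_imp_left]
  intro hn0
  rw [Set.mem_Iic, not_le] at hn0
  have hn1 : 0 < n := lt_of_le_of_lt (Nat.zero_le _) hn0
  have hnR : (1:ℝ) ≤ n := by exact_mod_cast hn1
  have hn0' := Nat.lt_of_floor_lt hn0
  let T : (Fin m → ℤ) → Fin m → ℝ := fun x i => ∑ l, Bn A ρ w n i l * (x l : ℝ)
  have hTn : ∀ x l, |(x l : ℝ)| ≤ CC * ‖T x‖ := fun x l => hCX n x _ (fun i => norm_le_pi_norm (T x) i) l
  have hBd : |Matrix.det (Matrix.of (Bn A ρ w n))| = dρ * Real.exp (c * n) := by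
    rw [Bn_det, abs_mul, abs_mul, abs_pow, hw, abs_of_pos (Real.exp_pos _)]
    have hdA : 0 < |(A.det : ℝ)| := abs_pos.2 (by exact_mod_cast hA)
    have : |(A.det : ℝ)| ^ n = Real.exp (Real.log |(A.det : ℝ)| * n) := by
      rw [mul_comm, Real.exp_nat_mul, Real.exp_log hdA]
    rw [this, mul_left_comm, ← Real.exp_add]
    congr 2; ring
  have hBd0 : Matrix.det (Matrix.of (Bn A ρ w n)) ≠ 0 := abs_pos.1 (by rw [hBd]; positivity)
  have hT0 : ∀ x, T x = 0 → x = 0 := fun x hx => by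
    ext l
    have := hTn x l
    rw [hx, norm_zero, mul_zero] at this
    exact_mod_cast abs_nonpos_iff.1 this
  have hspan : Submodule.span ℝ (Set.range T) = ⊤ := by
    rw [eq_top_iff]
    intro v _
    obtain ⟨Y, hY⟩ := fun_inv _ hBd0
    have : v = ∑ l, (∑ j, Y l j * v j) • T (Pi.single l 1) := by
      ext i
      have h1 : ∀ l, T (Pi.single l 1) i = Bn A ρ w n i l := fun l => by simp [T, Pi.single_apply]
      simp only [Finset.sum_apply, Pi.smul_apply, smul_eq_mul, h1, Finset.sum_mul]
      rw [Finset.sum_comm]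
      have h2 : ∀ j, ∑ l, Y l j * v j * Bn A ρ w n i l = (if i = j then 1 else 0) * v j := fun j => by
        rw [← hY, Finset.sum_mul]; exact Finset.sum_congr rfl fun l _ => by ring
      simp [h2]
    rw [this]
    exact Submodule.sum_mem _ fun l _ => Submodule.smul_mem _ _ (Submodule.subset_span ⟨_, rfl⟩)
  have hfin : ∀ c, {x | ‖T x‖ ≤ c}.Finite := fun c => by
    refine (Set.finite_Icc (fun _ : Fin m => -⌈CC * c⌉) (fun _ => ⌈CC * c⌉)).subset fun x hx => ?_
    have h1 : ∀ l, |(x l : ℝ)| ≤ (⌈CC * c⌉ : ℝ) := fun l =>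
      ((hTn x l).trans (mul_le_mul_of_nonneg_left hx (by positivity))).trans (Int.le_ceil _)
    exact ⟨fun l => by have := (abs_le.1 (h1 l)).1; exact_mod_cast this, fun l => by have := (abs_le.1 (h1 l)).2; exact_mod_cast this⟩
  obtain ⟨y, hy⟩ := minima T hspan hfin
  rw [Fintype.card_fin] at hy
  obtain ⟨r, hr⟩ := dav1 (Equiv.refl (Fin m)) (fl T y) (fl_mono T y) (fl_rank T y)
  obtain ⟨hl0, hlm, hlp⟩ := mink2 T y m (Fintype.card_fin m) hy r hr (dρ * Real.exp (c * n)) (fun e he h => by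
    rw [← hBd]
    exact minkbox _ hBd0 e he fun x hx => hT0 x (h x hx))
  rw [← mul_assoc] at hlp
  have hLI : LinearIndependent ℝ (fun l : Fin m => T (y l)) := by
    rw [linearIndependent_iff_card_eq_finrank_span, Fintype.card_fin]
    have := fl_rank_eq T y m (fun l hl => (hy l hl).1) m le_rfl
    have hset : Set.range (fun l : Fin m => T (y l)) = (fun l => T (y l)) '' Set.Iio m := by
      ext x; constructor
      · rintro ⟨l, rfl⟩; exact ⟨l, l.2, rfl⟩
      · rintro ⟨l, hl, rfl⟩; exact ⟨⟨l, hl⟩, rfl⟩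
    rw [Set.finrank, hset]; exact this.symm
  have hlc : ∀ l < m, 1 ≤ CC * ‖T (y l)‖ := fun l hl => by
    have h1 : y l ≠ 0 := fun h => by
      have := hl0 l hl
      have hT00 : T 0 = 0 := by ext i; simp [T]
      rw [h, hT00, norm_zero] at this
      exact lt_irrefl _ this
    obtain ⟨i, hi⟩ := Function.ne_iff.1 h1
    refine le_trans ?_ (hTn (y l) i)
    have : (1:ℤ) ≤ |y l i| := Int.one_le_abs hi
    exact_mod_cast this
  let Y : Matrix (Fin m) (Fin m) ℤ := Matrix.of fun j l => y j l
  have hTlin : ∀ (g : Fin m → ℝ) (x : Fin m → ℝ), (∀ l, x l = ∑ j, g j * (y j l : ℝ)) → (fun i => ∑ l, Bn A ρ w n i l * x l) = ∑ j, g j • T (y j) := fun g x h => by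
    ext i
    simp only [h, Finset.sum_apply, Pi.smul_apply, smul_eq_mul, T, Finset.mul_sum]
    rw [Finset.sum_comm]
    exact Finset.sum_congr rfl fun _ _ => Finset.sum_congr rfl fun _ _ => by ring
  have hYd : Y.det ≠ 0 := by
    intro h0
    obtain ⟨v, hv, hv0⟩ := Matrix.exists_vecMul_eq_zero_iff.2 h0
    have h1 := hTlin (fun j => (v j : ℝ)) 0 (fun l => by
      have := congrFun hv0 l
      simp only [Matrix.vecMul, dotProduct, Y, Matrix.of_apply, Pi.zero_apply] at this
      rw [Pi.zero_apply]
      exact_mod_cast this.symm)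
    have h2 := Fintype.linearIndependent_iff.1 hLI (fun j => (v j : ℝ)) (by rw [← h1]; ext; simp)
    exact hv (funext fun j => by exact_mod_cast h2 j)
  have hlow : dρ * Real.exp (c * n) ≤ m.factorial * ∏ l ∈ Finset.range m, ‖T (y l)‖ := by
    rw [← hBd, ← Fin.prod_univ_eq_prod_range (fun l => ‖T (y l)‖)]
    have h1 := det_cols (Matrix.of (Bn A ρ w n) * (Y.map (Int.castRingHom ℝ)).transpose) (fun j => ‖T (y j)‖) (fun i j => by
      refine le_trans (le_of_eq ?_) (norm_le_pi_norm (T (y j)) i)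
      rw [Real.norm_eq_abs, Matrix.mul_apply]; rfl)
    refine le_trans ?_ h1
    rw [Matrix.det_mul, Matrix.det_transpose, abs_mul]
    refine le_mul_of_one_le_right (abs_nonneg _) ?_
    have h2 : (Y.map (Int.castRingHom ℝ)).det = (Y.det : ℝ) := ((Int.castRingHom ℝ).map_det Y).symm
    rw [h2]
    exact_mod_cast Int.one_le_abs hYd
  have hex : ∃ k, k < m ∧ C' * Real.exp (ε * n * (k + 1)) < ‖T (y k)‖ := by
    by_contra hcon
    push Not at hcon
    have h1 : ∏ l ∈ Finset.range m, ‖T (y l)‖ ≤ ∏ l ∈ Finset.range m, C' * Real.exp (ε * n * m) :=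
      Finset.prod_le_prod (fun _ _ => norm_nonneg _) fun l hl => by
        rw [Finset.mem_range] at hl
        refine (hcon l hl).trans (mul_le_mul_of_nonneg_left (Real.exp_le_exp.2 ?_) (by positivity))
        have : (l : ℝ) + 1 ≤ m := by exact_mod_cast hl
        gcongr
    rw [Finset.prod_const, Finset.card_range, mul_pow, ← Real.exp_nat_mul] at h1
    have h2 : Real.exp (m * (ε * n * m)) ≤ Real.exp (c / 2 * n) := Real.exp_le_exp.2 (by nlinarith)
    have h3 : dρ * Real.exp (c * n) ≤ m.factorial * (C' ^ m * Real.exp (c / 2 * n)) :=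
      hlow.trans (mul_le_mul_of_nonneg_left (h1.trans (mul_le_mul_of_nonneg_left h2 (by positivity))) (by positivity))
    have h4 : Real.exp (c * n) = Real.exp (c / 2 * n) * Real.exp (c / 2 * n) := by rw [← Real.exp_add]; congr 1; ring
    have h5 : dρ * Real.exp (c / 2 * n) ≤ m.factorial * C' ^ m := by
      refine le_of_mul_le_mul_right ?_ (Real.exp_pos (c / 2 * n))
      rw [h4] at h3; linarith
    have h6 : Real.exp (c / 2 * n) ≤ m.factorial * C' ^ m / dρ := by
      rw [le_div_iff₀ hdρ0]; linarith
    have h7 := (Real.le_log_iff_exp_le (by positivity)).2 h6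
    rw [div_lt_iff₀ hc] at hn0'
    linarith
  set k := Nat.find hex with hkd
  obtain ⟨hkm, hk⟩ := Nat.find_spec hex
  have hmin : ∀ j < k, ‖T (y j)‖ ≤ C' * Real.exp (ε * n * (j + 1)) := fun j hj => by
    have := Nat.find_min hex hj
    push Not at this
    exact this (hj.trans hkm)
  have hx0T : ‖T x0‖ ≤ C' := by
    rw [pi_norm_le_iff_of_nonneg (by positivity)]
    exact fun i => (hn i).trans (le_max_right _ _)
  have hexp1 : ∀ j : ℕ, 1 ≤ Real.exp (ε * n * (j + 1)) := fun j => Real.one_le_exp (by positivity)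
  have hxfl : T x0 ∈ fl T y k := by
    by_contra h
    have h1 := (hy k hkm).2 x0 h
    have h2 : C' ≤ C' * Real.exp (ε * n * (k + 1)) := le_mul_of_one_le_right (by positivity) (hexp1 k)
    linarith
  have hk0 : 0 < k := by
    by_contra h
    have hk0 : k = 0 := by omega
    rw [hk0] at hxfl
    simp [fl] at hxfl
    have h2 := hT0 x0 hxfl
    refine hx0 ⟨0, hm⟩ ?_
    simp [h2]
  refine Set.mem_iUnion.2 ⟨⟨⟨k, hkm⟩, hk0⟩, fun j => y j, fun j => ‖T (y j)‖, fun i l hi => ?_, hYd, ?_, fun i => hl0 i i.2,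
    fun a b hab => hlm a b hab b.2, fun i j => norm_le_pi_norm (T (y j)) i, fun a b ha hb => ?_, ?_, fun i => ?_⟩
  · refine (hTn (y i) l).trans ?_
    rw [mul_assoc]
    refine mul_le_mul_of_nonneg_left ((hmin i hi).trans (mul_le_mul_of_nonneg_left (Real.exp_le_exp.2 ?_) (by positivity))) (by positivity)
    have h1 : ((i : ℕ) : ℝ) + 1 ≤ m := by exact_mod_cast i.2
    calc ε * n * ((i : ℕ) + 1) ≤ ε * n * m := by gcongr
      _ = ε * m * n := by ring
      _ ≤ _ := by gcongr
  · refine ⟨Y.det, Matrix.vecMul x0 Y.adjugate, hYd, ?_, ?_⟩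
    swap
    · intro l
      have h1 : Matrix.vecMul (Matrix.vecMul x0 Y.adjugate) Y = Y.det • x0 := by
        rw [Matrix.vecMul_vecMul, Matrix.adjugate_mul, Matrix.vecMul_smul, Matrix.vecMul_one]
      exact (congrFun h1 l).symm
    · intro i hi
      set cc := Matrix.vecMul x0 Y.adjugate
      have h1 : Matrix.vecMul cc Y = Y.det • x0 := by
        rw [Matrix.vecMul_vecMul, Matrix.adjugate_mul, Matrix.vecMul_smul, Matrix.vecMul_one]
      have h2 := hTlin (fun j => (cc j : ℝ)) (fun l => (Y.det : ℝ) * x0 l) (fun l => by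
        have := (congrFun h1 l).symm
        simp only [Matrix.vecMul, dotProduct, Y, Matrix.of_apply, Pi.smul_apply, smul_eq_mul] at this ⊢
        exact_mod_cast this)
      have h3 : (fun i => ∑ l, Bn A ρ w n i l * ((Y.det : ℝ) * x0 l)) = (Y.det : ℝ) • T x0 := by
        ext i
        simp only [Pi.smul_apply, smul_eq_mul, T, Finset.mul_sum]
        exact Finset.sum_congr rfl fun _ _ => by ring
      rw [fl, ← Finset.coe_range, Submodule.mem_span_image_finset_iff_exists_fun'] at hxfl
      obtain ⟨g, hg⟩ := hxfl
      have h4 : ∑ l : Fin m, (if (l : ℕ) < k then g l else 0) • T (y l) = T x0 := by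
        rw [← hg, Fin.sum_univ_eq_sum_range (fun l => (if l < k then g l else 0) • T (y l))]
        rw [← Finset.sum_subset (s₁ := Finset.range k) (by intro; simp; omega) (fun l _ hl => by
          rw [if_neg (by simpa using hl), zero_smul])]
        exact Finset.sum_congr rfl fun l hl => by rw [if_pos (by simpa using hl)]
      have h5 : ∑ j : Fin m, ((cc j : ℝ) - Y.det * (if (j : ℕ) < k then g j else 0)) • T (y j) = 0 := by
        simp only [sub_smul, Finset.sum_sub_distrib, mul_smul]
        rw [← Finset.smul_sum, h4, ← h2, h3, sub_self]
      have h6 := Fintype.linearIndependent_iff.1 hLI _ h5 i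
      rw [if_neg (by simpa using hi), mul_zero, sub_zero] at h6
      exact_mod_cast h6
  · simp only at ha hb
    have h1 := hlm k b hb b.2
    have h2 := hmin a ha
    have h3 : Real.exp (ε * n) * (C' * Real.exp (ε * n * ((a : ℕ) + 1))) ≤ C' * Real.exp (ε * n * (k + 1)) := by
      rw [mul_left_comm, ← Real.exp_add]
      refine mul_le_mul_of_nonneg_left (Real.exp_le_exp.2 ?_) (by positivity)
      have h4 : ((a : ℕ) : ℝ) + 1 ≤ k := by exact_mod_cast ha
      have h5 : 0 < ε * n := by positivity
      nlinarith
    have h4 := mul_le_mul_of_nonneg_left h2 (Real.exp_pos (ε * n)).le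
    linarith
  · rw [Fin.prod_univ_eq_prod_range (fun j => ‖T (y j)‖)]; exact hlp
  · have hp0 := hl0 i i.2
    have h1 : -(Real.log CC) ≤ Real.log ‖T (y i)‖ := by
      have := Real.log_le_log one_pos (hlc i i.2)
      rw [Real.log_one, Real.log_mul (by positivity) hp0.ne'] at this
      linarith
    have h2 : ‖T (y i)‖ ≤ C2 * CC ^ m * Real.exp (c * n) := by
      have h3 : ‖T (y i)‖ * ∏ l ∈ (Finset.range m).erase i, (1:ℝ) ≤ ‖T (y i)‖ * ∏ l ∈ (Finset.range m).erase i, (CC * ‖T (y l)‖) :=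
        mul_le_mul_of_nonneg_left (Finset.prod_le_prod (fun _ _ => zero_le_one) fun l hl => hlc l (by simpa using (Finset.mem_erase.1 hl).2)) hp0.le
      rw [Finset.prod_const_one, mul_one] at h3
      have h4 : ‖T (y i)‖ * ∏ l ∈ (Finset.range m).erase i, (CC * ‖T (y l)‖) ≤ ∏ l ∈ Finset.range m, (CC * ‖T (y l)‖) := by
        rw [← Finset.mul_prod_erase (Finset.range m) (fun l => CC * ‖T (y l)‖) (Finset.mem_range.2 i.2)]
        refine mul_le_mul_of_nonneg_right (le_mul_of_one_le_left hp0.le hCC1) (Finset.prod_nonneg fun _ _ => by positivity)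
      have h5 : ∏ l ∈ Finset.range m, (CC * ‖T (y l)‖) = CC ^ m * ∏ l ∈ Finset.range m, ‖T (y l)‖ := by
        rw [Finset.prod_mul_distrib, Finset.prod_const, Finset.card_range]
      rw [h5] at h4
      calc _ ≤ CC ^ m * ∏ l ∈ Finset.range m, ‖T (y l)‖ := h3.trans h4
        _ ≤ CC ^ m * (C2 * Real.exp (c * n)) := mul_le_mul_of_nonneg_left hlp (by positivity)
        _ = _ := by ring
    have h3 := Real.log_le_log hp0 h2
    rw [Real.log_mul (by positivity) (Real.exp_pos _).ne', Real.log_exp] at h3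
    have h4 := le_abs_self (Real.log (C2 * CC ^ m))
    have h5 := abs_nonneg (Real.log (C2 * CC ^ m))
    have h6 := Real.log_nonneg hCC1
    rw [abs_le, hBμ]
    have h7 := mul_le_mul_of_nonneg_left hnR h6
    have h8 := mul_le_mul_of_nonneg_left hnR h5
    have h9 := mul_le_mul_of_nonneg_left hnR hc.le
    constructor
    · linarith [add_mul (Real.log CC) (|Real.log (C2 * CC ^ m)| + c) n, add_mul (|Real.log (C2 * CC ^ m)|) c n]
    · linarith [add_mul (Real.log CC) (|Real.log (C2 * CC ^ m)| + c) n, add_mul (|Real.log (C2 * CC ^ m)|) c n]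

end Sub

namespace Sub
open MvPolynomial NumberField

lemma clr {K : Type*} [Field K] [NumberField K] {m : ℕ} (E P : Matrix (Fin m) (Fin m) (𝓞 K)) (hE : E.det ≠ 0) (hP : P.det ≠ 0) :
    ∃ (δ : ℕ) (E' P' : Matrix (Fin m) (Fin m) (𝓞 K)), 0 < δ ∧ E' * E = (δ : 𝓞 K) • 1 ∧ E * E' = (δ : 𝓞 K) • 1 ∧ P' * P = (δ : 𝓞 K) • 1 := by
  have hD : E.det * P.det ≠ 0 := mul_ne_zero hE hP
  obtain ⟨F, hF⟩ := Ideal.mem_span_singleton'.1 (Ideal.absNorm_mem (Ideal.span {E.det * P.det}))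
  refine ⟨Ideal.absNorm (Ideal.span {E.det * P.det}), (F * P.det) • E.adjugate, (F * E.det) • P.adjugate, Nat.pos_of_ne_zero fun h => ?_, ?_, ?_, ?_⟩
  · rw [Ideal.absNorm_eq_zero_iff, Ideal.span_singleton_eq_bot] at h; exact hD h
  · rw [← hF, Matrix.smul_mul, Matrix.adjugate_mul, smul_smul]; congr 1; ring
  · rw [← hF, Matrix.mul_smul, Matrix.mul_adjugate, smul_smul]; congr 1; ring
  · rw [← hF, Matrix.smul_mul, Matrix.adjugate_mul, smul_smul]; congr 1; ring

noncomputable def r0 {m : ℕ} (β : Fin m → ℂ) (i l : Fin m) : ℝ := 2 * ((β i ^ (l : ℕ)).re + (β i ^ (l : ℕ)).im)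

lemma r0_E {m : ℕ} (β : Fin m → ℂ) (κ : Fin m → Fin m) (hκ : ∀ i, β (κ i) = (starRingEnd ℂ) (β i)) (y : Fin m → ℝ) (i : Fin m) :
    4 * ∑ l : Fin m, β i ^ (l : ℕ) * (y l : ℂ) = (1 + Complex.I) * (∑ l, r0 β i l * y l : ℝ) + (1 - Complex.I) * (∑ l, r0 β (κ i) l * y l : ℝ) := by
  push_cast
  simp only [Finset.mul_sum, ← Finset.sum_add_distrib]
  refine Finset.sum_congr rfl fun l _ => ?_
  simp only [r0, hκ, ← map_pow, Complex.conj_re, Complex.conj_im]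
  apply Complex.ext <;> simp <;> ring

lemma r0_c {m : ℕ} (β : Fin m → ℂ) (κ : Fin m → Fin m) (hκ : ∀ i, β (κ i) = (starRingEnd ℂ) (β i)) (i l : Fin m) :
    ((r0 β i l : ℝ) : ℂ) = (1 - Complex.I) * β i ^ (l : ℕ) + (1 + Complex.I) * β (κ i) ^ (l : ℕ) := by
  rw [r0, hκ, ← map_pow]
  generalize β i ^ (l : ℕ) = z
  apply Complex.ext <;> simp <;> ring

lemma vinj {m : ℕ} (β : Fin m → ℂ) (hβ : Function.Injective β) (y : Fin m → ℂ) (h : ∀ i, ∑ l : Fin m, β i ^ (l : ℕ) * y l = 0) : y = 0 :=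
  Matrix.eq_zero_of_forall_index_sum_pow_mul_eq_zero hβ h

lemma r0_det {m : ℕ} (β : Fin m → ℂ) (hβ : Function.Injective β) (κ : Fin m → Fin m) (hκ : ∀ i, β (κ i) = (starRingEnd ℂ) (β i)) :
    Matrix.det (Matrix.of (r0 β)) ≠ 0 := by
  intro h
  obtain ⟨v, hv, hv0⟩ := Matrix.exists_mulVec_eq_zero_iff.2 h
  refine hv ?_
  have h1 : ∀ i, ∑ l, r0 β i l * v l = 0 := fun i => congrFun hv0 i
  have := vinj β hβ (fun l => (v l : ℂ)) fun i => by
    have := r0_E β κ hκ v i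
    rw [h1, h1] at this
    simpa using this
  ext l
  have := congrFun this l
  simpa using this

lemma conj_ix {m : ℕ} (β : Fin m → ℂ) (hβ : Function.Injective β) (a : Fin m → ℤ) (ha : ∀ i, β i ^ m = ∑ l : Fin m, (a l : ℂ) * β i ^ (l : ℕ)) (i : Fin m) :
    ∃ j, β j = (starRingEnd ℂ) (β i) := by
  by_contra hcon
  push Not at hcon
  let f : Fin (m + 1) → ℂ := Fin.cons ((starRingEnd ℂ) (β i)) β
  have hf : Function.Injective f := by
    rw [Fin.cons_injective_iff]
    exact ⟨fun ⟨j, hj⟩ => hcon j hj, hβ⟩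
  have hr : ∀ j, f j ^ m = ∑ l : Fin m, (a l : ℂ) * f j ^ (l : ℕ) := fun j => by
    refine Fin.cases ?_ (fun j => ?_) j
    · simp only [f, Fin.cons_zero]
      rw [← map_pow, ha, map_sum]
      exact Finset.sum_congr rfl fun l _ => by rw [map_mul, map_pow, map_intCast]
    · exact ha j
  have := Matrix.eq_zero_of_forall_index_sum_pow_mul_eq_zero hf (v := Fin.snoc (fun l => -(a l : ℂ)) 1) (fun j => by
    rw [Fin.sum_univ_castSucc]
    simp [hr j]
    rw [neg_add_eq_zero]
    exact Finset.sum_congr rfl fun _ _ => mul_comm _ _)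
  have := congrFun this (Fin.last m)
  simp at this

lemma r0_hC {m : ℕ} (β : Fin m → ℂ) (hβ : Function.Injective β) :
    ∃ C : ℝ, 0 ≤ C ∧ ∀ (x : Fin m → ℝ) X, (∀ i, ‖∑ l : Fin m, β i ^ (l : ℕ) * (x l : ℂ)‖ ≤ X) → ∀ l, |x l| ≤ C * X := by
  have hd : Matrix.det (Matrix.of fun (i l : Fin m) => β i ^ (l : ℕ)) ≠ 0 := Matrix.det_vandermonde_ne_zero_iff.2 hβ
  obtain ⟨Y, hY⟩ := fun_inv' _ hd
  refine ⟨∑ i, ∑ j, ‖Y i j‖, by positivity, fun x X h l => ?_⟩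
  have h1 : (x l : ℂ) = ∑ i, Y l i * ∑ j : Fin m, β i ^ (j : ℕ) * (x j : ℂ) := by
    simp only [Finset.mul_sum]
    rw [Finset.sum_comm]
    have : ∀ j : Fin m, ∑ i, Y l i * (β i ^ (j : ℕ) * (x j : ℂ)) = (if l = j then 1 else 0) * x j := fun j => by
      rw [← hY, Finset.sum_mul]; exact Finset.sum_congr rfl fun _ _ => by ring
    simp [this]
  rw [← Real.norm_eq_abs, ← Complex.norm_real, h1]
  calc _ ≤ ∑ i, ‖Y l i‖ * X := norm_sum_le_of_le _ fun i _ => by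
        rw [norm_mul]; exact mul_le_mul_of_nonneg_left (h i) (norm_nonneg _)
    _ = (∑ i, ‖Y l i‖) * X := by rw [Finset.sum_mul]
    _ ≤ _ := mul_le_mul_of_nonneg_right (Finset.single_le_sum (f := fun i => ∑ j, ‖Y i j‖) (fun _ _ => by positivity) (Finset.mem_univ l)) ((norm_nonneg _).trans (h l))

end Sub

namespace Sub
open MvPolynomial NumberField

lemma nfx (S : Set ℂ) (hf : S.Finite) (hS : ∀ x ∈ S, IsIntegral ℤ x) :
    ∃ (K : Type) (_ : Field K) (_ : NumberField K) (σ : K →+* ℂ), ∀ x ∈ S, ∃ b : 𝓞 K, σ (b : K) = x := by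
  have : Finite S := hf
  have : FiniteDimensional ℚ (IntermediateField.adjoin ℚ S) :=
    IntermediateField.finiteDimensional_adjoin fun x hx => (hS x hx).tower_top
  refine ⟨IntermediateField.adjoin ℚ S, inferInstance, NumberField.of_module_finite ℚ _, (IntermediateField.adjoin ℚ S).val, fun x hx => ?_⟩
  have hx' := IntermediateField.subset_adjoin ℚ S hx
  exact ⟨⟨⟨x, hx'⟩, (isIntegral_algHom_iff ((IntermediateField.adjoin ℚ S).val.restrictScalars ℤ) Subtype.val_injective).1 (hS x hx)⟩, rfl⟩

def cmA {m : ℕ} (a : Fin m → ℤ) : Matrix (Fin m) (Fin m) ℤ :=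
  Matrix.of fun j l => if (l : ℕ) + 1 < m then (if (j : ℕ) = l + 1 then 1 else 0) else a j

lemma cmA_E {m : ℕ} (a : Fin m → ℤ) (z : ℂ) (h : z ^ m = ∑ l : Fin m, (a l : ℂ) * z ^ (l : ℕ)) (l : Fin m) :
    ∑ j : Fin m, z ^ (j : ℕ) * ((cmA a j l : ℤ) : ℂ) = z * z ^ (l : ℕ) := by
  rw [← pow_succ']
  by_cases hl : (l : ℕ) + 1 < m
  · rw [Finset.sum_eq_single ⟨l + 1, hl⟩]
    · simp [cmA, hl]
    · intro j _ hj
      have : ¬ (j : ℕ) = l + 1 := fun h => hj (Fin.ext h)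
      simp [cmA, hl, this]
    · simp
  · have : (l : ℕ) + 1 = m := by omega
    rw [this, h]
    simp [cmA, hl, mul_comm]

lemma ix1 {m : ℕ} (β : Fin m → ℂ) (hβ : Function.Injective β) (κ : Fin m → Fin m) (hκ : ∀ i, β (κ i) = (starRingEnd ℂ) (β i))
    (cf : Fin m → ℂ) (hcf : ∀ i, cf i ≠ 0) (u : Fin m → ℝ) (hu : ∀ l : Fin m, (u l : ℂ) = ∑ i, cf i * β i ^ (l : ℕ)) (i0 : Fin m) :
    ∃ (d : Fin m → ℝ) (i1 : Fin m), (∀ l, u l = ∑ i, d i * r0 β i l) ∧ d i1 ≠ 0 ∧ ‖β i1‖ = ‖β i0‖ := by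
  obtain ⟨Y, hY⟩ := fun_inv' _ (r0_det β hβ κ hκ)
  set d : Fin m → ℝ := fun i => ∑ l, u l * Y l i with hd
  have hud : ∀ l, u l = ∑ i, d i * r0 β i l := fun l => by
    simp only [hd, Finset.sum_mul]
    rw [Finset.sum_comm]
    have : ∀ j, ∑ i, u j * Y j i * r0 β i l = u j * (if j = l then 1 else 0) := fun j => by
      rw [← hY, Finset.mul_sum]; exact Finset.sum_congr rfl fun _ _ => by ring
    simp [this]
  have hinv : Function.Involutive κ := fun i => hβ (by rw [hκ, hκ, Complex.conj_conj])
  have key : cf - (fun i => (1 - Complex.I) * d i + (1 + Complex.I) * d (κ i)) = 0 := by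
    refine Matrix.eq_zero_of_forall_pow_sum_mul_pow_eq_zero hβ fun l => ?_
    have h1 := hu l
    rw [hud l] at h1
    push_cast at h1
    simp only [r0_c β κ hκ, mul_add, Finset.sum_add_distrib] at h1
    rw [← Equiv.sum_comp hinv.toPerm (fun i => (d i : ℂ) * ((1 + Complex.I) * β (κ i) ^ (l : ℕ)))] at h1
    simp only [Function.Involutive.coe_toPerm, hinv _] at h1
    simp only [Pi.sub_apply, sub_mul, Finset.sum_sub_distrib, ← h1, ← Finset.sum_add_distrib]
    rw [sub_eq_zero]
    exact Finset.sum_congr rfl fun i _ => by ring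
  by_cases h0 : d i0 = 0
  · refine ⟨d, κ i0, hud, fun h1 => hcf i0 ?_, by rw [hκ, RCLike.norm_conj]⟩
    have := congrFun key i0
    simpa [h0, h1] using this
  · exact ⟨d, i0, hud, h0, rfl⟩

end Sub

namespace Sub
open MvPolynomial NumberField

theorem gt1 {m : ℕ} (β : Fin m → ℂ) (hβ : Function.Injective β) (hβ0 : ∀ i, β i ≠ 0)
    (hru : ∀ i j, i ≠ j → ∀ e : ℕ, 0 < e → (β i / β j) ^ e ≠ 1) (a : Fin m → ℤ)
    (ha : ∀ i, β i ^ m = ∑ l : Fin m, (a l : ℂ) * β i ^ (l : ℕ)) (cf : Fin m → ℂ) (hcf : ∀ i, cf i ≠ 0) (u : ℕ → ℤ)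
    (hu : ∀ n, (u n : ℂ) = ∑ i, cf i * β i ^ n) (i0 : Fin m) (hi0 : ∀ i, ‖β i‖ ≤ ‖β i0‖) (c : ℝ) (hc : 0 < c) :
    {n : ℕ | |(u n : ℝ)| ≤ ‖β i0‖ ^ n * Real.exp (-(c * n))}.Finite := by
  classical
  have hm : 0 < m := i0.pos
  choose κ hκ using conj_ix β hβ a ha
  obtain ⟨d, i1, hd, hd1, hi1⟩ := ix1 β hβ κ hκ cf hcf (fun l => (u l : ℝ)) (fun l => by push_cast; exact hu l) i0
  rw [← hi1] at hi0 ⊢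
  have hint : ∀ i, IsIntegral ℤ (β i) := fun i => by
    refine ⟨Polynomial.X ^ m - ∑ l : Fin m, Polynomial.C (a l) * Polynomial.X ^ (l : ℕ), Polynomial.monic_X_pow_sub (Polynomial.degree_sum_fin_lt a), ?_⟩
    simp only [Polynomial.eval₂_sub, Polynomial.eval₂_pow, Polynomial.eval₂_X, Polynomial.eval₂_finsetSum, Polynomial.eval₂_mul, Polynomial.eval₂_C, ha i]
    simp
  obtain ⟨K, _, _, σ, hK⟩ := nfx (insert Complex.I (Set.range β)) ((Set.finite_range β).insert _) (by
    rintro x (rfl | ⟨i, rfl⟩)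
    · exact Complex.isIntegral_int_I
    · exact hint i)
  obtain ⟨J, hJ⟩ := hK Complex.I (by simp)
  choose b hb using fun i => hK (β i) (by simp)
  let φ : 𝓞 K →+* ℂ := σ.comp (algebraMap (𝓞 K) K)
  have hφ : Function.Injective φ := σ.injective.comp (FaithfulSMul.algebraMap_injective _ _)
  have hφb : ∀ i, φ (b i) = β i := hb
  have hφJ : φ J = Complex.I := hJ
  set A := cmA a with hA
  have hEAc : ∀ i l, ∑ j : Fin m, β i ^ (j : ℕ) * (A j l : ℂ) = β i * β i ^ (l : ℕ) := fun i l => cmA_E a (β i) (ha i) l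
  let E : Fin m → Fin m → 𝓞 K := fun i l => b i ^ (l : ℕ)
  have hEA : ∀ i l, ∑ j, E i j * (A j l : 𝓞 K) = b i * E i l := fun i l => hφ (by
    simp only [E, map_sum, map_mul, map_pow, map_intCast, hφb]; exact hEAc i l)
  have hEd : (Matrix.of E).det ≠ 0 := fun h => by
    have h1 := congrArg φ h
    rw [RingHom.map_det, map_zero] at h1
    refine Matrix.det_vandermonde_ne_zero_iff.2 hβ (Eq.trans ?_ h1)
    congr 1; ext i l; simp [E, hφb, Matrix.vandermonde]
  have hdet : ∏ i, b i = (A.det : 𝓞 K) := by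
    have h1 : Matrix.of E * A.map (Int.castRingHom (𝓞 K)) = Matrix.diagonal b * Matrix.of E := by
      ext1 i l
      rw [Matrix.diagonal_mul, Matrix.mul_apply]; exact hEA i l
    have h2 := congrArg Matrix.det h1
    rw [Matrix.det_mul, Matrix.det_mul, Matrix.det_diagonal, mul_comm] at h2
    rw [← mul_right_cancel₀ hEd h2]
    exact (RingHom.map_det (Int.castRingHom (𝓞 K)) A).symm
  have hbβ : ∏ i, β i = (A.det : ℂ) := by
    have := congrArg φ hdet
    simpa only [map_prod, map_intCast, hφb] using this
  have hAd : A.det ≠ 0 := fun h => by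
    rw [h, Int.cast_zero, Finset.prod_eq_zero_iff] at hbβ
    obtain ⟨i, _, hi⟩ := hbβ; exact hβ0 i hi
  let ρ : Fin m → Fin m → ℝ := fun i l => if i = i1 then (u l : ℝ) else r0 β i l
  have hρd : Matrix.det (Matrix.of ρ) ≠ 0 := by
    have h1 : Matrix.of ρ = (Matrix.of (r0 β)).updateRow i1 (∑ k, d k • (Matrix.of (r0 β)) k) := by
      ext i l
      by_cases h : i = i1
      · subst h; simp [ρ, hd, Finset.sum_apply]
      · simp [ρ, h]
    rw [h1, Matrix.det_updateRow_sum]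
    exact mul_ne_zero hd1 (r0_det β hβ κ hκ)
  let P : Fin m → Fin m → 𝓞 K := fun i l => if i = i1 then (u l : 𝓞 K) else (1 - J) * b i ^ (l : ℕ) + (1 + J) * b (κ i) ^ (l : ℕ)
  have hφP : ∀ i l, φ (P i l) = ρ i l := fun i l => by
    by_cases h : i = i1
    · simp [P, ρ, h]
    · simp only [P, ρ, if_neg h, r0_c β κ hκ, map_add, map_mul, map_sub, map_one, map_pow, hφb, hφJ]
  have hPd : (Matrix.of P).det ≠ 0 := fun h => by
    have h1 := congrArg φ h
    rw [RingHom.map_det, map_zero] at h1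
    have h2 : (φ.mapMatrix (Matrix.of P)) = Complex.ofRealHom.mapMatrix (Matrix.of ρ) := by
      ext i l; exact hφP i l
    rw [h2, ← RingHom.map_det] at h1
    exact hρd (by simpa using h1)
  obtain ⟨δ, E', P', hδ, h1, h2, h3⟩ := clr (Matrix.of E) (Matrix.of P) hEd hPd
  have hsm : ∀ i l : Fin m, ((δ : 𝓞 K) • (1 : Matrix (Fin m) (Fin m) (𝓞 K))) i l = if i = l then (δ : 𝓞 K) else 0 := fun i l => by
    simp [Matrix.one_apply]
  have hAE : ∀ i j, ∑ l, (A i l : 𝓞 K) * E' l j = b j * E' i j := by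
    have hM : Matrix.of E * A.map (Int.castRingHom (𝓞 K)) = Matrix.diagonal b * Matrix.of E := by
      ext1 i l
      rw [Matrix.diagonal_mul, Matrix.mul_apply]; exact hEA i l
    have h4 : (δ : 𝓞 K) • (A.map (Int.castRingHom (𝓞 K)) * E') = (δ : 𝓞 K) • (E' * Matrix.diagonal b) := by
      calc _ = (E' * Matrix.of E) * (A.map (Int.castRingHom (𝓞 K)) * E') := by rw [h1]; simp
        _ = E' * (Matrix.of E * A.map (Int.castRingHom (𝓞 K))) * E' := by simp only [Matrix.mul_assoc]
        _ = E' * Matrix.diagonal b * (Matrix.of E * E') := by rw [hM]; simp only [Matrix.mul_assoc]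
        _ = _ := by rw [h2]; simp
    intro i j
    have h5 := congrFun (congrFun h4 i) j
    rw [Matrix.smul_apply, Matrix.smul_apply, smul_eq_mul, smul_eq_mul, Matrix.mul_diagonal] at h5
    have h6 := mul_left_cancel₀ (by exact_mod_cast hδ.ne') h5
    rw [mul_comm (b j), ← h6, Matrix.mul_apply]; rfl
  have hr : ∀ i, 0 < ‖β i‖ := fun i => norm_pos_iff.2 (hβ0 i)
  let w : Fin m → ℝ := fun i => Real.log ‖β i‖ - if i = i1 then c else 0
  have hw : ∑ i, w i = Real.log |(A.det : ℝ)| - c := by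
    simp only [w, Finset.sum_sub_distrib, Finset.sum_ite_eq', Finset.mem_univ, if_true]
    rw [← Real.log_prod (fun i _ => (hr i).ne'), ← norm_prod, hbβ, Complex.norm_intCast]
  have hew : ∀ i (n : ℕ), i ≠ i1 → Real.exp (w i * n) = ‖β i‖ ^ n := fun i n h => by
    simp only [w, if_neg h, sub_zero]
    rw [mul_comm, Real.exp_nat_mul, Real.exp_log (hr i)]
  have hew1 : ∀ n : ℕ, Real.exp (w i1 * n) = ‖β i1‖ ^ n * Real.exp (-(c * n)) := fun n => by
    simp only [w, if_true]
    rw [sub_mul, sub_eq_add_neg, Real.exp_add, mul_comm (Real.log _), Real.exp_nat_mul, Real.exp_log (hr i1)]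
  have hB : ∀ n (x : Fin m → ℤ) i, ∑ l, Bn A ρ w n i l * (x l : ℝ) = Real.exp (-(w i * n)) * ∑ j, ρ i j * ∑ l, ((A ^ n) j l : ℝ) * x l := fun n x i => by
    simp only [Bn, Finset.mul_sum, Finset.sum_mul]
    rw [Finset.sum_comm]
    exact Finset.sum_congr rfl fun _ _ => Finset.sum_congr rfl fun _ _ => by rw [neg_mul]; ring
  have hEn : ∀ n (x : Fin m → ℤ) i, ∑ j : Fin m, β i ^ (j : ℕ) * ((∑ l, ((A ^ n) j l : ℝ) * x l : ℝ) : ℂ) = β i ^ n * ∑ l : Fin m, β i ^ (l : ℕ) * ((x l : ℝ) : ℂ) := fun n x i => by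
    have h4 := EApow A (fun (i l : Fin m) => β i ^ (l : ℕ)) β hEAc n i
    push_cast
    simp only [Finset.mul_sum]
    rw [Finset.sum_comm]
    refine Finset.sum_congr rfl fun l _ => ?_
    rw [← mul_assoc, ← h4, Finset.sum_mul]
    exact Finset.sum_congr rfl fun _ _ => by ring
  have hI1 : ‖(1 : ℂ) + Complex.I‖ ≤ 2 := (norm_add_le _ _).trans (by norm_num)
  have hI2 : ‖(1 : ℂ) - Complex.I‖ ≤ 2 := (norm_sub_le _ _).trans (by norm_num)
  have hκn : ∀ i, ‖β (κ i)‖ = ‖β i‖ := fun i => by rw [hκ, RCLike.norm_conj]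
  obtain ⟨C, hC, hCx⟩ := r0_hC β hβ
  set C3 := max 1 ((1 + ∑ i, |d i|) / |d i1|) with hC3
  have hC0 : ∀ (n : ℕ) (x : Fin m → ℤ) (X : ℝ), (∀ i, |∑ l, Bn A ρ w n i l * (x l : ℝ)| ≤ X) → ∀ l, |(x l : ℝ)| ≤ C * C3 * X := by
    intro n x X hX l
    set y : Fin m → ℝ := fun j => ∑ l, ((A ^ n) j l : ℝ) * x l with hy
    have hX0 : 0 ≤ X := (abs_nonneg _).trans (hX i1)
    have h4 : ∀ i, |∑ j, ρ i j * y j| ≤ Real.exp (w i * n) * X := fun i => by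
      have := hX i
      rw [hB, abs_mul, Real.abs_exp, Real.exp_neg, inv_mul_le_iff₀ (Real.exp_pos _)] at this
      exact this
    have h5 : ∀ i, i ≠ i1 → |∑ j, r0 β i j * y j| ≤ ‖β i‖ ^ n * X := fun i hi => by
      have := h4 i
      simp only [ρ, if_neg hi] at this
      rwa [hew i n hi] at this
    have h6 : |∑ j : Fin m, (u j : ℝ) * y j| ≤ ‖β i1‖ ^ n * X := by
      have := h4 i1
      simp only [ρ, if_true] at this
      rw [hew1] at this
      refine this.trans (mul_le_mul_of_nonneg_right (mul_le_of_le_one_right (by positivity) (Real.exp_le_one_iff.2 ?_)) hX0)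
      have : 0 ≤ c * n := by positivity
      linarith
    have h7 : d i1 * ∑ j, r0 β i1 j * y j = ∑ j : Fin m, (u j : ℝ) * y j - ∑ i ∈ Finset.univ.erase i1, d i * ∑ j, r0 β i j * y j := by
      rw [eq_sub_iff_add_eq, Finset.add_sum_erase _ (fun i => d i * ∑ j, r0 β i j * y j) (Finset.mem_univ i1)]
      simp only [hd, Finset.mul_sum, Finset.sum_mul]
      rw [Finset.sum_comm]
      exact Finset.sum_congr rfl fun _ _ => Finset.sum_congr rfl fun _ _ => by ring
    have h8 : |d i1| * |∑ j, r0 β i1 j * y j| ≤ (1 + ∑ i, |d i|) * (‖β i1‖ ^ n * X) := by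
      rw [← abs_mul, h7, add_mul, one_mul]
      refine (abs_sub _ _).trans (add_le_add h6 ?_)
      refine (Finset.abs_sum_le_sum_abs _ _).trans ?_
      rw [Finset.sum_mul]
      refine (Finset.sum_le_sum fun i hi => ?_).trans (Finset.sum_le_sum_of_subset_of_nonneg (Finset.erase_subset _ _) fun i _ _ => by positivity)
      rw [abs_mul]
      refine mul_le_mul_of_nonneg_left ((h5 i (Finset.ne_of_mem_erase hi)).trans ?_) (abs_nonneg _)
      have := hi0 i
      gcongr
    have h9 : ∀ i, |∑ j, r0 β i j * y j| ≤ C3 * (‖β i‖ ^ n * X) := fun i => by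
      by_cases hi : i = i1
      · subst hi
        have : 0 < |d i| := abs_pos.2 hd1
        have h10 : |∑ j, r0 β i j * y j| ≤ (1 + ∑ i, |d i|) / |d i| * (‖β i‖ ^ n * X) := by
          rw [div_mul_eq_mul_div, le_div_iff₀ this]; linarith
        exact h10.trans (mul_le_mul_of_nonneg_right (le_max_right _ _) (by positivity))
      · exact (h5 i hi).trans (le_mul_of_one_le_left (by positivity) (le_max_left _ _))
    have h10 : ∀ i, ‖∑ l : Fin m, β i ^ (l : ℕ) * ((x l : ℝ) : ℂ)‖ ≤ C3 * X := fun i => by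
      have e1 := congrArg norm (r0_E β κ hκ y i)
      rw [hEn, norm_mul, norm_mul, norm_pow] at e1
      have e2 := norm_add_le ((1 + Complex.I) * ((∑ l, r0 β i l * y l : ℝ) : ℂ)) ((1 - Complex.I) * ((∑ l, r0 β (κ i) l * y l : ℝ) : ℂ))
      rw [norm_mul, norm_mul, Complex.norm_real, Complex.norm_real, Real.norm_eq_abs, Real.norm_eq_abs] at e2
      have e3 := mul_le_mul hI1 (h9 i) (abs_nonneg _) zero_le_two
      have e4 := mul_le_mul hI2 (h9 (κ i)) (abs_nonneg _) zero_le_two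
      rw [hκn] at e4
      rw [show ‖(4:ℂ)‖ = 4 by norm_num] at e1
      have e5 : ‖β i‖ ^ n * ‖∑ l : Fin m, β i ^ (l : ℕ) * ((x l : ℝ) : ℂ)‖ ≤ ‖β i‖ ^ n * (C3 * X) := by linarith
      exact le_of_mul_le_mul_left e5 (pow_pos (hr i) n)
    rw [mul_assoc]
    exact hCx (fun l => (x l : ℝ)) _ h10 l
  refine (core σ hm b (fun i h => hβ0 i (by rw [← hφb, h, map_zero])) (fun i j hij e he h => hru i j hij e he (by
      have := congrArg σ h
      rwa [map_pow, map_div₀, hb, hb, map_one] at this)) A hAd hdet E E' P P' δ hδ (fun i l => (congrFun (congrFun h1 i) l).trans (hsm i l))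
    (fun i l => (congrFun (congrFun h3 i) l).trans (hsm i l)) hEA hAE (Pi.single ⟨0, hm⟩ 1) (fun i => ?_) ρ hφP hρd w c hc hw (C * C3) hC0 4).subset ?_
  · simp [E, Pi.single_apply]
  · intro n hn i
    rw [hB]
    have hEx : ∀ i, ∑ l : Fin m, β i ^ (l : ℕ) * (((Pi.single (⟨0, hm⟩ : Fin m) (1 : ℤ) : Fin m → ℤ) l : ℝ) : ℂ) = 1 := fun i => by
      rw [Finset.sum_eq_single ⟨0, hm⟩ (fun j _ hj => by simp [Pi.single_apply, hj]) (by simp)]; simp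
    have hEn' := fun i => (hEn n (Pi.single ⟨0, hm⟩ 1) i).trans (by rw [hEx, mul_one])
    set y : Fin m → ℝ := fun j => ∑ l, ((A ^ n) j l : ℝ) * ((Pi.single (⟨0, hm⟩ : Fin m) (1 : ℤ) : Fin m → ℤ) l : ℝ) with hy
    rw [abs_mul, Real.abs_exp, Real.exp_neg, inv_mul_le_iff₀ (Real.exp_pos _)]
    by_cases hi : i = i1
    · subst hi
      simp only [ρ, if_true]
      have h4 : ∑ j : Fin m, (u j : ℝ) * y j = u n := by
        have : ((∑ j : Fin m, (u j : ℝ) * y j : ℝ) : ℂ) = ((u n : ℝ) : ℂ) := by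
          push_cast
          simp only [hu, Finset.sum_mul]
          rw [Finset.sum_comm]
          refine Finset.sum_congr rfl fun i _ => ?_
          rw [← hEn' i, Finset.mul_sum]
          exact Finset.sum_congr rfl fun _ _ => by ring
        exact_mod_cast this
      rw [h4, hew1]
      have : |(u n : ℝ)| ≤ ‖β i‖ ^ n * Real.exp (-(c * n)) := hn
      have h5 := (abs_nonneg _).trans this
      linarith
    · simp only [ρ, if_neg hi]
      rw [hew i n hi]
      have h4 : ((∑ j, r0 β i j * y j : ℝ) : ℂ) = (1 - Complex.I) * β i ^ n + (1 + Complex.I) * β (κ i) ^ n := by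
        push_cast
        simp only [r0_c β κ hκ]
        rw [← hEn' i, ← hEn' (κ i), Finset.mul_sum, Finset.mul_sum, ← Finset.sum_add_distrib]
        exact Finset.sum_congr rfl fun _ _ => by ring
      rw [← Real.norm_eq_abs, ← Complex.norm_real, h4]
      refine (norm_add_le _ _).trans ?_
      rw [norm_mul, norm_mul, norm_pow, norm_pow, hκn]
      have h5 : 0 ≤ ‖β i‖ ^ n := by positivity
      linarith [mul_le_mul_of_nonneg_right hI1 h5, mul_le_mul_of_nonneg_right hI2 h5]

end Sub

namespace Sub
open MvPolynomial NumberField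

lemma ratrec {m : ℕ} (β : Fin m → ℂ) (hβ : Function.Injective β) (cf : Fin m → ℂ) (hcf : ∀ i, cf i ≠ 0) (u : ℕ → ℤ)
    (hu : ∀ n, (u n : ℂ) = ∑ i, cf i * β i ^ n) : ∃ b : Fin m → ℚ, ∀ i, β i ^ m = ∑ l : Fin m, (b l : ℂ) * β i ^ (l : ℕ) := by
  obtain ⟨Y, hY⟩ := fun_inv (fun i l : Fin m => β i ^ (l : ℕ)) (Matrix.det_vandermonde_ne_zero_iff.2 hβ)
  set k : Fin m → ℂ := fun l => ∑ j, Y l j * β j ^ m with hk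
  have hk1 : ∀ i, β i ^ m = ∑ l : Fin m, k l * β i ^ (l : ℕ) := fun i => by
    simp only [hk, Finset.sum_mul]
    rw [Finset.sum_comm]
    have : ∀ j, ∑ l : Fin m, Y l j * β j ^ m * β i ^ (l : ℕ) = (if i = j then 1 else 0) * β j ^ m := fun j => by
      rw [← hY, Finset.sum_mul]; exact Finset.sum_congr rfl fun _ _ => by ring
    simp [this]
  have hswap : ∀ (g : Fin m → ℂ) (n : ℕ), ∑ l : Fin m, g l * (u (n + l) : ℂ) = ∑ i, cf i * (∑ l : Fin m, g l * β i ^ (l : ℕ)) * β i ^ n := fun g n => by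
    simp only [hu, Finset.mul_sum, Finset.sum_mul]
    rw [Finset.sum_comm]
    exact Finset.sum_congr rfl fun _ _ => Finset.sum_congr rfl fun _ _ => by rw [pow_add]; ring
  have hrec : ∀ n, (u (n + m) : ℂ) = ∑ l : Fin m, k l * u (n + l) := fun n => by
    rw [hswap, hu]
    exact Finset.sum_congr rfl fun i _ => by rw [← hk1, pow_add]; ring
  obtain ⟨π, hπ⟩ := LinearMap.exists_leftInverse_of_injective (Algebra.linearMap ℚ ℂ) (LinearMap.ker_eq_bot.2 (algebraMap ℚ ℂ).injective)
  have hπ1 : ∀ q : ℚ, π (q : ℂ) = q := fun q => by simpa using LinearMap.congr_fun hπ q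
  have hπm : ∀ (z : ℂ) (t : ℤ), π (z * t) = π z * t := fun z t => by
    rw [mul_comm, ← zsmul_eq_mul, map_zsmul, zsmul_eq_mul, mul_comm]
  refine ⟨fun l => π (k l), fun i => ?_⟩
  have hz : (fun i => cf i * (β i ^ m - ∑ l : Fin m, ((π (k l) : ℚ) : ℂ) * β i ^ (l : ℕ))) = 0 := by
    refine Matrix.eq_zero_of_forall_pow_sum_mul_pow_eq_zero hβ fun n => ?_
    have h1 := congrArg π (hrec n)
    rw [map_sum] at h1
    simp only [hπm] at h1
    have h2 : π ((u (n + m) : ℤ) : ℂ) = (u (n + m) : ℚ) := by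
      have := hπ1 (u (n + m)); simpa using this
    rw [h2] at h1
    have h3 : (u (n + m) : ℂ) = ∑ l : Fin m, ((π (k l) : ℚ) : ℂ) * u (n + l) := by
      have := congrArg (Rat.cast (K := ℂ)) h1
      push_cast at this; exact this
    rw [hswap, hu, ← sub_eq_zero, ← Finset.sum_sub_distrib] at h3
    rw [← h3]
    exact Finset.sum_congr rfl fun i _ => by rw [pow_add]; ring
  have := congrFun hz i
  simpa [hcf i, sub_eq_zero] using this

theorem gt2 {m : ℕ} (hm : 0 < m) (β : Fin m → ℂ) (hβ : Function.Injective β) (hβ0 : ∀ i, β i ≠ 0)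
    (hru : ∀ i j, i ≠ j → ∀ e : ℕ, 0 < e → (β i / β j) ^ e ≠ 1) (cf : Fin m → ℂ) (hcf : ∀ i, cf i ≠ 0) (u : ℕ → ℤ)
    (hu : ∀ n, (u n : ℂ) = ∑ i, cf i * β i ^ n) (hu0 : ∀ n, u n ≠ 0) : ∃ L, Tendsto (fun n : ℕ => Real.log |(u n : ℝ)| / n) atTop (nhds L) := by
  obtain ⟨b, hb⟩ := ratrec β hβ cf hcf u hu
  have : Nonempty (Fin m) := ⟨⟨0, hm⟩⟩
  obtain ⟨i0, hi0⟩ := Finite.exists_max (fun i => ‖β i‖)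
  set D : ℕ := ∏ l, (b l).den with hD
  have hD0 : 0 < D := Finset.prod_pos fun l _ => (b l).den_pos
  have hDC : (D : ℂ) ≠ 0 := by exact_mod_cast hD0.ne'
  have ht : ∀ l, ∃ t : ℤ, (b l : ℂ) * D = t := fun l => by
    obtain ⟨e, he⟩ := Finset.dvd_prod_of_mem (fun l => (b l).den) (Finset.mem_univ l)
    refine ⟨(b l).num * e, ?_⟩
    have h1 : b l * D = (((b l).num * e : ℤ) : ℚ) := by
      have h2 := Rat.mul_den_eq_num (b l)
      rw [hD, he]; push_cast; rw [← mul_assoc, h2]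
    have := congrArg (Rat.cast (K := ℂ)) h1
    push_cast at this ⊢; exact this
  choose t ht using ht
  have hR : 0 < ‖β i0‖ := norm_pos_iff.2 (hβ0 i0)
  have hup : ∀ n, 0 < |(u n : ℝ)| := fun n => abs_pos.2 (by exact_mod_cast hu0 n)
  have hDR : (0:ℝ) < D := by exact_mod_cast hD0
  have key : ∀ c : ℝ, 0 < c → ∀ᶠ n : ℕ in atTop, ‖β i0‖ ^ n * Real.exp (-(c * n)) < |(u n : ℝ)| := fun c hc => by
    have := gt1 (fun i => (D : ℂ) * β i) (fun i j h => hβ (mul_left_cancel₀ hDC h)) (fun i => mul_ne_zero hDC (hβ0 i))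
      (fun i j hij e he h => hru i j hij e he (by rwa [mul_div_mul_left _ _ hDC] at h)) (fun l => t l * D ^ (m - 1 - l))
      (fun i => by
        rw [mul_pow, hb, Finset.mul_sum]
        refine Finset.sum_congr rfl fun l _ => ?_
        push_cast
        rw [← ht, mul_pow]
        have : (D : ℂ) ^ m = D * D ^ (m - 1 - (l : ℕ)) * D ^ (l : ℕ) := by
          rw [← pow_succ', ← pow_add]; congr 1; omega
        rw [this]; ring) cf hcf (fun n => D ^ n * u n) (fun n => by
        push_cast
        rw [hu, Finset.mul_sum]
        exact Finset.sum_congr rfl fun i _ => by rw [mul_pow]; ring) i0 (fun i => by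
        rw [norm_mul, norm_mul]; exact mul_le_mul_of_nonneg_left (hi0 i) (norm_nonneg _)) c hc
    have h2 := this.eventually_cofinite_notMem
    rw [Nat.cofinite_eq_atTop] at h2
    filter_upwards [h2] with n hn
    rw [not_le, norm_mul, mul_pow, Complex.norm_natCast, mul_assoc] at hn
    push_cast at hn
    rw [abs_mul, abs_of_pos (pow_pos hDR n)] at hn
    exact lt_of_mul_lt_mul_left hn (by positivity)
  refine ⟨Real.log ‖β i0‖, tendsto_order.2 ⟨fun a ha => ?_, fun a ha => ?_⟩⟩
  · filter_upwards [key (Real.log ‖β i0‖ - a) (by linarith), eventually_gt_atTop 0] with n hn hn0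
    have hnR : (0:ℝ) < n := by exact_mod_cast hn0
    have h1 := Real.log_lt_log (by positivity) hn
    rw [Real.log_mul (by positivity) (Real.exp_pos _).ne', Real.log_pow, Real.log_exp] at h1
    rw [lt_div_iff₀ hnR]
    linarith [sub_mul (Real.log ‖β i0‖) a n]
  · set C := ∑ i, ‖cf i‖ with hC
    have hC0 : 0 < C := Finset.sum_pos (fun i _ => norm_pos_iff.2 (hcf i)) Finset.univ_nonempty
    filter_upwards [(tendsto_const_div_atTop_nhds_zero_nat (Real.log C)).eventually_lt_const (show (0:ℝ) < a - Real.log ‖β i0‖ by linarith), eventually_gt_atTop 0] with n hn hn0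
    have hnR : (0:ℝ) < n := by exact_mod_cast hn0
    have h1 : |(u n : ℝ)| ≤ C * ‖β i0‖ ^ n := by
      rw [← Complex.norm_intCast, hu, hC, Finset.sum_mul]
      refine norm_sum_le_of_le _ fun i _ => ?_
      rw [norm_mul, norm_pow]
      have := hi0 i
      gcongr
    have h2 := Real.log_le_log (hup n) h1
    rw [Real.log_mul hC0.ne' (by positivity), Real.log_pow] at h2
    rw [div_lt_iff₀ hnR] at hn ⊢
    linarith [sub_mul a (Real.log ‖β i0‖) n]

end Sub

namespace Sub

lemma qex (S : Finset ℂ) : ∃ q : ℕ, 0 < q ∧ ∀ s ∈ S, ∀ t ∈ S, (∃ e : ℕ, 0 < e ∧ (s / t) ^ e = 1) → (s / t) ^ q = 1 := by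
  classical
  have : ∀ x : ℂ × ℂ, ∃ e : ℕ, 0 < e ∧ ((∃ e : ℕ, 0 < e ∧ (x.1 / x.2) ^ e = 1) → (x.1 / x.2) ^ e = 1) := fun x => by
    by_cases h : ∃ e : ℕ, 0 < e ∧ (x.1 / x.2) ^ e = 1
    · obtain ⟨e, he, h1⟩ := h; exact ⟨e, he, fun _ => h1⟩
    · exact ⟨1, one_pos, fun h' => absurd h' h⟩
  choose e he h using this
  refine ⟨∏ x ∈ S ×ˢ S, e x, Finset.prod_pos fun x _ => he x, fun s hs t ht hst => ?_⟩
  obtain ⟨d, hd⟩ := Finset.dvd_prod_of_mem e (Finset.mem_product.2 ⟨hs, ht⟩ : (s, t) ∈ S ×ˢ S)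
  rw [hd, pow_mul, h (s, t) hst, one_pow]

lemma cls (S : Finset ℂ) (h0 : (0:ℂ) ∉ S) (b : ℂ → ℂ) (a : ℕ → ℕ) (hpos : ∀ n, 1 ≤ n → 0 < a n)
    (ha : ∀ n, 1 ≤ n → (a n : ℂ) = ∑ s ∈ S, b s * s ^ n) (q : ℕ) (hq : 0 < q)
    (hS : ∀ s ∈ S, ∀ t ∈ S, (∃ e : ℕ, 0 < e ∧ (s / t) ^ e = 1) → (s / t) ^ q = 1) (r : ℕ) :
    ∃ L, Tendsto (fun n : ℕ => Real.log (a (q * n + r + 1)) / ((q * n + r + 1 : ℕ) : ℝ)) atTop (nhds L) := by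
  classical
  set C : ℂ → ℂ := fun v => ∑ s ∈ S with s ^ q = v, b s * s ^ (r + 1) with hC
  set T := (S.image (fun s => s ^ q)).filter (fun v => C v ≠ 0) with hT
  have hTS : ∀ v ∈ T, ∃ s ∈ S, s ^ q = v := fun v hv => by
    simpa using (Finset.mem_filter.1 hv).1
  have hn : ∀ n, (a (q * n + r + 1) : ℂ) = ∑ v ∈ T, C v * v ^ n := fun n => by
    rw [ha _ (by omega), hT, Finset.sum_filter_of_ne (fun v _ h => left_ne_zero_of_mul h),
      ← Finset.sum_fiberwise_of_maps_to (g := fun s => s ^ q) (t := S.image fun s => s ^ q) (fun s hs => Finset.mem_image_of_mem _ hs)]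
    refine Finset.sum_congr rfl fun v _ => ?_
    rw [hC, Finset.sum_mul]
    refine Finset.sum_congr rfl fun s hs => ?_
    rw [← (Finset.mem_filter.1 hs).2, ← pow_mul, add_assoc, pow_add]; ring
  let e := T.equivFin.symm
  have hm : 0 < T.card := by
    rw [Finset.card_pos, Finset.nonempty_iff_ne_empty]
    intro h
    have h1 := hn 0
    rw [h, Finset.sum_empty] at h1
    exact (hpos (q * 0 + r + 1) (by omega)).ne' (by exact_mod_cast h1)
  have hne : ∀ v ∈ T, v ≠ 0 := fun v hv h => by
    obtain ⟨s, hs, hsv⟩ := hTS v hv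
    rw [h] at hsv
    exact h0 (pow_eq_zero_iff hq.ne' |>.1 hsv ▸ hs)
  obtain ⟨L, hL⟩ := gt2 hm (fun i => (e i : ℂ)) (fun i j h => e.injective (Subtype.ext h)) (fun i => hne _ (e i).2)
    (fun i j hij k hk h => by
      obtain ⟨s, hs, hsv⟩ := hTS _ (e i).2
      obtain ⟨t, ht, htv⟩ := hTS _ (e j).2
      rw [← hsv, ← htv, ← div_pow, ← pow_mul] at h
      have h1 := hS s hs t ht ⟨q * k, Nat.mul_pos hq hk, h⟩
      rw [div_pow, hsv, htv, div_eq_one_iff_eq (hne _ (e j).2)] at h1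
      exact hij (e.injective (Subtype.ext h1))) (fun i => C (e i)) (fun i => (Finset.mem_filter.1 (e i).2).2)
    (fun n => (a (q * n + r + 1) : ℤ)) (fun n => by
      rw [Equiv.sum_comp e (fun v : T => C v * (v : ℂ) ^ n), Finset.sum_coe_sort T (fun v => C v * v ^ n), ← hn]; simp)
    (fun n => by exact_mod_cast (hpos (q * n + r + 1) (by omega)).ne')
  have hqR : (q : ℝ) ≠ 0 := by exact_mod_cast hq.ne'
  have h1 : Tendsto (fun n : ℕ => (q : ℝ) + ((r : ℝ) + 1) / n) atTop (nhds q) := by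
    simpa using tendsto_const_nhds.add (tendsto_const_div_atTop_nhds_zero_nat ((r : ℝ) + 1))
  refine ⟨L / q, (hL.div h1 hqR).congr' ?_⟩
  filter_upwards [eventually_gt_atTop 0] with n hn0
  have hnR : (n : ℝ) ≠ 0 := by exact_mod_cast hn0.ne'
  have h2 : (q : ℝ) * n + r + 1 ≠ 0 := by positivity
  have h3 : |(((a (q * n + r + 1) : ℕ) : ℤ) : ℝ)| = a (q * n + r + 1) := by simp
  simp only [Pi.div_apply]
  rw [h3]
  push_cast
  rw [div_div]
  congr 1
  field_simp
  ring

lemma fincl (F : ℕ → ℝ) (q : ℕ) (hq : 0 < q) (h : ∀ r, ∃ L, Tendsto (fun n : ℕ => F (q * n + r + 1)) atTop (nhds L)) :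
    {L : ℝ | MapClusterPt L atTop F}.Finite := by
  choose l hl using h
  refine ((Finset.range q).finite_toSet.image l).subset fun L hL => ?_
  by_contra hcon
  set Λ := l '' (Finset.range q : Set ℕ) with hΛ
  have hfin : Λ.Finite := (Finset.range q).finite_toSet.image l
  obtain ⟨U, V, hU, hV, hΛU, hLV, hUV⟩ := normal_separation hfin.isClosed (isClosed_singleton (x := L)) (by simpa using hcon)
  have h1 : ∀ᶠ n : ℕ in atTop, ∀ r ∈ Finset.range q, F (q * n + r + 1) ∈ U := by
    rw [Filter.eventually_all_finset]
    exact fun r hr => (hl r).eventually (hU.mem_nhds (hΛU ⟨r, hr, rfl⟩))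
  obtain ⟨N0, hN0⟩ := eventually_atTop.1 h1
  have h2 : ∀ᶠ N : ℕ in atTop, F N ∈ U := by
    filter_upwards [eventually_ge_atTop (q * (N0 + 1) + 1)] with N hN
    have h3 := hN0 ((N - 1) / q) (by rw [Nat.le_div_iff_mul_le hq]; nlinarith [Nat.le_sub_of_add_le hN]) ((N - 1) % q) (Finset.mem_range.2 (Nat.mod_lt _ hq))
    rw [Nat.div_add_mod] at h3
    rwa [Nat.sub_add_cancel (by omega)] at h3
  have h3 : ∃ᶠ N in atTop, F N ∈ V := (mapClusterPt_iff_frequently.1 hL) V (hV.mem_nhds (hLV rfl))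
  obtain ⟨N, hN1, hN2⟩ := (h3.and_eventually h2).exists
  exact Set.disjoint_left.1 hUV hN2 hN1

lemma gt3 (S : Finset ℂ) (h0 : (0:ℂ) ∉ S) (b : ℂ → ℂ) (a : ℕ → ℕ) (hpos : ∀ n, 1 ≤ n → 0 < a n)
    (ha : ∀ n, 1 ≤ n → (a n : ℂ) = ∑ s ∈ S, b s * s ^ n) :
    {L : ℝ | MapClusterPt L atTop (fun n : ℕ => Real.log (a n) / n)}.Finite := by
  obtain ⟨q, hq, hS⟩ := qex S
  exact fincl _ q hq (cls S h0 b a hpos ha q hq hS)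

end Sub

namespace Sub
open Polynomial

noncomputable def lr (r : ℂ) : PowerSeries ℂ := PowerSeries.mk fun n => if n = 0 then (if r = 0 then 1 else 0) else -(r⁻¹) ^ n

lemma lr_mul (r : ℂ) : ((X - C r : ℂ[X]) : PowerSeries ℂ) * lr r = PowerSeries.X := by
  rw [Polynomial.coe_sub, Polynomial.coe_X, Polynomial.coe_C, sub_mul]
  ext n
  rw [map_sub, PowerSeries.coeff_C_mul]
  cases n with
  | zero => by_cases h : r = 0 <;> simp [lr, h]
  | succ n =>
    rw [PowerSeries.coeff_succ_X_mul, PowerSeries.coeff_X]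
    by_cases h : r = 0
    · cases n <;> simp [lr, h]
    · cases n with
      | zero => simp [lr, h]
      | succ n => simp [lr, h, pow_succ]

lemma lr_prod (s : Multiset ℂ) : PowerSeries.X * ((derivative (s.map fun r => X - C r).prod : ℂ[X]) : PowerSeries ℂ) =
    (((s.map fun r => X - C r).prod : ℂ[X]) : PowerSeries ℂ) * (s.map lr).sum := by
  induction s using Multiset.induction with
  | empty => simp
  | cons r s ih =>
    rw [Multiset.map_cons, Multiset.prod_cons, Multiset.map_cons, Multiset.sum_cons, derivative_mul, derivative_sub, derivative_X, derivative_C, sub_zero, one_mul,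
      Polynomial.coe_add, Polynomial.coe_mul, mul_add, mul_left_comm, ih, Polynomial.coe_mul]
    conv_lhs => rw [← lr_mul r]
    ring

lemma lr_poly (F : ℂ[X]) : PowerSeries.X * ((derivative F : ℂ[X]) : PowerSeries ℂ) = (F : PowerSeries ℂ) * (F.roots.map lr).sum := by
  have h := (IsAlgClosed.splits F).eq_prod_roots
  have h1 := lr_prod F.roots
  set G := (F.roots.map fun r => X - C r).prod
  rw [h, derivative_mul, derivative_C, zero_mul, zero_add, Polynomial.coe_mul, Polynomial.coe_mul, mul_left_comm, h1, ← h, mul_assoc]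

def HS (G : PowerSeries ℝ) (z g : ℝ) : Prop := HasSum (fun n => PowerSeries.coeff n G * z ^ n) g

lemma HS.xmul {G : PowerSeries ℝ} {z g : ℝ} (h : HS G z g) : HS (PowerSeries.X * G) z (z * g) := by
  have := (hasSum_nat_add_iff (f := fun n => PowerSeries.coeff n (PowerSeries.X * G) * z ^ n) (g := z * g) 1).1 (by
    simp only [PowerSeries.coeff_succ_X_mul]
    have e : (fun n => PowerSeries.coeff n G * z ^ (n + 1)) = fun n => z * (PowerSeries.coeff n G * z ^ n) := by ext n; ring
    rw [e]; exact h.mul_left z)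
  unfold HS
  simpa using this

lemma HS.pmul {G : PowerSeries ℝ} {z g : ℝ} (h : HS G z g) (F : ℝ[X]) : HS ((F : PowerSeries ℝ) * G) z (F.eval z * g) := by
  induction F using Polynomial.induction_on with
  | C a =>
    unfold HS
    simp only [Polynomial.coe_C, PowerSeries.coeff_C_mul, eval_C, mul_assoc]
    exact h.mul_left a
  | add p q hp hq =>
    unfold HS
    simp only [Polynomial.coe_add, add_mul, map_add, eval_add]
    exact hp.add hq
  | monomial n a ih =>
    have := ih.xmul
    rw [← mul_assoc, ← Polynomial.coe_X, ← Polynomial.coe_mul] at this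
    have e1 : X * (C a * X ^ n) = C a * X ^ (n + 1) := by ring
    have e2 : z * (eval z (C a * X ^ n) * g) = eval z (C a * X ^ (n + 1)) * g := by simp; ring
    rwa [e1, e2] at this

lemma HS.one (z : ℝ) : HS 1 z 1 := by
  unfold HS
  convert hasSum_single (f := fun n => PowerSeries.coeff n (1 : PowerSeries ℝ) * z ^ n) 0 (fun n hn => by simp [PowerSeries.coeff_one, hn]) using 1
  simp

lemma HS.zero (G : PowerSeries ℝ) (h : ∀ᶠ z in nhds (0:ℝ), HS G z 0) : G = 0 := by
  have h1 : HasFPowerSeriesAt (0 : ℝ → ℝ) (FormalMultilinearSeries.ofScalars ℝ (fun n => PowerSeries.coeff n G)) 0 := by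
    rw [hasFPowerSeriesAt_iff]
    filter_upwards [h] with z hz
    have : ∀ n, z ^ n • (FormalMultilinearSeries.ofScalars ℝ (fun n => PowerSeries.coeff n G)).coeff n = PowerSeries.coeff n G * z ^ n := fun n => by
      simp [FormalMultilinearSeries.coeff_ofScalars, mul_comm]
    simp only [this]
    exact hz
  have h2 := h1.eq_zero
  ext n
  have := congrArg (fun p => FormalMultilinearSeries.coeff p n) h2
  simp only [FormalMultilinearSeries.coeff_ofScalars] at this
  rw [this]; rfl

end Sub

namespace Sub
open Polynomial

lemma formal (p : ℕ) (hp : 0 < p) (a : ℕ → ℕ) (hle : ∀ n, 1 ≤ n → a n ≤ p ^ n) (P Q : ℝ[X])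
    (h : ∀ z : ℝ, |z| < 1 / p → Real.exp (∑' n : ℕ, (a (n + 1) : ℝ) * z ^ (n + 1) / (n + 1)) * Q.eval z = P.eval z) :
    ((P * Q : ℝ[X]) : PowerSeries ℝ) * PowerSeries.mk (fun n => (a (n + 1) : ℝ)) = ((derivative P * Q - P * derivative Q : ℝ[X]) : PowerSeries ℝ) := by
  have hpR : (0:ℝ) < p := by exact_mod_cast hp
  set ρ : ℝ := 1 / (2 * p) with hρ
  have hρ0 : 0 < ρ := by positivity
  have hρp : ρ < 1 / p := by rw [hρ]; gcongr; linarith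
  have hb : ∀ (n : ℕ) (y : ℝ), |y| < ρ → ‖(a (n + 1) : ℝ) * y ^ n‖ ≤ p * (1 / 2) ^ n := fun n y hy => by
    rw [norm_mul, norm_pow, Real.norm_natCast, Real.norm_eq_abs]
    have h1 : (a (n + 1) : ℝ) ≤ p ^ (n + 1) := by exact_mod_cast hle (n + 1) (by omega)
    calc _ ≤ (p : ℝ) ^ (n + 1) * ρ ^ n := by gcongr
      _ = p * (p * ρ) ^ n := by rw [mul_pow]; ring
      _ = _ := by congr 2; rw [hρ]; field_simp
  have hsu : Summable fun n : ℕ => (p : ℝ) * (1 / 2) ^ n := (summable_geometric_of_lt_one (by norm_num) (by norm_num)).mul_left _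
  have hder : ∀ z : ℝ, |z| < ρ → HasDerivAt (fun z => ∑' n : ℕ, (a (n + 1) : ℝ) * z ^ (n + 1) / (n + 1)) (∑' n : ℕ, (a (n + 1) : ℝ) * z ^ n) z := fun z hz =>
    hasDerivAt_tsum_of_isPreconnected (t := Metric.ball 0 ρ) (y₀ := 0) hsu Metric.isOpen_ball (convex_ball _ _).isPreconnected
      (fun n y _ => by
        have := ((hasDerivAt_pow (n + 1) y).const_mul (a (n + 1) : ℝ)).div_const ((n : ℝ) + 1)
        refine this.congr_deriv ?_
        have : (n : ℝ) + 1 ≠ 0 := by positivity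
        push_cast; field_simp)
      (fun n y hy => hb n y (by simpa using hy)) (by simpa using hρ0) (by simp) (by simpa using hz)
  rw [← sub_eq_zero]
  refine HS.zero _ ?_
  filter_upwards [Metric.ball_mem_nhds (0:ℝ) hρ0] with z hz
  replace hz : |z| < ρ := by simpa using hz
  set S' := ∑' n : ℕ, (a (n + 1) : ℝ) * z ^ n with hS'
  have hHS : HS (PowerSeries.mk fun n => (a (n + 1) : ℝ)) z S' := by
    unfold HS
    simp only [PowerSeries.coeff_mk]
    exact (Summable.of_norm_bounded hsu fun n => hb n z hz).hasSum
  have h1 := ((hder z hz).exp.mul (Q.hasDerivAt z)).unique ((P.hasDerivAt z).congr_of_eventuallyEq (by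
    filter_upwards [(isOpen_lt continuous_abs continuous_const).mem_nhds (show |z| < 1 / p from hz.trans hρp)] with y hy
    exact h y hy))
  have h2 := h z (hz.trans hρp)
  have h3 := (hHS.pmul (P * Q)).sub ((HS.one z).pmul (derivative P * Q - P * derivative Q))
  have h4 : eval z (P * Q) * S' - eval z (derivative P * Q - P * derivative Q) * 1 = 0 := by
    simp only [eval_mul, eval_sub, mul_one]
    rw [← h1, ← h2]; ring
  rw [h4] at h3
  unfold HS
  simpa only [mul_one, map_sub, sub_mul] using h3

lemma fin0 (p : ℕ) (hp : 0 < p) (a : ℕ → ℕ) (hle : ∀ n, 1 ≤ n → a n ≤ p ^ n) (P Q : ℝ[X]) (hQ : Q ≠ 0)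
    (h : ∀ z : ℝ, |z| < 1 / p → Real.exp (∑' n : ℕ, (a (n + 1) : ℝ) * z ^ (n + 1) / (n + 1)) * Q.eval z = P.eval z) :
    ∃ (S : Finset ℂ) (b : ℂ → ℂ), (0:ℂ) ∉ S ∧ ∀ n, 1 ≤ n → (a n : ℂ) = ∑ s ∈ S, b s * s ^ n := by
  classical
  have hpR : (0:ℝ) < p := by exact_mod_cast hp
  have hP : P ≠ 0 := fun hP0 => by
    refine hQ (Polynomial.eq_zero_of_infinite_isRoot Q (Set.Infinite.mono (s := Set.Ioo 0 (1 / (p:ℝ))) (fun z hz => ?_) (Set.Ioo_infinite (by positivity))))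
    have := h z (by rw [abs_of_pos hz.1]; exact hz.2)
    rw [hP0, eval_zero] at this
    exact (mul_eq_zero.1 this).resolve_left (Real.exp_pos _).ne'
  have hf := congrArg (PowerSeries.map (algebraMap ℝ ℂ)) (formal p hp a hle P Q h)
  set P' := P.map (algebraMap ℝ ℂ) with hP'
  set Q' := Q.map (algebraMap ℝ ℂ) with hQ'
  have hP0 : P' ≠ 0 := (Polynomial.map_ne_zero_iff (algebraMap ℝ ℂ).injective).2 hP
  have hQ0 : Q' ≠ 0 := (Polynomial.map_ne_zero_iff (algebraMap ℝ ℂ).injective).2 hQ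
  rw [map_mul, ← Polynomial.polynomial_map_coe, ← Polynomial.polynomial_map_coe, Polynomial.map_sub, Polynomial.map_mul, Polynomial.map_mul, Polynomial.map_mul, ← derivative_map, ← derivative_map, ← hP', ← hQ'] at hf
  set M := PowerSeries.map (algebraMap ℝ ℂ) (PowerSeries.mk fun n => (a (n + 1) : ℝ)) with hM
  have hPQ : ((P' * Q' : ℂ[X]) : PowerSeries ℂ) ≠ 0 := by
    rw [Ne, Polynomial.coe_eq_zero_iff]; exact mul_ne_zero hP0 hQ0
  have key : PowerSeries.X * M = (P'.roots.map lr).sum - (Q'.roots.map lr).sum := by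
    refine mul_left_cancel₀ hPQ ?_
    rw [mul_left_comm, hf, Polynomial.coe_sub, Polynomial.coe_mul, Polynomial.coe_mul, Polynomial.coe_mul]
    have h1 := lr_poly P'
    have h2 := lr_poly Q'
    linear_combination (Q' : PowerSeries ℂ) * h1 - (P' : PowerSeries ℂ) * h2
  set W := (P'.roots + Q'.roots).toFinset with hW
  have hcoef : ∀ (s : Multiset ℂ), s ≤ P'.roots + Q'.roots → ∀ n, 1 ≤ n → PowerSeries.coeff n (s.map lr).sum = ∑ r ∈ W, (s.count r : ℂ) * -(r⁻¹) ^ n := fun s hs n hn => by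
    have hlr : ∀ r, PowerSeries.coeff n (lr r) = -(r⁻¹) ^ n := fun r => by
      simp [lr, show n ≠ 0 by omega]
    rw [map_multiset_sum, Multiset.map_map, Finset.sum_multiset_map_count]
    simp only [Function.comp, hlr, nsmul_eq_mul]
    refine Finset.sum_subset (Multiset.toFinset_subset.2 (Multiset.subset_of_le hs)) fun r _ hr => ?_
    rw [Multiset.count_eq_zero.2 (by simpa using hr)]; simp
  have ha : ∀ n, 1 ≤ n → (a n : ℂ) = ∑ r ∈ W, ((Q'.roots.count r : ℂ) - P'.roots.count r) * (r⁻¹) ^ n := fun n hn => by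
    have h1 := congrArg (PowerSeries.coeff n) key
    obtain ⟨k, rfl⟩ : ∃ k, n = k + 1 := ⟨n - 1, by omega⟩
    rw [PowerSeries.coeff_succ_X_mul, map_sub, hcoef _ (Multiset.le_add_right _ _) _ hn, hcoef _ (Multiset.le_add_left _ _) _ hn, hM, PowerSeries.coeff_map, PowerSeries.coeff_mk, ← Finset.sum_sub_distrib] at h1
    have h2 : (algebraMap ℝ ℂ) (a (k + 1) : ℝ) = (a (k + 1) : ℂ) := by simp
    rw [← h2, h1]
    exact Finset.sum_congr rfl fun r _ => by ring
  refine ⟨(W.erase 0).image (·⁻¹), fun s => (Q'.roots.count s⁻¹ : ℂ) - P'.roots.count s⁻¹, by simp, fun n hn => ?_⟩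
  rw [ha n hn, Finset.sum_image (fun _ _ _ _ h => inv_injective h), Finset.sum_erase _ (by simp [show n ≠ 0 by omega])]
  simp

end Sub

/-- if (a_n) are positive integers with a_n ≤ p^n and the set of
limit points of (1/n) log a_n is infinite, then ζ(z) = exp(∑ a_n z^n / n) is not
a rational function. -/
theorem stmt14 (p : ℕ) (hp : p.Prime) (a : ℕ → ℕ)
    (hpos : ∀ n, 1 ≤ n → 0 < a n) (hle : ∀ n, 1 ≤ n → a n ≤ p ^ n)
    (hlim : {L : ℝ |
      MapClusterPt L atTop (fun n : ℕ => Real.log (a n) / n)}.Infinite) :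
    ¬ ∃ P Q : Polynomial ℝ, Q ≠ 0 ∧
      ∀ z : ℝ, |z| < 1 / p →
        Real.exp (∑' n : ℕ, (a (n + 1) : ℝ) * z ^ (n + 1) / (n + 1)) *
            Q.eval z = P.eval z := by
  rintro ⟨P, Q, hQ, h⟩
  obtain ⟨S, b, h0, ha⟩ := Sub.fin0 p hp.pos a hle P Q hQ h
  exact hlim (Sub.gt3 S h0 b a hpos ha)
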